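/- arXiv:1308.2698 — 3 statements merged into one kernel-verified Lean document; each statement's English description precedes it below -/
import Mathlib

section
/- Let M be a positroid on [n] and suppose M = M_1 ⊕ M_2 ⊕ ... ⊕ M_t is its decomposition into connected components, i.e. each M_i is a connected matroid on a nonempty ground set S_i and the sets S_1,...,S_t partition [n]. Then {S_1,...,S_t} is a non-crossing partition of [n]. -/
open Finset

/-- A full-row-rank real `d × n` matrix is *totally nonnegative* if all of its
maximal (`d × d`) minors are nonnegative.  Columns are indexed by a finite
linearly ordered set `E`; a maximal minor is indexed by a strictly increasing
choice of `d` columns. -/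
def Matrix.TotallyNonneg {d : ℕ} {E : Type*} [Fintype E] [LinearOrder E]
    (A : Matrix (Fin d) E ℝ) : Prop :=
  A.rank = d ∧ ∀ f : Fin d → E, StrictMono f → 0 ≤ (A.submatrix id f).det

/-- `ℬ` is the collection of bases of the column matroid `M(A)`: the `d`-element
sets of column indices whose columns are linearly independent. -/
def Matrix.RepresentsBases {d : ℕ} {E : Type*} [Fintype E]
    (A : Matrix (Fin d) E ℝ) (ℬ : Finset E → Prop) : Prop :=
  ∀ B : Finset E, ℬ B ↔ B.card = d ∧ LinearIndependent ℝ (fun j : B => fun i => A i j.1)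

/-- A positroid of rank `d` on the finite linearly ordered ground set `E`,
given by its collection of bases `ℬ`. -/
def IsPositroidOfRank (d : ℕ) {E : Type*} [Fintype E] [LinearOrder E]
    (ℬ : Finset E → Prop) : Prop :=
  ∃ A : Matrix (Fin d) E ℝ, A.TotallyNonneg ∧ A.RepresentsBases ℬ

/-- A positroid on the finite linearly ordered ground set `E`. -/
def IsPositroid {E : Type*} [Fintype E] [LinearOrder E] (ℬ : Finset E → Prop) : Prop :=
  ∃ d, IsPositroidOfRank d ℬ


/-- The basis-exchange axiom: `ℬ` is the (nonempty) collection of bases of a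
matroid on the ground set `E`. -/
def IsBasesSet {E : Type*} [DecidableEq E] (ℬ : Finset E → Prop) : Prop :=
  (∃ B, ℬ B) ∧
  ∀ ⦃B₁ B₂ : Finset E⦄, ℬ B₁ → ℬ B₂ → ∀ b₁ ∈ B₁ \ B₂,
    ∃ b₂ ∈ B₂ \ B₁, ℬ (insert b₂ (B₁.erase b₁))

/-- Lexicographic order on two `d`-element subsets of `Fin n` (with respect to
the standard order): comparing the increasing enumerations `s_1 < ... < s_d`
and `t_1 < ... < t_d`, either they agree or they first differ at an index `k`
where `s_k < t_k`. -/
def LexLE {n : ℕ} (d : ℕ) (S T : Finset (Fin n)) : Prop :=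
  ∃ (hS : S.card = d) (hT : T.card = d),
    S = T ∨ ∃ k : Fin d,
      (∀ l, l < k → ((S.orderIsoOfFin hS) l : Fin n) = ((T.orderIsoOfFin hT) l : Fin n)) ∧
      ((S.orderIsoOfFin hS) k : Fin n) < ((T.orderIsoOfFin hT) k : Fin n)

/-- Gale order on two `d`-element subsets of `Fin n` (with respect to the
standard order): the increasing enumerations satisfy `s_k ≤ t_k` for all `k`. -/
def GaleLE {n : ℕ} (d : ℕ) (S T : Finset (Fin n)) : Prop :=
  ∃ (hS : S.card = d) (hT : T.card = d),
    ∀ k : Fin d, ((S.orderIsoOfFin hS) k : Fin n) ≤ ((T.orderIsoOfFin hT) k : Fin n)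

/-- Transfer of a basis collection supported on a subset `S ⊆ Fin n` to a basis
collection on the ground set `S` itself (a subtype carrying the inherited
order). -/
def toSubtypePred {n : ℕ} (S : Finset (Fin n)) (ℬ : Finset (Fin n) → Prop) :
    Finset {x : Fin n // x ∈ S} → Prop :=
  fun C => ℬ (C.map (Function.Embedding.subtype fun x => x ∈ S))

/-- A matroid (given by its basis collection `ℬ` on the ground set `E`) is
*connected* if it cannot be written as the direct sum of two matroids on
nonempty ground sets. -/
def MatroidConnected {E : Type*} [Fintype E] [DecidableEq E] (ℬ : Finset E → Prop) : Prop :=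
  ¬ ∃ (E₁ E₂ : Finset E) (ℬ₁ ℬ₂ : Finset E → Prop),
      E₁.Nonempty ∧ E₂.Nonempty ∧ Disjoint E₁ E₂ ∧ E₁ ∪ E₂ = Finset.univ ∧
      IsBasesSet ℬ₁ ∧ IsBasesSet ℬ₂ ∧
      (∀ B, ℬ₁ B → B ⊆ E₁) ∧ (∀ B, ℬ₂ B → B ⊆ E₂) ∧
      (∀ B, ℬ B ↔ ∃ B₁ B₂, ℬ₁ B₁ ∧ ℬ₂ B₂ ∧ B = B₁ ∪ B₂)

/-- `a, b, c, d` are (distinct and) in cyclic order in `Fin m`. -/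
def Cyc4 {m : ℕ} (a b c d : Fin m) : Prop :=
  0 < (b - a).val ∧ (b - a).val < (c - a).val ∧ (c - a).val < (d - a).val

/-- A family `S` of subsets of `[n]` is non-crossing: there are no `a, b, c, d`
in cyclic order with `a, c` in one member and `b, d` in a different member. -/
def NonCrossingFam {n t : ℕ} (S : Fin t → Finset (Fin n)) : Prop :=
  ¬ ∃ (i j : Fin t) (a b c d : Fin n), i ≠ j ∧
      a ∈ S i ∧ c ∈ S i ∧ b ∈ S j ∧ d ∈ S j ∧ Cyc4 a b c d


section MatroidPart
set_option linter.unusedSectionVars false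

variable {E : Type*} [Fintype E] [DecidableEq E]

/-- The Mathlib matroid attached to a family of bases. -/
def toMatroid {ℬ : Finset E → Prop} (h : IsBasesSet ℬ) : Matroid E :=
  Matroid.ofIsBaseOfFinite (E := Set.univ) Set.finite_univ (fun s => ∃ B : Finset E, (B : Set E) = s ∧ ℬ B)
    (by obtain ⟨B, hB⟩ := h.1; exact ⟨_, B, rfl, hB⟩)
    (by
      rintro _ _ ⟨X, rfl, hX⟩ ⟨Y, rfl, hY⟩ a ha
      obtain ⟨b, hb, hb'⟩ := h.2 hX hY a (by simpa using ha)
      refine ⟨b, by simpa using hb, _, ?_, hb'⟩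
      simp)
    (fun _ _ => Set.subset_univ _)

lemma toMatroid_isBase {ℬ : Finset E → Prop} (h : IsBasesSet ℬ) (B : Finset E) :
    (toMatroid h).IsBase (B : Set E) ↔ ℬ B := by
  constructor
  · rintro ⟨B', hB', h'⟩
    rw [Finset.coe_inj] at hB'
    exact hB' ▸ h'
  · intro h'
    exact ⟨B, rfl, h'⟩

lemma toMatroid_E {ℬ : Finset E → Prop} (h : IsBasesSet ℬ) : (toMatroid h).E = Set.univ := rfl

/-- Adjacency in the fundamental graph of a basis. -/
def FAdj (ℬ : Finset E → Prop) (B : Finset E) (x y : E) : Prop :=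
  (x ∈ B ∧ y ∉ B ∧ ℬ (insert y (B.erase x))) ∨ (y ∈ B ∧ x ∉ B ∧ ℬ (insert x (B.erase y)))

lemma basis_union_isBase (M : Matroid E) (hE : M.E = Set.univ) {E₁ E₂ B X Y : Set E}
    (hd : Disjoint E₁ E₂) (hu : E₁ ∪ E₂ = Set.univ) (hB : M.IsBase B)
    (h1 : M.IsBasis (B ∩ E₁) E₁) (h2 : M.IsBasis (B ∩ E₂) E₂)
    (hX : M.IsBasis X E₁) (hY : M.IsBasis Y E₂) : M.IsBase (X ∪ Y) := by
  have hsp : M.Spanning (X ∪ Y) := by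
    rw [Matroid.spanning_iff_ground_subset_closure (by rw [hE]; exact Set.subset_univ _), hE, ← hu]
    apply Set.union_subset
    · exact hX.subset_closure.trans (M.closure_subset_closure Set.subset_union_left)
    · exact hY.subset_closure.trans (M.closure_subset_closure Set.subset_union_right)
  obtain ⟨D, hD, hDs⟩ := hsp.exists_isBase_subset
  have hXY : Disjoint X Y := hd.mono hX.subset hY.subset
  have hBB : B = (B ∩ E₁) ∪ (B ∩ E₂) := by rw [← Set.inter_union_distrib_left, hu, Set.inter_univ]
  have hBd : Disjoint (B ∩ E₁) (B ∩ E₂) := hd.mono Set.inter_subset_right Set.inter_subset_right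
  have : (X ∪ Y).encard = D.encard := by
    rw [hD.encard_eq_encard_of_isBase hB, hBB, Set.encard_union_eq hXY, Set.encard_union_eq hBd,
      hX.encard_eq_encard h1, hY.encard_eq_encard h2]
  rw [← Set.Finite.eq_of_subset_of_encard_le (Set.toFinite _) hDs this.le]
  exact hD

lemma isBase_inter_basis (M : Matroid E) (hE : M.E = Set.univ) {E₁ E₂ B D : Set E}
    (hd : Disjoint E₁ E₂) (hu : E₁ ∪ E₂ = Set.univ) (hB : M.IsBase B)
    (h1 : M.IsBasis (B ∩ E₁) E₁) (h2 : M.IsBasis (B ∩ E₂) E₂)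
    (hD : M.IsBase D) : M.IsBasis (D ∩ E₁) E₁ ∧ M.IsBasis (D ∩ E₂) E₂ := by
  obtain ⟨X, hX, hDX⟩ := (hD.indep.inter_right E₁).subset_isBasis_of_subset Set.inter_subset_right
    (by rw [hE]; exact Set.subset_univ _)
  obtain ⟨Y, hY, hDY⟩ := (hD.indep.inter_right E₂).subset_isBasis_of_subset Set.inter_subset_right
    (by rw [hE]; exact Set.subset_univ _)
  have hXY := basis_union_isBase M hE hd hu hB h1 h2 hX hY
  have hDD : D = (D ∩ E₁) ∪ (D ∩ E₂) := by rw [← Set.inter_union_distrib_left, hu, Set.inter_univ]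
  have hs : D ⊆ X ∪ Y := by rw [hDD]; exact Set.union_subset_union hDX hDY
  have := hD.eq_of_subset_isBase hXY hs
  have hX1 := hX.subset
  have hY1 := hY.subset
  have e1 : D ∩ E₁ = X := by
    apply hDX.antisymm
    exact Set.subset_inter (this ▸ Set.subset_union_left) hX1
  have e2 : D ∩ E₂ = Y := by
    apply hDY.antisymm
    exact Set.subset_inter (this ▸ Set.subset_union_right) hY1
  rw [e1, e2]
  exact ⟨hX, hY⟩

lemma half_basis {ℬ : Finset E → Prop} (h : IsBasesSet ℬ) {B : Finset E} (hB : ℬ B) (P : Set E)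
    (hP : ∀ x ∉ P, ∀ y ∈ P, ¬ FAdj ℬ B x y) :
    (toMatroid h).IsBasis ((B : Set E) ∩ P) P := by
  have hBM := (toMatroid_isBase h B).2 hB
  have hind : (toMatroid h).Indep ((B : Set E) ∩ P) := hBM.indep.inter_right P
  refine hind.isBasis_of_subset_of_subset_closure Set.inter_subset_right ?_
  intro y hy
  by_contra hcl
  rw [hind.notMem_closure_iff (by rw [toMatroid_E]; trivial)] at hcl
  obtain ⟨hi, hyB⟩ := hcl
  have hyB' : y ∉ B := fun h => hyB ⟨h, hy⟩
  obtain ⟨D, hD, hs, hsD⟩ := hi.exists_isBase_subset_union_isBase hBM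
  obtain ⟨D', rfl, hD'⟩ := hD
  have hDM := (toMatroid_isBase h D').2 hD'
  have hyD : y ∈ D' := by simpa using hs (Set.mem_insert _ _)
  have hDB : D' ⊆ insert y B := by
    intro z hz
    have := hsD hz
    simp at this ⊢
    tauto
  have hc : D'.card = B.card := by
    have := hDM.ncard_eq_ncard_of_isBase hBM
    simpa [Set.ncard_coe_finset] using this
  have : ∃ x ∈ B, x ∉ D' := by
    by_contra! hcon
    have : insert y B ⊆ D' := Finset.insert_subset hyD hcon
    have := Finset.card_le_card this
    rw [Finset.card_insert_of_notMem hyB'] at this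
    omega
  obtain ⟨x, hxB, hxD⟩ := this
  have hxP : x ∉ P := fun hx => hxD (by simpa using hs (Set.mem_insert_of_mem _ ⟨hxB, hx⟩))
  refine hP x hxP y hy (Or.inl ⟨hxB, hyB', ?_⟩)
  have : D' = insert y (B.erase x) := by
    apply Finset.eq_of_subset_of_card_le
    · intro z hz
      have := hDB hz
      have : z ≠ x := fun h => hxD (h ▸ hz)
      simp_all
    · rw [Finset.card_insert_of_notMem (by simp [hyB']), Finset.card_erase_of_mem hxB, hc]
      have := Finset.card_pos.2 ⟨x, hxB⟩
      omega
  exact this ▸ hD'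

lemma FAdj.symm' {ℬ : Finset E → Prop} {B : Finset E} {x y : E} (h : FAdj ℬ B x y) :
    FAdj ℬ B y x := Or.symm h

lemma basesSet_restrict (M : Matroid E) (hE : M.E = Set.univ) (P : Set E) :
    IsBasesSet (fun X : Finset E => M.IsBasis (X : Set E) P) := by
  have hP : P ⊆ M.E := by rw [hE]; exact Set.subset_univ _
  constructor
  · obtain ⟨X, hX⟩ := M.exists_isBasis P
    refine ⟨(Set.toFinite X).toFinset, by simpa using hX⟩
  · intro X Y hX hY x hx
    rw [← Matroid.isBase_restrict_iff hP] at hX hY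
    obtain ⟨y, hy, hy'⟩ := (M.restrict P).isBase_exchange _ _ hX hY x (by simpa using hx)
    refine ⟨y, by simpa using hy, ?_⟩
    beta_reduce
    rw [← Matroid.isBase_restrict_iff hP]
    simpa using hy'

lemma reach_of_connected {ℬ : Finset E → Prop} (h : IsBasesSet ℬ) (hc : MatroidConnected ℬ)
    {B : Finset E} (hB : ℬ B) (a c : E) : Relation.ReflTransGen (FAdj ℬ B) a c := by
  classical
  by_contra hac
  apply hc
  let E₁ : Finset E := univ.filter (fun x => Relation.ReflTransGen (FAdj ℬ B) a x)
  let E₂ : Finset E := univ.filter (fun x => ¬ Relation.ReflTransGen (FAdj ℬ B) a x)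
  have hd : Disjoint E₁ E₂ := Finset.disjoint_filter_filter_not _ _ _
  have hu : E₁ ∪ E₂ = univ := Finset.filter_union_filter_not_eq _ _
  have hd' : Disjoint (E₁ : Set E) E₂ := by simpa using hd
  have hu' : (E₁ : Set E) ∪ E₂ = Set.univ := by
    rw [← Finset.coe_union, hu, Finset.coe_univ]
  have hE := toMatroid_E h
  have hBM := (toMatroid_isBase h B).2 hB
  have hb1 : (toMatroid h).IsBasis ((B : Set E) ∩ E₁) E₁ := by
    apply half_basis h hB
    intro x hx y hy hxy
    simp only [E₁, Finset.coe_filter, Finset.mem_univ, true_and, Set.mem_ofPred_eq] at hx hy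
    exact hx (hy.tail hxy.symm')
  have hb2 : (toMatroid h).IsBasis ((B : Set E) ∩ E₂) E₂ := by
    apply half_basis h hB
    intro x hx y hy hxy
    simp only [E₂, Finset.coe_filter, Finset.mem_univ, true_and, Set.mem_ofPred_eq, not_not] at hx hy
    exact hy (hx.tail hxy)
  refine ⟨E₁, E₂, _, _, ⟨a, by simp [E₁, Relation.ReflTransGen.refl]⟩, ⟨c, by simp [E₂, hac]⟩, hd, hu,
    basesSet_restrict (toMatroid h) hE E₁, basesSet_restrict (toMatroid h) hE E₂,
    fun B hB => by simpa using hB.subset, fun B hB => by simpa using hB.subset, ?_⟩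
  intro D
  rw [← toMatroid_isBase h]
  constructor
  · intro hD
    obtain ⟨h1, h2⟩ := isBase_inter_basis _ hE hd' hu' hBM hb1 hb2 hD
    refine ⟨D ∩ E₁, D ∩ E₂, by simpa using h1, by simpa using h2, ?_⟩
    rw [← Finset.inter_union_distrib_left, hu, Finset.inter_univ]
  · rintro ⟨X, Y, hX, hY, rfl⟩
    rw [Finset.coe_union]
    exact basis_union_isBase _ hE hd' hu' hBM hb1 hb2 hX hY

/-- Double exchange. -/
lemma double_exchange {ℬ : Finset E → Prop} (h : IsBasesSet ℬ) {B : Finset E} {x x' y y' : E}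
    (hx : x ∈ B) (hx' : x' ∈ B) (hy : y ∉ B) (hy' : y' ∉ B) (hxx : x ≠ x') (hyy : y ≠ y')
    (h1 : ℬ (insert y (B.erase x))) (h2 : ℬ (insert y' (B.erase x')))
    (h3 : ¬ ℬ (insert y' (B.erase x))) :
    ℬ (insert y (insert y' ((B.erase x).erase x'))) := by
  obtain ⟨z, hz, hz'⟩ := h.2 h2 h1 x (by grind)
  have : z = y ∨ z = x' := by grind
  rcases this with rfl | rfl
  · convert hz' using 1; grind
  · exact absurd (by convert hz' using 1; grind) h3

lemma walk_exchange {ℬ : Finset E → Prop} (h : IsBasesSet ℬ) (k : ℕ) :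
    ∀ (B : Finset E) (v : ℕ → E), ℬ B → (∀ i < k, FAdj ℬ B (v i) (v (i+1))) → v 0 ≠ v k →
      ∃ B, ℬ B ∧ FAdj ℬ B (v 0) (v k) := by
  induction k using Nat.strong_induction_on with
  | _ k ih =>
  intro B v hB hv hne
  have hk0 : k ≠ 0 := by rintro rfl; exact hne rfl
  by_cases hk1 : k = 1
  · subst hk1; exact ⟨B, hB, hv 0 (by omega)⟩
  by_cases hA : ∃ i, 2 ≤ i ∧ i ≤ k ∧ FAdj ℬ B (v 0) (v i)
  · obtain ⟨i, hi2, hik, hi⟩ := hA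
    have := ih (k - i + 1) (by omega) B (fun j => if j = 0 then v 0 else v (i + j - 1)) hB ?_ ?_
    · have e : i + (k - i + 1) - 1 = k := by omega
      simpa [e] using this
    · intro j hj
      by_cases hj0 : j = 0
      · subst hj0; simpa using hi
      · have e : i + (j + 1) - 1 = (i + j - 1) + 1 := by omega
        simp only [hj0, if_false, Nat.add_eq_zero_iff, one_ne_zero, and_false, e]
        exact hv _ (by omega)
    · have e : i + (k - i + 1) - 1 = k := by omega
      simpa [e] using hne
  by_cases hR : ∃ i, 1 ≤ i ∧ i ≤ k ∧ v 0 = v i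
  · obtain ⟨i, hi1, hik, hi⟩ := hR
    have := ih (k - i) (by omega) B (fun j => v (i + j)) hB ?_ ?_
    · have e : i + (k - i) = k := by omega
      simpa [e, ← hi] using this
    · intro j hj
      exact hv (i + j) (by omega)
    · have e : i + (k - i) = k := by omega
      simpa [e, ← hi] using hne
  push Not at hA hR
  have h01 := hv 0 (by omega)
  have h12 := hv 1 (by omega)
  simp only [zero_add, Nat.reduceAdd] at h01 h12
  have hv1 : ∀ i, 2 ≤ i → i ≤ k → v 1 ≠ v i := by
    intro i h2 hik he
    exact hA i h2 hik (he ▸ h01)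
  have h02 := hR 2 (by omega) (by omega)
  -- the pivoted basis
  obtain ⟨B', hB', hB'1⟩ : ∃ B', ℬ B' ∧ ((v 0 ∈ B ∧ v 1 ∉ B ∧ B' = insert (v 1) (B.erase (v 0))) ∨
      (v 1 ∈ B ∧ v 0 ∉ B ∧ B' = insert (v 0) (B.erase (v 1)))) := by
    rcases h01 with ⟨p, q, r⟩ | ⟨p, q, r⟩
    · exact ⟨_, r, Or.inl ⟨p, q, rfl⟩⟩
    · exact ⟨_, r, Or.inr ⟨p, q, rfl⟩⟩
  have := ih (k - 1) (by omega) B' (fun j => if j = 0 then v 0 else v (j + 1)) hB' ?_ ?_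
  · have e : k - 1 + 1 = k := by omega
    have e' : k - 1 ≠ 0 := by omega
    simpa [e, e'] using this
  · intro j hj
    by_cases hj0 : j = 0
    · subst hj0
      simp only [if_true, zero_add, one_ne_zero, if_false, Nat.reduceAdd]
      have n12 := hv1 2 (by omega) (by omega)
      rcases hB'1 with ⟨p, q, rfl⟩ | ⟨p, q, rfl⟩
      · rcases h12 with ⟨p', q', r'⟩ | ⟨p', q', r'⟩
        · exact absurd p' q
        · refine Or.inr ⟨by grind, by grind, ?_⟩
          convert r' using 1
          grind
      · rcases h12 with ⟨p', q', r'⟩ | ⟨p', q', r'⟩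
        · refine Or.inl ⟨by grind, by grind, ?_⟩
          convert r' using 1
          grind
        · exact absurd p q'
    · simp only [hj0, if_false, Nat.add_eq_zero_iff, one_ne_zero, and_false]
      have hs := hv (j + 1) (by omega)
      have a1 := hR (j + 1) (by omega) (by omega)
      have a2 := hR (j + 1 + 1) (by omega) (by omega)
      have b1 := hv1 (j + 1) (by omega) (by omega)
      have b2 := hv1 (j + 1 + 1) (by omega) (by omega)
      have c1 := hA (j + 1) (by omega) (by omega)
      have c2 := hA (j + 1 + 1) (by omega) (by omega)
      generalize v (j + 1) = s at *
      generalize v (j + 1 + 1) = t at *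
      have key : ∀ s t : E, v 0 ≠ s → v 0 ≠ t → v 1 ≠ s → v 1 ≠ t → ¬ FAdj ℬ B (v 0) s →
          ¬ FAdj ℬ B (v 0) t → s ∈ B → t ∉ B → ℬ (insert t (B.erase s)) →
          s ∈ B' ∧ t ∉ B' ∧ ℬ (insert t (B'.erase s)) := by
        intro s t a1 a2 b1 b2 c1 c2 hs ht hst
        rcases hB'1 with ⟨p, q, rfl⟩ | ⟨p, q, rfl⟩
        · refine ⟨by grind, by grind, ?_⟩
          have h1 : ℬ (insert (v 1) (B.erase (v 0))) := hB'
          have := double_exchange h p hs q ht a1 b2 h1 hst (fun hh => c2 (Or.inl ⟨p, ht, hh⟩))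
          convert this using 1
          grind
        · refine ⟨by grind, by grind, ?_⟩
          have h1 : ℬ (insert (v 0) (B.erase (v 1))) := hB'
          have := double_exchange h hs p ht q b1.symm a2.symm hst h1 (fun hh => c1 (Or.inr ⟨hs, q, hh⟩))
          convert this using 1
          grind
      rcases hs with ⟨p, q, r⟩ | ⟨p, q, r⟩
      · exact Or.inl (key s t a1 a2 b1 b2 c1 c2 p q r)
      · exact Or.inr (key t s a2 a1 b2 b1 c2 c1 p q r)
  · have e : k - 1 + 1 = k := by omega
    have e' : k - 1 ≠ 0 := by omega
    simpa [e, e'] using hne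

lemma walk_of_reach {r : E → E → Prop} {a c : E} (h : Relation.ReflTransGen r a c) :
    ∃ (k : ℕ) (v : ℕ → E), v 0 = a ∧ v k = c ∧ ∀ i < k, r (v i) (v (i+1)) := by
  induction h with
  | refl => exact ⟨0, fun _ => a, rfl, rfl, by simp⟩
  | @tail b c hb hbc ih =>
    obtain ⟨k, v, h0, hk, hv⟩ := ih
    refine ⟨k + 1, fun j => if j ≤ k then v j else c, by simp [h0], by simp, ?_⟩
    intro i hi
    by_cases hik : i = k
    · subst hik; simpa [hk] using hbc
    · have h1 : i ≤ k := by omega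
      have h2 : i + 1 ≤ k := by omega
      simpa [h1, h2] using hv i (by omega)

/-- In a connected matroid, two distinct elements can be exchanged in some basis. -/
lemma exists_exchange {ℬ : Finset E → Prop} (h : IsBasesSet ℬ) (hc : MatroidConnected ℬ)
    {a c : E} (hac : a ≠ c) :
    ∃ K : Finset E, a ∉ K ∧ c ∉ K ∧ ℬ (insert a K) ∧ ℬ (insert c K) := by
  obtain ⟨B, hB⟩ := h.1
  obtain ⟨k, v, h0, hk, hv⟩ := walk_of_reach (reach_of_connected h hc hB a c)
  obtain ⟨D, hD, hD'⟩ := walk_exchange h k B v hB hv (by rw [h0, hk]; exact hac)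
  rw [h0, hk] at hD'
  rcases hD' with ⟨p, q, r⟩ | ⟨p, q, r⟩
  · exact ⟨D.erase a, by simp, by simp [q], by rwa [Finset.insert_erase p], r⟩
  · exact ⟨D.erase c, by simp [q], by simp, r, by rwa [Finset.insert_erase p]⟩

end MatroidPart

section MatrixPart

/-- Vandermonde determinant of a tuple of indices; used to keep track of signs. -/
noncomputable def vdm {n d : ℕ} (e : Fin d → Fin n) : ℝ :=
  (Matrix.vandermonde (fun i => ((e i : ℕ) : ℝ))).det

lemma det_mul_vdm_nonneg {n d : ℕ} (A : Matrix (Fin d) (Fin n) ℝ) (hA : A.TotallyNonneg)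
    (e : Fin d → Fin n) (he : Function.Injective e) :
    0 ≤ (A.submatrix id e).det * vdm e := by
  let σ := Tuple.sort e
  have hs : StrictMono (e ∘ σ) :=
    (Tuple.monotone_sort e).strictMono_of_injective (he.comp σ.injective)
  have h1 := hA.2 _ hs
  have h2 : 0 ≤ vdm (e ∘ σ) := by
    unfold vdm
    rw [Matrix.det_vandermonde]
    refine Finset.prod_nonneg fun i _ => Finset.prod_nonneg fun j hj => ?_
    have : (e ∘ σ) i < (e ∘ σ) j := hs (by simpa using hj)
    rw [sub_nonneg, Nat.cast_le]
    exact this.le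
  have e1 : (A.submatrix id (e ∘ σ)).det = (Equiv.Perm.sign σ : ℝ) * (A.submatrix id e).det := by
    rw [← Matrix.det_permute' σ (A.submatrix id e)]
    rfl
  have e2 : vdm (e ∘ σ) = (Equiv.Perm.sign σ : ℝ) * vdm e := by
    unfold vdm
    rw [← Matrix.det_permute σ]
    rfl
  have h3 := mul_nonneg h1 h2
  rw [e1, e2] at h3
  have hsg : ((Equiv.Perm.sign σ : ℤ) : ℝ) * ((Equiv.Perm.sign σ : ℤ) : ℝ) = 1 := by
    rcases Int.units_eq_one_or (Equiv.Perm.sign σ) with h | h <;> simp [h]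
  calc 0 ≤ _ := h3
    _ = (((Equiv.Perm.sign σ : ℤ) : ℝ) * ((Equiv.Perm.sign σ : ℤ) : ℝ)) *
        ((A.submatrix id e).det * vdm e) := by ring
    _ = _ := by rw [hsg, one_mul]

/-- prepend two indices -/
def pre2 {n m : ℕ} (x y : Fin n) (k : Fin m → Fin n) : Fin (m + 2) → Fin n :=
  Fin.cons x (Fin.cons y k)

lemma vdm_pre2 {n m : ℕ} (x y : Fin n) (k : Fin m → Fin n) :
    vdm (pre2 x y k) = (((y : ℕ) : ℝ) - ((x : ℕ) : ℝ)) *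
      (∏ l, (((k l : ℕ) : ℝ) - ((x : ℕ) : ℝ))) * (∏ l, (((k l : ℕ) : ℝ) - ((y : ℕ) : ℝ))) * vdm k := by
  unfold vdm pre2
  rw [Matrix.det_vandermonde, Matrix.det_vandermonde, Fin.prod_univ_succ, Fin.prod_univ_succ]
  simp only [Fin.prod_Ioi_zero, Fin.prod_Ioi_succ, Fin.prod_univ_succ, Fin.cons_zero, Fin.cons_succ]
  ring

lemma pre2_injective {n m : ℕ} {x y : Fin n} {k : Fin m → Fin n} (hk : Function.Injective k)
    (hxy : x ≠ y) (hx : ∀ l, k l ≠ x) (hy : ∀ l, k l ≠ y) : Function.Injective (pre2 x y k) := by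
  unfold pre2
  rw [Fin.cons_injective_iff, Fin.cons_injective_iff]
  refine ⟨?_, ?_, hk⟩
  · rintro ⟨i, hi⟩
    refine Fin.cases ?_ ?_ i hi
    · simpa using hxy.symm
    · simpa using hx
  · rintro ⟨i, hi⟩
    exact hy i hi

lemma pre2_image {n m : ℕ} (x y : Fin n) (k : Fin m → Fin n) :
    univ.image (pre2 x y k) = insert x (insert y (univ.image k)) := by
  ext z
  simp only [pre2, Finset.mem_image, Finset.mem_univ, true_and, Fin.exists_fin_succ, Fin.cons_zero,
    Fin.cons_succ, Finset.mem_insert]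
  simp [eq_comm]

lemma base_iff_det {n d : ℕ} (A : Matrix (Fin d) (Fin n) ℝ) {ℬ : Finset (Fin n) → Prop}
    (hA : A.RepresentsBases ℬ) (e : Fin d → Fin n) (he : Function.Injective e) :
    ℬ (univ.image e) ↔ (A.submatrix id e).det ≠ 0 := by
  rw [hA]
  have hc : (univ.image e).card = d := by
    rw [Finset.card_image_of_injective _ he]; simp
  rw [and_iff_right hc]
  let ε : Fin d ≃ (univ.image e : Finset (Fin n)) :=
    Equiv.ofBijective (fun i => ⟨e i, by simp⟩) ⟨fun i j h => he (by simpa using h), by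
      rintro ⟨x, hx⟩
      simp only [Finset.mem_image, Finset.mem_univ, true_and] at hx
      obtain ⟨i, rfl⟩ := hx
      exact ⟨i, rfl⟩⟩
  rw [← linearIndependent_equiv ε]
  have : ((fun j : (univ.image e : Finset (Fin n)) => fun i => A i j.1) ∘ ε) =
      (A.submatrix id e).col := rfl
  rw [this, Matrix.linearIndependent_cols_iff_isUnit, Matrix.isUnit_iff_isUnit_det, isUnit_iff_ne_zero]

/-- A linear relation among columns gives a relation among minors. -/
lemma minor_relation {n m : ℕ} (A : Matrix (Fin (m+2)) (Fin n) ℝ) (a c x : Fin n)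
    (k : Fin m → Fin n) (v : Fin (m+2) → ℝ) (hv : (A.submatrix id (pre2 a c k)).mulVec v = 0) :
    v 0 * (A.submatrix id (pre2 x a k)).det + v 1 * (A.submatrix id (pre2 x c k)).det = 0 := by
  let rows : (Fin (m+2) → ℝ) → Fin (m+2) → Fin (m+2) → ℝ := fun y =>
    Fin.cons (fun i => A i x) (Fin.cons y (fun l i => A i (k l)))
  have hup : ∀ y z, Function.update (rows z) 1 y = rows y := by
    intro y z
    funext i
    refine Fin.cases ?_ (fun i => ?_) i
    · rw [Function.update_of_ne (by simp)]; rfl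
    · refine Fin.cases ?_ (fun i => ?_) i
      · exact Function.update_self (1 : Fin (m+2)) y (rows z)
      · rw [Function.update_of_ne]
        · rfl
        · intro h
          have := congrArg Fin.val h
          simp at this
  let L : (Fin (m+2) → ℝ) →ₗ[ℝ] ℝ :=
    (Matrix.detRowAlternating (R := ℝ) (n := Fin (m+2))).toMultilinearMap.toLinearMap (rows 0) 1
  have hL : ∀ y, L y = Matrix.det (Matrix.of (rows y)) := by
    intro y
    change Matrix.det (Matrix.of (Function.update (rows 0) 1 y)) = _
    rw [hup]
  have hcol : ∀ z, L (fun i => A i z) = (A.submatrix id (pre2 x z k)).det := by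
    intro z
    rw [hL, ← Matrix.det_transpose]
    congr 1
    ext i j
    refine Fin.cases ?_ (fun j => ?_) j
    · rfl
    · refine Fin.cases ?_ (fun j => ?_) j <;> rfl
  have hk : ∀ l, L (fun i => A i (k l)) = 0 := by
    intro l
    rw [hL]
    apply Matrix.det_zero_of_row_eq (i := 1) (j := l.succ.succ)
    · intro h
      have := congrArg Fin.val h
      simp at this
    · rfl
  have hsum : v 0 • (fun i => A i a) + v 1 • (fun i => A i c) + ∑ l, v (Fin.succ (Fin.succ l)) • (fun i => A i (k l)) = 0 := by
    rw [← hv]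
    funext i
    simp only [Matrix.mulVec, dotProduct, Fin.sum_univ_succ, Matrix.submatrix_apply, pre2,
      Pi.add_apply, Pi.smul_apply, Finset.sum_apply, smul_eq_mul, Fin.cons_zero, Fin.cons_succ, id]
    simp only [mul_comm]
    rw [add_assoc]
    rfl
  have := congrArg L hsum
  simpa [map_add, map_sum, hk, hcol] using this

lemma no_crossing_minors {n m : ℕ} (A : Matrix (Fin (m+2)) (Fin n) ℝ) (hA : A.TotallyNonneg)
    (k : Fin m → Fin n) (hk : Function.Injective k) {a b c d : Fin n}
    (hab : a < b) (hbc : b < c) (hcd : c < d)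
    (ha : ∀ l, k l ≠ a) (hb : ∀ l, k l ≠ b) (hc : ∀ l, k l ≠ c) (hd : ∀ l, k l ≠ d)
    (hac : (A.submatrix id (pre2 a c k)).det = 0)
    (hba : (A.submatrix id (pre2 b a k)).det ≠ 0)
    (hbc' : (A.submatrix id (pre2 b c k)).det ≠ 0)
    (hda : (A.submatrix id (pre2 d a k)).det ≠ 0)
    (hdc : (A.submatrix id (pre2 d c k)).det ≠ 0) : False := by
  obtain ⟨v, hv0, hv⟩ := Matrix.exists_mulVec_eq_zero_iff.2 hac
  have r1 := minor_relation A a c b k v hv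
  have r2 := minor_relation A a c d k v hv
  have hV : vdm k ≠ 0 := by
    unfold vdm
    rw [Matrix.det_vandermonde_ne_zero_iff]
    intro i j h
    exact hk (Fin.ext (by simpa using h))
  have hs : ∀ x : Fin n, (∀ l, k l ≠ x) → (∏ l, (((k l : ℕ) : ℝ) - ((x : ℕ) : ℝ))) ≠ 0 := by
    intro x hx
    rw [Finset.prod_ne_zero_iff]
    intro l _ h
    rw [sub_eq_zero, Nat.cast_inj] at h
    exact hx l (Fin.ext h)
  have p1 := det_mul_vdm_nonneg A hA _ (pre2_injective hk hab.ne' hb ha)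
  have p2 := det_mul_vdm_nonneg A hA _ (pre2_injective hk hbc.ne hb hc)
  have p3 := det_mul_vdm_nonneg A hA _ (pre2_injective hk (hab.trans (hbc.trans hcd)).ne' hd ha)
  have p4 := det_mul_vdm_nonneg A hA _ (pre2_injective hk hcd.ne' hd hc)
  rw [vdm_pre2] at p1 p2 p3 p4
  have sa := hs a ha
  have sb := hs b hb
  have sc := hs c hc
  have sd := hs d hd
  have ab' : ((a : ℕ) : ℝ) < ((b : ℕ) : ℝ) := by exact_mod_cast hab
  have bc' : ((b : ℕ) : ℝ) < ((c : ℕ) : ℝ) := by exact_mod_cast hbc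
  have cd' : ((c : ℕ) : ℝ) < ((d : ℕ) : ℝ) := by exact_mod_cast hcd
  have hz : v 0 = 0 ∧ v 1 = 0 := by
    generalize ∏ l, (((k l : ℕ) : ℝ) - ((a : ℕ) : ℝ)) = A' at *
    generalize ∏ l, (((k l : ℕ) : ℝ) - ((b : ℕ) : ℝ)) = B' at *
    generalize ∏ l, (((k l : ℕ) : ℝ) - ((c : ℕ) : ℝ)) = C' at *
    generalize ∏ l, (((k l : ℕ) : ℝ) - ((d : ℕ) : ℝ)) = D' at *
    generalize (A.submatrix id (pre2 b a k)).det = q1 at *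
    generalize (A.submatrix id (pre2 b c k)).det = q2 at *
    generalize (A.submatrix id (pre2 d a k)).det = q3 at *
    generalize (A.submatrix id (pre2 d c k)).det = q4 at *
    generalize vdm k = V at *
    generalize ((a : ℕ) : ℝ) = a' at *
    generalize ((b : ℕ) : ℝ) = b' at *
    generalize ((c : ℕ) : ℝ) = c' at *
    generalize ((d : ℕ) : ℝ) = d' at *
    generalize v 0 = x at *
    generalize v 1 = y at *
    -- signs of the minors
    have P1 : q1 * (B' * A' * V) < 0 := by
      refine lt_of_le_of_ne ?_ (by positivity)
      have : 0 ≤ (a' - b') * (q1 * (B' * A' * V)) := by linarith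
      exact nonpos_of_mul_nonneg_right this (by linarith)
    have P2 : 0 < q2 * (B' * C' * V) := by
      refine lt_of_le_of_ne ?_ (by positivity)
      have : 0 ≤ (c' - b') * (q2 * (B' * C' * V)) := by linarith
      exact nonneg_of_mul_nonneg_right this (by linarith)
    have P3 : q3 * (D' * A' * V) < 0 := by
      refine lt_of_le_of_ne ?_ (by positivity)
      have : 0 ≤ (a' - d') * (q3 * (D' * A' * V)) := by linarith
      exact nonpos_of_mul_nonneg_right this (by linarith)
    have P4 : q4 * (D' * C' * V) < 0 := by
      refine lt_of_le_of_ne ?_ (by positivity)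
      have : 0 ≤ (c' - d') * (q4 * (D' * C' * V)) := by linarith
      exact nonpos_of_mul_nonneg_right this (by linarith)
    have X0 : x = 0 := by
      by_contra hx
      have e : (q1 * (B' * A' * V)) * (q4 * (D' * C' * V)) * x =
          (q3 * (D' * A' * V)) * (q2 * (B' * C' * V)) * x := by
        linear_combination (q4 * (B' * A' * V) * (D' * C' * V)) * r1 -
          (q2 * (B' * A' * V) * (D' * C' * V)) * r2
      have e' := mul_right_cancel₀ hx e
      have := mul_pos_of_neg_of_neg P1 P4
      have := mul_neg_of_neg_of_pos P3 P2
      linarith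
    refine ⟨X0, ?_⟩
    rw [X0] at r1
    simpa [hbc'] using r1
  apply hba
  rw [← Matrix.exists_mulVec_eq_zero_iff]
  refine ⟨v, hv0, ?_⟩
  rw [← hv]
  funext i
  simp [Matrix.mulVec, dotProduct, Fin.sum_univ_succ, pre2, hz.1, hz.2]

end MatrixPart

lemma prop_aux1 (y x p q r : Prop) : (y ∨ x ∨ p ∨ q ∨ r) ↔ ((x ∨ p) ∨ (y ∨ q) ∨ r) := by
  tauto

lemma toSubtype_basesSet {n : ℕ} (S : Finset (Fin n)) (ℬ : Finset (Fin n) → Prop)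
    (hsupp : ∀ B, ℬ B → B ⊆ S) (h : IsBasesSet ℬ) : IsBasesSet (toSubtypePred S ℬ) := by
  constructor
  · obtain ⟨B, hB⟩ := h.1
    refine ⟨B.subtype (fun x => x ∈ S), ?_⟩
    unfold toSubtypePred
    rw [Finset.subtype_map_of_mem (hsupp B hB)]
    exact hB
  · intro X Y hX hY x hx
    obtain ⟨y, hy, hy'⟩ := h.2 hX hY x.1 (by simpa using hx)
    have hyS : y ∈ S := hsupp _ hy' (Finset.mem_insert_self _ _)
    refine ⟨⟨y, hyS⟩, ?_, ?_⟩
    · simpa [hyS] using hy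
    · unfold toSubtypePred
      rw [Finset.map_insert, Finset.map_erase]
      exact hy'

lemma component_exchange {n : ℕ} (S : Finset (Fin n)) (ℬ : Finset (Fin n) → Prop)
    (hsupp : ∀ B, ℬ B → B ⊆ S) (h : IsBasesSet ℬ)
    (hconn : MatroidConnected (toSubtypePred S ℬ)) {a c : Fin n} (ha : a ∈ S) (hc : c ∈ S)
    (hac : a ≠ c) :
    ∃ K : Finset (Fin n), K ⊆ S ∧ a ∉ K ∧ c ∉ K ∧ ℬ (insert a K) ∧ ℬ (insert c K) := by
  obtain ⟨K, h1, h2, h3, h4⟩ := exists_exchange (toSubtype_basesSet S ℬ hsupp h) hconn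
    (a := ⟨a, ha⟩) (c := ⟨c, hc⟩) (by simpa using hac)
  unfold toSubtypePred at h3 h4
  rw [Finset.map_insert] at h3 h4
  refine ⟨K.map (Function.Embedding.subtype fun x => x ∈ S), ?_, ?_, ?_, h3, h4⟩
  · exact fun x hx => hsupp _ h3 (Finset.mem_insert_of_mem hx)
  · simpa [ha] using h1
  · simpa [hc] using h2

lemma linear_noncrossing (n t : ℕ) (ℬ : Finset (Fin n) → Prop)
    (S : Fin t → Finset (Fin n)) (ℬᵢ : Fin t → Finset (Fin n) → Prop)
    (hpos : IsPositroid ℬ)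
    (hpart : ∀ x : Fin n, ∃! i, x ∈ S i)
    (hsupp : ∀ i B, ℬᵢ i B → B ⊆ S i)
    (hmat : ∀ i, IsBasesSet (ℬᵢ i))
    (hconn : ∀ i, MatroidConnected (toSubtypePred (S i) (ℬᵢ i)))
    (hsum : ∀ B, ℬ B ↔ ∃ f : Fin t → Finset (Fin n),
      (∀ i, ℬᵢ i (f i)) ∧ B = Finset.univ.biUnion f)
    (i j : Fin t) (hij : i ≠ j) (a b c d : Fin n) (ha : a ∈ S i) (hc : c ∈ S i)
    (hb : b ∈ S j) (hd : d ∈ S j) (hab : a < b) (hbc : b < c) (hcd : c < d) : False := by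
  obtain ⟨r, A, hA, hrep⟩ := hpos
  have huniq : ∀ x p q, x ∈ S p → x ∈ S q → p = q := fun x p q hp hq => (hpart x).unique hp hq
  obtain ⟨Ki, hKi, hai, hci, hBa, hBc⟩ :=
    component_exchange (S i) (ℬᵢ i) (hsupp i) (hmat i) (hconn i) ha hc (hab.trans hbc).ne
  obtain ⟨Kj, hKj, hbj, hdj, hBb, hBd⟩ :=
    component_exchange (S j) (ℬᵢ j) (hsupp j) (hmat j) (hconn j) hb hd (hbc.trans hcd).ne
  choose g hg using fun l => (hmat l).1
  -- the common part of the bases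
  let F : Finset (Fin n) → Finset (Fin n) → Fin t → Finset (Fin n) := fun X Y l =>
    if l = i then X else if l = j then Y else g l
  let K : Finset (Fin n) := univ.biUnion (F Ki Kj)
  have hKmem : ∀ X Y x, x ∈ univ.biUnion (F X Y) ↔
      x ∈ X ∨ x ∈ Y ∨ ∃ l, l ≠ i ∧ l ≠ j ∧ x ∈ g l := by
    intro X Y x
    simp only [Finset.mem_biUnion, Finset.mem_univ, true_and, F]
    constructor
    · rintro ⟨l, hl⟩
      split_ifs at hl with h1 h2
      · exact Or.inl hl
      · exact Or.inr (Or.inl hl)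
      · exact Or.inr (Or.inr ⟨l, h1, h2, hl⟩)
    · rintro (h | h | ⟨l, h1, h2, h⟩)
      · exact ⟨i, by simpa using h⟩
      · exact ⟨j, by simpa [hij.symm] using h⟩
      · exact ⟨l, by simpa [h1, h2] using h⟩
  have hF : ∀ X Y, ℬᵢ i X → ℬᵢ j Y → ℬ (univ.biUnion (F X Y)) := by
    intro X Y hX hY
    rw [hsum]
    refine ⟨_, fun l => ?_, rfl⟩
    simp only [F]
    split_ifs with h1 h2
    · exact h1 ▸ hX
    · exact h2 ▸ hY
    · exact hg l
  have hbase : ∀ x y, ℬᵢ i (insert x Ki) → ℬᵢ j (insert y Kj) → ℬ (insert y (insert x K)) := by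
    intro x y hx hy
    convert hF _ _ hx hy using 1
    ext z
    rw [hKmem]
    simp only [Finset.mem_insert, K, hKmem]
    exact prop_aux1 _ _ _ _ _
  have hnotK : ∀ x, (x ∈ S i ∧ x ∉ Ki) ∨ (x ∈ S j ∧ x ∉ Kj) → x ∉ K := by
    intro x hx hxK
    rw [hKmem] at hxK
    rcases hxK with h | h | ⟨l, h1, h2, h⟩
    · rcases hx with ⟨p, q⟩ | ⟨p, q⟩
      · exact q h
      · exact hij (huniq x i j (hKi h) p)
    · rcases hx with ⟨p, q⟩ | ⟨p, q⟩
      · exact hij (huniq x i j p (hKj h))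
      · exact q h
    · have := hsupp l _ (hg l) h
      rcases hx with ⟨p, q⟩ | ⟨p, q⟩
      · exact h1 (huniq x l i this p)
      · exact h2 (huniq x l j this p)
  have haK := hnotK a (Or.inl ⟨ha, hai⟩)
  have hcK := hnotK c (Or.inl ⟨hc, hci⟩)
  have hbK := hnotK b (Or.inr ⟨hb, hbj⟩)
  have hdK := hnotK d (Or.inr ⟨hd, hdj⟩)
  have hcard : ∀ B, ℬ B → B.card = r := fun B hB => ((hrep B).1 hB).1
  have hab1 := hbase a b hBa hBb
  have hcb1 := hbase c b hBc hBb
  have had1 := hbase a d hBa hBd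
  have hcd1 := hbase c d hBc hBd
  have hr : r = K.card + 2 := by
    rw [← hcard _ hab1, Finset.card_insert_of_notMem, Finset.card_insert_of_notMem haK]
    simp [hbK, hab.ne']
  have hac1 : ¬ ℬ (insert a (insert c K)) := by
    intro h
    obtain ⟨f, hf, hfe⟩ := (hsum _).1 h
    have hfj : ∀ x, x ∈ f j ↔ x ∈ Kj := by
      intro x
      constructor
      · intro hx
        have hxS := hsupp j _ (hf j) hx
        have : x ∈ insert a (insert c K) := by
          rw [hfe]; exact Finset.mem_biUnion.2 ⟨j, Finset.mem_univ _, hx⟩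
        simp only [Finset.mem_insert] at this
        rcases this with rfl | rfl | hxK
        · exact absurd (huniq _ _ _ ha hxS) hij
        · exact absurd (huniq _ _ _ hc hxS) hij
        · by_contra hne
          exact hnotK x (Or.inr ⟨hxS, hne⟩) hxK
      · intro hx
        have hxS := hKj hx
        have : x ∈ insert a (insert c K) := by
          simp only [Finset.mem_insert, K, hKmem]
          exact Or.inr (Or.inr (Or.inr (Or.inl hx)))
        rw [hfe] at this
        obtain ⟨l, -, hl⟩ := Finset.mem_biUnion.1 this
        have := huniq x l j (hsupp l _ (hf l) hl) hxS
        exact this ▸ hl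
    have hfj' : f j = Kj := Finset.ext hfj
    have h1 : ℬᵢ j Kj := hfj' ▸ hf j
    have h2 := hcard _ (hF _ _ hBa h1)
    have h3 : univ.biUnion (F (insert a Ki) Kj) = insert a K := by
      ext z
      rw [hKmem]
      simp only [Finset.mem_insert, K, hKmem]
      exact or_assoc
    rw [h3, Finset.card_insert_of_notMem haK] at h2
    omega
  obtain ⟨m, hm⟩ : ∃ m, K.card = m := ⟨_, rfl⟩
  rw [hm] at hr
  subst hr
  let k : Fin m → Fin n := K.orderEmbOfFin hm
  have hkinj : Function.Injective k := (K.orderEmbOfFin hm).injective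
  have hkim : univ.image k = K := by
    apply Finset.coe_injective
    simp [k]
  have hkK : ∀ x, x ∉ K → ∀ l, k l ≠ x := by
    rintro x hx l rfl
    exact hx (K.orderEmbOfFin_mem hm l)
  have hdet : ∀ x y, x ∉ K → y ∉ K → x ≠ y →
      (ℬ (insert x (insert y K)) ↔ (A.submatrix id (pre2 x y k)).det ≠ 0) := by
    intro x y hx hy hxy
    rw [← base_iff_det A hrep _ (pre2_injective hkinj hxy (hkK x hx) (hkK y hy)), pre2_image, hkim]
  refine no_crossing_minors A hA k hkinj hab hbc hcd (hkK a haK) (hkK b hbK) (hkK c hcK) (hkK d hdK)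
    ?_ ?_ ?_ ?_ ?_
  · by_contra hne
    exact hac1 ((hdet a c haK hcK (hab.trans hbc).ne).2 hne)
  · exact (hdet b a hbK haK hab.ne').1 hab1
  · exact (hdet b c hbK hcK hbc.ne).1 hcb1
  · exact (hdet d a hdK haK (hab.trans (hbc.trans hcd)).ne').1 had1
  · exact (hdet d c hdK hcK hcd.ne').1 hcd1

lemma fin_sub_val_cases {n : ℕ} (a b : Fin n) :
    (a.val ≤ b.val ∧ (b - a).val = b.val - a.val) ∨
      (b.val < a.val ∧ (b - a).val = n + b.val - a.val) := by
  rcases le_or_gt a b with h | h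
  · exact Or.inl ⟨h, Fin.coe_sub_iff_le.2 h⟩
  · exact Or.inr ⟨h, Fin.coe_sub_iff_lt.2 h⟩

lemma cyc4_cases {n : ℕ} {a b c d : Fin n} (h : Cyc4 a b c d) :
    (a < b ∧ b < c ∧ c < d) ∨ (b < c ∧ c < d ∧ d < a) ∨ (c < d ∧ d < a ∧ a < b) ∨
      (d < a ∧ a < b ∧ b < c) := by
  obtain ⟨h1, h2, h3⟩ := h
  simp only [Fin.lt_def]
  have := fin_sub_val_cases a b
  have := fin_sub_val_cases a c
  have := fin_sub_val_cases a d
  have := a.2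
  have := b.2
  have := c.2
  have := d.2
  omega

/-- Let `M` be a positroid on `[n]` and let
`M = M₁ ⊕ ... ⊕ M_t` be its decomposition into connected components: each `Mᵢ`
is a connected matroid on a nonempty ground set `Sᵢ`, the sets `S₁, ..., S_t`
partition `[n]`, and the bases of `M` are exactly the unions of one basis from
each `Mᵢ`.  Then `{S₁, ..., S_t}` is a non-crossing partition of `[n]`. -/
theorem positroid_components_noncrossing (n t : ℕ) (ℬ : Finset (Fin n) → Prop)
    (S : Fin t → Finset (Fin n)) (ℬᵢ : Fin t → Finset (Fin n) → Prop)
    (hpos : IsPositroid ℬ)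
    (hne : ∀ i, (S i).Nonempty)
    (hpart : ∀ x : Fin n, ∃! i, x ∈ S i)
    (hsupp : ∀ i B, ℬᵢ i B → B ⊆ S i)
    (hmat : ∀ i, IsBasesSet (ℬᵢ i))
    (hconn : ∀ i, MatroidConnected (toSubtypePred (S i) (ℬᵢ i)))
    (hsum : ∀ B, ℬ B ↔ ∃ f : Fin t → Finset (Fin n),
      (∀ i, ℬᵢ i (f i)) ∧ B = Finset.univ.biUnion f) :
    NonCrossingFam S := by
  rintro ⟨i, j, a, b, c, d, hij, ha, hc, hb, hd, hcyc⟩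
  have key := linear_noncrossing n t ℬ S ℬᵢ hpos hpart hsupp hmat hconn hsum
  rcases cyc4_cases hcyc with ⟨h1, h2, h3⟩ | ⟨h1, h2, h3⟩ | ⟨h1, h2, h3⟩ | ⟨h1, h2, h3⟩
  · exact key i j hij a b c d ha hc hb hd h1 h2 h3
  · exact key j i hij.symm b c d a hb hd hc ha h1 h2 h3
  · exact key i j hij c d a b hc ha hd hb h1 h2 h3
  · exact key j i hij.symm d a b c hd hb ha hc h1 h2 h3
end

section
/- Let {S_1,...,S_t} be a non-crossing partition of [n], each block S_i carrying the total order inherited from [n], and for each i let M_i be a connected positroid on S_i. Then the direct sum M_1 ⊕ M_2 ⊕ ... ⊕ M_t is a positroid on [n] = {1 < 2 < ... < n}. -/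
open Finset

namespace PosAux

/-- Column minor. -/
noncomputable def mnr {n d : ℕ} (A : Matrix (Fin d) (Fin n) ℝ) (f : Fin d → Fin n) : ℝ :=
  (A.submatrix id f).det

theorem mnr_ne_zero_iff {n d : ℕ} (A : Matrix (Fin d) (Fin n) ℝ) (f : Fin d → Fin n) :
    mnr A f ≠ 0 ↔ LinearIndependent ℝ (fun k : Fin d => fun i => A i (f k)) := by
  unfold mnr
  have h := Matrix.linearIndependent_cols_iff_isUnit (A := A.submatrix id f)
  rw [Matrix.isUnit_iff_isUnit_det, isUnit_iff_ne_zero] at h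
  exact h.symm

theorem li_iff {n d : ℕ} (A : Matrix (Fin d) (Fin n) ℝ) (f : Fin d → Fin n)
    (hf : Function.Injective f) (B : Finset (Fin n)) (hB : Finset.univ.image f = B) :
    LinearIndependent ℝ (fun j : B => fun i => A i j.1) ↔ mnr A f ≠ 0 := by
  rw [mnr_ne_zero_iff]
  have hmem : ∀ k, f k ∈ B := fun k => by rw [← hB]; simp
  let e : Fin d ≃ B := Equiv.ofBijective (fun k => ⟨f k, hmem k⟩) (by
    constructor
    · intro a b h
      exact hf (by simpa using h)
    · rintro ⟨x, hx⟩
      rw [← hB] at hx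
      simp only [Finset.mem_image, Finset.mem_univ, true_and] at hx
      obtain ⟨k, hk⟩ := hx
      exact ⟨k, by simp [hk]⟩)
  exact (linearIndependent_equiv e (f := fun j : B => fun i => A i j.1)).symm

/-- Positroid on `Fin n` all of whose elements outside `S` are loops. -/
def PosOn {n : ℕ} (S : Finset (Fin n)) (ℬ : Finset (Fin n) → Prop) : Prop :=
  ∃ (d : ℕ) (A : Matrix (Fin d) (Fin n) ℝ),
    (∀ x, x ∉ S → ∀ i, A i x = 0) ∧ (∃ B, ℬ B) ∧
    (∀ f : Fin d → Fin n, StrictMono f → 0 ≤ mnr A f) ∧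
    ∀ B, ℬ B ↔ ∃ f : Fin d → Fin n, StrictMono f ∧ Finset.univ.image f = B ∧ mnr A f ≠ 0

theorem mnr_support {n d : ℕ} (A : Matrix (Fin d) (Fin n) ℝ) (S : Finset (Fin n))
    (hA : ∀ x, x ∉ S → ∀ i, A i x = 0) (f : Fin d → Fin n) (h : mnr A f ≠ 0) (k : Fin d) :
    f k ∈ S := by
  by_contra hk
  exact h (Matrix.det_eq_zero_of_column_eq_zero k (fun i => hA _ hk i))

theorem repr_iff {n d : ℕ} (A : Matrix (Fin d) (Fin n) ℝ) (B : Finset (Fin n)) :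
    (B.card = d ∧ LinearIndependent ℝ (fun j : B => fun i => A i j.1)) ↔
    ∃ f : Fin d → Fin n, StrictMono f ∧ Finset.univ.image f = B ∧ mnr A f ≠ 0 := by
  constructor
  · rintro ⟨hc, hl⟩
    have him : Finset.univ.image (B.orderEmbOfFin hc) = B := by simp
    exact ⟨B.orderEmbOfFin hc, (B.orderEmbOfFin hc).strictMono, him,
      (li_iff A _ (B.orderEmbOfFin hc).injective B him).1 hl⟩
  · rintro ⟨f, hf, him, hm⟩
    refine ⟨?_, (li_iff A f hf.injective B him).2 hm⟩
    rw [← him, Finset.card_image_of_injective _ hf.injective]; simp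

theorem PosOn.isPositroid {n : ℕ} {S : Finset (Fin n)} {ℬ : Finset (Fin n) → Prop}
    (h : PosOn S ℬ) : IsPositroid ℬ := by
  obtain ⟨d, A, -, ⟨B, hB⟩, hnn, hrep⟩ := h
  refine ⟨d, A, ⟨?_, fun f hf => hnn f hf⟩, fun B => (hrep B).trans (repr_iff A B).symm⟩
  obtain ⟨f, hf, -, hm⟩ := (hrep B).1 hB
  apply le_antisymm
  · simpa using A.rank_le_height
  · have hl := (mnr_ne_zero_iff A f).1 hm
    rw [Matrix.rank_eq_finrank_span_cols]
    have h1 := finrank_span_eq_card hl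
    rw [Fintype.card_fin] at h1
    refine h1.symm.le.trans ?_
    apply Submodule.finrank_mono
    apply Submodule.span_mono
    rintro _ ⟨k, rfl⟩
    exact ⟨f k, rfl⟩

theorem posOn_of {n : ℕ} (S : Finset (Fin n)) (ℬ : Finset (Fin n) → Prop)
    (hsupp : ∀ B, ℬ B → B ⊆ S) (hne : ∃ B, ℬ B)
    (h : IsPositroid (toSubtypePred S ℬ)) : PosOn S ℬ := by
  obtain ⟨d, A, ⟨-, hnn⟩, hrep⟩ := h
  let A' : Matrix (Fin d) (Fin n) ℝ := fun r x => if hx : x ∈ S then A r ⟨x, hx⟩ else 0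
  have hz : ∀ x, x ∉ S → ∀ i, A' i x = 0 := fun x hx i => by simp [A', hx]
  refine ⟨d, A', hz, hne, ?_, ?_⟩
  · intro f hf
    by_cases h0 : mnr A' f = 0
    · rw [h0]
    have hs := mnr_support A' S hz f h0
    have := hnn (fun k => ⟨f k, hs k⟩) (fun a b hab => hf hab)
    convert this using 1
    unfold mnr
    congr 1
    ext i k
    exact dif_pos (hs k)
  · intro B
    rw [← repr_iff]
    have key : B ⊆ S → (ℬ B ↔
        B.card = d ∧ LinearIndependent ℝ (fun j : B => fun i => A' i j.1)) := by
      intro hBS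
      have hmap : (B.subtype (fun x => x ∈ S)).map (Function.Embedding.subtype fun x => x ∈ S)
          = B := by
        rw [Finset.subtype_map]
        exact Finset.filter_true_of_mem hBS
      have hr := hrep (B.subtype (fun x => x ∈ S))
      unfold toSubtypePred at hr
      rw [hmap] at hr
      rw [hr]
      have hcard : (B.subtype (fun x => x ∈ S)).card = B.card := by
        conv_rhs => rw [← hmap, Finset.card_map]
      rw [hcard]
      apply and_congr_right
      intro _
      let e : (B.subtype (fun x => x ∈ S)) ≃ B :=
        { toFun := fun j => ⟨j.1.1, Finset.mem_subtype.1 j.2⟩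
          invFun := fun j => ⟨⟨j.1, hBS j.2⟩, Finset.mem_subtype.2 j.2⟩
          left_inv := fun j => rfl
          right_inv := fun j => rfl }
      rw [← linearIndependent_equiv e (f := fun j : B => fun i => A' i j.1)]
      have : ((fun j : B => fun i => A' i j.1) ∘ e) =
          fun j : (B.subtype (fun x => x ∈ S)) => fun i => A i j.1 := by
        funext j i
        have : j.1.1 ∈ S := j.1.2
        simp [A', e]
      rw [this]
    constructor
    · intro h
      exact (key (hsupp B h)).1 h
    · intro h
      refine (key ?_).2 h
      intro x hx
      by_contra hxS
      exact h.2.ne_zero ⟨x, hx⟩ (funext fun i => hz x hxS i)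

section two

variable {n d₁ d₂ : ℕ}

/-- The direct sum matrix. -/
def dsum (A : Matrix (Fin d₁) (Fin n) ℝ) (C : Matrix (Fin d₂) (Fin n) ℝ) (s : Fin n → ℝ) :
    Matrix (Fin (d₁ + d₂)) (Fin n) ℝ :=
  fun i x => Fin.addCases (motive := fun _ => ℝ) (fun i => A i x) (fun i => s x * C i x) i

theorem det_append (A : Matrix (Fin d₁) (Fin n) ℝ) (C : Matrix (Fin d₂) (Fin n) ℝ)
    (s : Fin n → ℝ) (f₁ : Fin d₁ → Fin n) (f₂ : Fin d₂ → Fin n)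
    (hA : ∀ i k, A i (f₂ k) = 0) (hC : ∀ i k, C i (f₁ k) = 0) :
    mnr (dsum A C s) (Fin.append f₁ f₂) = mnr A f₁ * ((∏ k, s (f₂ k)) * mnr C f₂) := by
  unfold mnr
  rw [← Matrix.det_submatrix_equiv_self finSumFinEquiv]
  have : ((dsum A C s).submatrix id (Fin.append f₁ f₂)).submatrix finSumFinEquiv finSumFinEquiv
      = Matrix.fromBlocks (A.submatrix id f₁) 0 0
        (Matrix.of fun i k => s (f₂ k) * (C.submatrix id f₂) i k) := by
    ext i k
    rcases i with i | i <;> rcases k with k | k <;>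
      simp [dsum, hA, hC]
  rw [this, Matrix.det_fromBlocks_zero₂₁, Matrix.det_mul_row]

theorem sign_shuffle (f₁ : Fin d₁ → Fin n) (f₂ : Fin d₂ → Fin n) (f : Fin (d₁ + d₂) → Fin n)
    (h₁ : StrictMono f₁) (h₂ : StrictMono f₂) (hf : StrictMono f)
    (σ : Equiv.Perm (Fin (d₁ + d₂))) (hσ : ∀ i, f (σ i) = Fin.append f₁ f₂ i) :
    (Equiv.Perm.sign σ : ℤˣ) = ∏ k : Fin d₂, ∏ l : Fin d₁, if f₁ l < f₂ k then 1 else -1 := by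
  rw [Equiv.Perm.sign_eq_prod_prod_Iio, Fin.prod_univ_add]
  have e : ∀ i j, (σ i < σ j) ↔ Fin.append f₁ f₂ i < Fin.append f₁ f₂ j := fun i j => by
    rw [← hσ, ← hσ, hf.lt_iff_lt]
  simp_rw [e]
  have conv : ∀ j : Fin (d₁ + d₂), ∀ F : Fin (d₁ + d₂) → ℤˣ,
      ∏ i ∈ Finset.Iio j, F i = ∏ i, if i < j then F i else 1 := by
    intro j F
    rw [← Finset.prod_filter]
    congr 1
    ext; simp
  simp_rw [conv, Fin.prod_univ_add]
  have a1 : ∀ (x : Fin d₁), (∏ i : Fin d₁, if Fin.castAdd d₂ i < Fin.castAdd d₂ x then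
      (if Fin.append f₁ f₂ (Fin.castAdd d₂ i) < Fin.append f₁ f₂ (Fin.castAdd d₂ x) then (1:ℤˣ) else -1)
      else 1) = 1 := by
    intro x
    apply Finset.prod_eq_one
    intro i _
    split_ifs with h h' <;> try rfl
    have hix : i < x := by
      rw [Fin.lt_def] at h ⊢
      simp only [Fin.val_castAdd, Fin.val_natAdd] at h
      omega
    have := h₁ hix
    simp only [Fin.append_left] at h'
    exact absurd this h'
  have a2 : ∀ (x : Fin d₁), (∏ i : Fin d₂, if Fin.natAdd d₁ i < Fin.castAdd d₂ x then
      (if Fin.append f₁ f₂ (Fin.natAdd d₁ i) < Fin.append f₁ f₂ (Fin.castAdd d₂ x) then (1:ℤˣ) else -1)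
      else 1) = 1 := by
    intro x
    apply Finset.prod_eq_one
    intro i _
    rw [if_neg]
    simp [Fin.lt_def]; omega
  have a3 : ∀ (x : Fin d₂), (∏ i : Fin d₂, if Fin.natAdd d₁ i < Fin.natAdd d₁ x then
      (if Fin.append f₁ f₂ (Fin.natAdd d₁ i) < Fin.append f₁ f₂ (Fin.natAdd d₁ x) then (1:ℤˣ) else -1)
      else 1) = 1 := by
    intro x
    apply Finset.prod_eq_one
    intro i _
    split_ifs with h h' <;> try rfl
    have hix : i < x := by
      rw [Fin.lt_def] at h ⊢
      simp only [Fin.val_castAdd, Fin.val_natAdd] at h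
      omega
    have := h₂ hix
    simp only [Fin.append_right] at h'
    exact absurd this h'
  simp_rw [a1, a2, a3]
  simp only [mul_one, Finset.prod_const_one, one_mul]
  apply Finset.prod_congr rfl
  intro k _
  apply Finset.prod_congr rfl
  intro l _
  rw [if_pos (by simp [Fin.lt_def]; omega)]
  simp

open Classical in
/-- Signs. -/
noncomputable def sg (S₁ : Finset (Fin n)) (d₁ : ℕ) (x : Fin n) : ℝ :=
  if ∃ y ∈ S₁, x < y then (-1) ^ d₁ else 1

theorem mnr_dsum (S₁ S₂ : Finset (Fin n)) (hd : Disjoint S₁ S₂)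
    (hsep : ∀ x ∈ S₂, ∀ y ∈ S₁, ∀ y' ∈ S₁, y < x → x < y' → False)
    (A : Matrix (Fin d₁) (Fin n) ℝ) (C : Matrix (Fin d₂) (Fin n) ℝ)
    (hA : ∀ x, x ∉ S₁ → ∀ i, A i x = 0) (hC : ∀ x, x ∉ S₂ → ∀ i, C i x = 0)
    (f₁ : Fin d₁ → Fin n) (f₂ : Fin d₂ → Fin n) (f : Fin (d₁ + d₂) → Fin n)
    (h₁ : StrictMono f₁) (h₂ : StrictMono f₂) (hf : StrictMono f)
    (m₁ : ∀ k, f₁ k ∈ S₁) (m₂ : ∀ k, f₂ k ∈ S₂)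
    (r₁ : ∀ k, f₁ k ∈ Set.range f) (r₂ : ∀ k, f₂ k ∈ Set.range f) :
    mnr (dsum A C (sg S₁ d₁)) f = mnr A f₁ * mnr C f₂ := by
  have hne : ∀ k l, f₁ k ≠ f₂ l := fun k l h =>
    Finset.disjoint_left.1 hd (m₁ k) (h ▸ m₂ l)
  have hex : ∀ i, ∃ k, f k = Fin.append f₁ f₂ i := by
    intro i
    refine Fin.addCases (fun i => ?_) (fun i => ?_) i
    · simpa using r₁ i
    · simpa using r₂ i
  choose τ hτ using hex
  have hinj : Function.Injective (Fin.append f₁ f₂) :=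
    Fin.append_injective_iff.2 ⟨h₁.injective, h₂.injective, hne⟩
  have hτi : Function.Injective τ := fun a b h => hinj (by rw [← hτ, ← hτ, h])
  let σ : Equiv.Perm (Fin (d₁ + d₂)) := Equiv.ofBijective τ (Finite.injective_iff_bijective.1 hτi)
  have hσ : ∀ i, f (σ i) = Fin.append f₁ f₂ i := hτ
  have hs := sign_shuffle f₁ f₂ f h₁ h₂ hf σ hσ
  have hdet := det_append A C (sg S₁ d₁) f₁ f₂
    (fun i k => hA _ (fun h => Finset.disjoint_left.1 hd h (m₂ k)) i)
    (fun i k => hC _ (fun h => Finset.disjoint_left.1 hd (m₁ k) h) i)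
  have hperm : mnr (dsum A C (sg S₁ d₁)) (Fin.append f₁ f₂)
      = ((Equiv.Perm.sign σ : ℤˣ) : ℝ) * mnr (dsum A C (sg S₁ d₁)) f := by
    unfold mnr
    rw [← Matrix.det_permute']
    congr 1
    ext i k
    simp [hσ]
  have hprod : ∏ k, sg S₁ d₁ (f₂ k) = ((Equiv.Perm.sign σ : ℤˣ) : ℝ) := by
    rw [hs]
    push_cast
    apply Finset.prod_congr rfl
    intro k _
    unfold sg
    split_ifs with h
    · obtain ⟨y, hy, hxy⟩ := h
      have : ∀ l, ¬ f₁ l < f₂ k := fun l hl => hsep _ (m₂ k) _ (m₁ l) y hy hl hxy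
      simp [this]
    · push Not at h
      have : ∀ l, f₁ l < f₂ k := fun l => lt_of_le_of_ne (h _ (m₁ l)) (hne l k)
      simp [this]
  rw [hprod, hperm] at hdet
  have hu : ((Equiv.Perm.sign σ : ℤˣ) : ℝ) ≠ 0 := by
    rcases Int.units_eq_one_or (Equiv.Perm.sign σ) with h | h <;> simp [h]
  apply mul_left_cancel₀ hu
  rw [hdet]; ring

theorem card_le₁ (A : Matrix (Fin d₁) (Fin n) ℝ) (C : Matrix (Fin d₂) (Fin n) ℝ) (s : Fin n → ℝ)
    (S : Finset (Fin n)) (hC : ∀ x, x ∈ S → ∀ i, C i x = 0)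
    (f : Fin (d₁ + d₂) → Fin n) (hf : mnr (dsum A C s) f ≠ 0) :
    (Finset.univ.filter (fun k => f k ∈ S)).card ≤ d₁ := by
  rw [mnr_ne_zero_iff] at hf
  have h2 := hf.comp (fun k : {k // f k ∈ S} => k.1) Subtype.val_injective
  let ι : (Fin d₁ → ℝ) →ₗ[ℝ] (Fin (d₁ + d₂) → ℝ) :=
    { toFun := fun v => Fin.append v 0
      map_add' := fun v w => by
        funext i; refine Fin.addCases (fun i => ?_) (fun i => ?_) i <;> simp
      map_smul' := fun v w => by
        funext i; refine Fin.addCases (fun i => ?_) (fun i => ?_) i <;> simp }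
  have h3 : LinearIndependent ℝ (fun k : {k // f k ∈ S} => fun i => A i (f k.1)) := by
    apply LinearIndependent.of_comp ι
    convert h2 using 1
    funext k i
    refine Fin.addCases (fun i => ?_) (fun i => ?_) i <;> simp [ι, dsum, hC _ k.2]
  have h4 := h3.fintype_card_le_finrank
  simpa [Fintype.card_subtype] using h4

theorem card_le₂ (A : Matrix (Fin d₁) (Fin n) ℝ) (C : Matrix (Fin d₂) (Fin n) ℝ) (s : Fin n → ℝ)
    (S : Finset (Fin n)) (hA : ∀ x, x ∈ S → ∀ i, A i x = 0)
    (f : Fin (d₁ + d₂) → Fin n) (hf : mnr (dsum A C s) f ≠ 0) :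
    (Finset.univ.filter (fun k => f k ∈ S)).card ≤ d₂ := by
  rw [mnr_ne_zero_iff] at hf
  have h2 := hf.comp (fun k : {k // f k ∈ S} => k.1) Subtype.val_injective
  let ι : (Fin d₂ → ℝ) →ₗ[ℝ] (Fin (d₁ + d₂) → ℝ) :=
    { toFun := fun v => Fin.append 0 v
      map_add' := fun v w => by
        funext i; refine Fin.addCases (fun i => ?_) (fun i => ?_) i <;> simp
      map_smul' := fun v w => by
        funext i; refine Fin.addCases (fun i => ?_) (fun i => ?_) i <;> simp }
  have h3 : LinearIndependent ℝ (fun k : {k // f k ∈ S} => fun i => s (f k.1) * C i (f k.1)) := by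
    apply LinearIndependent.of_comp ι
    convert h2 using 1
    funext k i
    refine Fin.addCases (fun i => ?_) (fun i => ?_) i <;> simp [ι, dsum, hA _ k.2]
  have h4 := h3.fintype_card_le_finrank
  simpa [Fintype.card_subtype] using h4

theorem decomp (S₁ S₂ : Finset (Fin n)) (hd : Disjoint S₁ S₂)
    (A : Matrix (Fin d₁) (Fin n) ℝ) (C : Matrix (Fin d₂) (Fin n) ℝ) (s : Fin n → ℝ)
    (hA : ∀ x, x ∉ S₁ → ∀ i, A i x = 0) (hC : ∀ x, x ∉ S₂ → ∀ i, C i x = 0)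
    (f : Fin (d₁ + d₂) → Fin n) (hf : StrictMono f) (h0 : mnr (dsum A C s) f ≠ 0) :
    ∃ (f₁ : Fin d₁ → Fin n) (f₂ : Fin d₂ → Fin n), StrictMono f₁ ∧ StrictMono f₂ ∧
      (∀ k, f₁ k ∈ S₁) ∧ (∀ k, f₂ k ∈ S₂) ∧ (∀ k, f₁ k ∈ Set.range f) ∧
      (∀ k, f₂ k ∈ Set.range f) ∧
      Finset.univ.image f = Finset.univ.image f₁ ∪ Finset.univ.image f₂ := by
  have hz : ∀ x, x ∉ S₁ ∪ S₂ → ∀ i, dsum A C s i x = 0 := by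
    intro x hx i
    simp only [Finset.mem_union, not_or] at hx
    refine Fin.addCases (fun i => ?_) (fun i => ?_) i <;> simp [dsum, hA x hx.1, hC x hx.2]
  have hmem := mnr_support _ _ hz f h0
  have c1 := card_le₁ A C s S₁ (fun x hx => hC x (Finset.disjoint_left.1 hd hx)) f h0
  have c2 := card_le₂ A C s S₂ (fun x hx => hA x (Finset.disjoint_right.1 hd hx)) f h0
  have c3 : (Finset.univ.filter (fun k => f k ∈ S₁)).card +
      (Finset.univ.filter (fun k => f k ∈ S₂)).card = d₁ + d₂ := by
    rw [← Finset.card_union_of_disjoint]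
    · rw [← Finset.filter_or, Finset.filter_true_of_mem]
      · simp
      · intro k _
        exact Finset.mem_union.1 (hmem k)
    · rw [Finset.disjoint_filter]
      intro k _ h
      exact Finset.disjoint_left.1 hd h
  let P₁ := (Finset.univ.filter (fun k => f k ∈ S₁))
  let P₂ := (Finset.univ.filter (fun k => f k ∈ S₂))
  have e1 : P₁.card = d₁ := by simp only [P₁]; omega
  have e2 : P₂.card = d₂ := by simp only [P₂]; omega
  have q1 : ∀ k, f (P₁.orderEmbOfFin e1 k) ∈ S₁ := fun k =>
    (Finset.mem_filter.1 (P₁.orderEmbOfFin_mem e1 k)).2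
  have q2 : ∀ k, f (P₂.orderEmbOfFin e2 k) ∈ S₂ := fun k =>
    (Finset.mem_filter.1 (P₂.orderEmbOfFin_mem e2 k)).2
  refine ⟨fun k => f (P₁.orderEmbOfFin e1 k), fun k => f (P₂.orderEmbOfFin e2 k),
    hf.comp (P₁.orderEmbOfFin e1).strictMono, hf.comp (P₂.orderEmbOfFin e2).strictMono,
    q1, q2, fun k => ⟨_, rfl⟩, fun k => ⟨_, rfl⟩, ?_⟩
  have i1 : Finset.univ.image (P₁.orderEmbOfFin e1) = P₁ := by simp
  have i2 : Finset.univ.image (P₂.orderEmbOfFin e2) = P₂ := by simp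
  have j1 : Finset.univ.image (fun k => f (P₁.orderEmbOfFin e1 k)) = P₁.image f := by
    conv_rhs => rw [← i1, Finset.image_image]
    rfl
  have j2 : Finset.univ.image (fun k => f (P₂.orderEmbOfFin e2 k)) = P₂.image f := by
    conv_rhs => rw [← i2, Finset.image_image]
    rfl
  rw [j1, j2, ← Finset.image_union]
  congr 1
  ext k
  simpa [P₁, P₂] using hmem k

end two

theorem PosOn.union {n : ℕ} {S₁ S₂ : Finset (Fin n)} {ℬ₁ ℬ₂ : Finset (Fin n) → Prop}
    (H₁ : PosOn S₁ ℬ₁) (H₂ : PosOn S₂ ℬ₂) (hd : Disjoint S₁ S₂)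
    (hsep : ∀ x ∈ S₂, ∀ y ∈ S₁, ∀ y' ∈ S₁, y < x → x < y' → False) :
    PosOn (S₁ ∪ S₂) (fun B => ∃ B₁ B₂, ℬ₁ B₁ ∧ ℬ₂ B₂ ∧ B = B₁ ∪ B₂) := by
  obtain ⟨d₁, A, hA, ⟨X₁, hX₁⟩, nn₁, rep₁⟩ := H₁
  obtain ⟨d₂, C, hC, ⟨X₂, hX₂⟩, nn₂, rep₂⟩ := H₂
  refine ⟨d₁ + d₂, dsum A C (sg S₁ d₁), ?_, ⟨X₁ ∪ X₂, X₁, X₂, hX₁, hX₂, rfl⟩, ?_, ?_⟩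
  · intro x hx i
    simp only [Finset.mem_union, not_or] at hx
    refine Fin.addCases (fun i => ?_) (fun i => ?_) i <;> simp [dsum, hA x hx.1, hC x hx.2]
  · intro f hf
    by_cases h0 : mnr (dsum A C (sg S₁ d₁)) f = 0
    · rw [h0]
    obtain ⟨f₁, f₂, h₁, h₂, m₁, m₂, r₁, r₂, -⟩ := decomp S₁ S₂ hd A C _ hA hC f hf h0
    rw [mnr_dsum S₁ S₂ hd hsep A C hA hC f₁ f₂ f h₁ h₂ hf m₁ m₂ r₁ r₂]
    exact mul_nonneg (nn₁ _ h₁) (nn₂ _ h₂)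
  · intro B
    constructor
    · rintro ⟨B₁, B₂, hB₁, hB₂, rfl⟩
      obtain ⟨f₁, h₁, i₁, z₁⟩ := (rep₁ _).1 hB₁
      obtain ⟨f₂, h₂, i₂, z₂⟩ := (rep₂ _).1 hB₂
      have m₁ := mnr_support A S₁ hA f₁ z₁
      have m₂ := mnr_support C S₂ hC f₂ z₂
      have hc : (B₁ ∪ B₂).card = d₁ + d₂ := by
        rw [Finset.card_union_of_disjoint, ← i₁, ← i₂,
          Finset.card_image_of_injective _ h₁.injective,
          Finset.card_image_of_injective _ h₂.injective]
        · simp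
        · apply Finset.disjoint_of_subset_left _ (Finset.disjoint_of_subset_right _ hd)
          · rw [← i₁]; intro x; simp only [Finset.mem_image, Finset.mem_univ, true_and]
            rintro ⟨k, rfl⟩; exact m₁ k
          · rw [← i₂]; intro x; simp only [Finset.mem_image, Finset.mem_univ, true_and]
            rintro ⟨k, rfl⟩; exact m₂ k
      refine ⟨(B₁ ∪ B₂).orderEmbOfFin hc, ((B₁ ∪ B₂).orderEmbOfFin hc).strictMono, by simp, ?_⟩
      rw [mnr_dsum S₁ S₂ hd hsep A C hA hC f₁ f₂ _ h₁ h₂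
        ((B₁ ∪ B₂).orderEmbOfFin hc).strictMono m₁ m₂]
      · exact mul_ne_zero z₁ z₂
      · intro k
        rw [Finset.range_orderEmbOfFin, ← i₁]
        simp
      · intro k
        rw [Finset.range_orderEmbOfFin, ← i₂]
        simp
    · rintro ⟨f, hf, rfl, h0⟩
      obtain ⟨f₁, f₂, h₁, h₂, m₁, m₂, r₁, r₂, him⟩ := decomp S₁ S₂ hd A C _ hA hC f hf h0
      rw [mnr_dsum S₁ S₂ hd hsep A C hA hC f₁ f₂ f h₁ h₂ hf m₁ m₂ r₁ r₂] at h0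
      exact ⟨_, _, (rep₁ _).2 ⟨f₁, h₁, rfl, left_ne_zero_of_mul h0⟩,
        (rep₂ _).2 ⟨f₂, h₂, rfl, right_ne_zero_of_mul h0⟩, him⟩

theorem posOn_empty {n : ℕ} (ℬ : Finset (Fin n) → Prop) (h : ∀ B, ℬ B ↔ B = ∅) :
    PosOn ∅ ℬ := by
  refine ⟨0, fun i => i.elim0, fun x _ i => i.elim0, ⟨∅, (h _).2 rfl⟩, ?_, ?_⟩
  · intro f _
    simp [mnr]
  · intro B
    rw [h]
    constructor
    · rintro rfl
      exact ⟨fun i => i.elim0, fun i => i.elim0, by simp, by simp [mnr]⟩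
    · rintro ⟨f, -, rfl, -⟩
      simp

theorem cyc_of_lt {n : ℕ} {a b c d : Fin n} (h1 : a < b) (h2 : b < c) (h3 : c < d) :
    Cyc4 a b c d := by
  unfold Cyc4
  have e1 := Fin.sub_val_of_le h1.le
  have e2 := Fin.sub_val_of_le (h1.trans h2).le
  have e3 := Fin.sub_val_of_le ((h1.trans h2).trans h3).le
  rw [e1, e2, e3]
  simp only [Fin.lt_def] at *
  omega

theorem noncross_lt {n t : ℕ} {S : Fin t → Finset (Fin n)} (hnc : NonCrossingFam S)
    {i j : Fin t} (hij : i ≠ j) {a b c d : Fin n} (ha : a ∈ S i) (hc : c ∈ S i)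
    (hb : b ∈ S j) (hd : d ∈ S j) (h1 : a < b) (h2 : b < c) (h3 : c < d) : False :=
  hnc ⟨i, j, a, b, c, d, hij, ha, hc, hb, hd, cyc_of_lt h1 h2 h3⟩

theorem main_ind {n t : ℕ} (S : Fin t → Finset (Fin n)) (ℬ : Fin t → Finset (Fin n) → Prop)
    (hne : ∀ i, (S i).Nonempty) (hdisj : ∀ i j, i ≠ j → Disjoint (S i) (S j))
    (hnc : NonCrossingFam S) (hpos : ∀ i, PosOn (S i) (ℬ i)) (m : ℕ) :
    ∀ T : Finset (Fin t), T.card = m → PosOn (T.biUnion S)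
      (fun B => ∃ f : Fin t → Finset (Fin n), (∀ i ∈ T, ℬ i (f i)) ∧ B = T.biUnion f) := by
  induction m with
  | zero =>
    intro T hT
    rw [Finset.card_eq_zero] at hT
    subst hT
    exact posOn_empty _ (fun B => by simp)
  | succ m ih =>
    intro T hT
    have hTn : T.Nonempty := by rw [← Finset.card_pos]; omega
    obtain ⟨i, hi, hmin⟩ := Finset.exists_min_image T
      (fun i => ((S i).max' (hne i)).val - ((S i).min' (hne i)).val) hTn
    have IH := ih (T.erase i) (by rw [Finset.card_erase_of_mem hi]; omega)
    have hins : insert i (T.erase i) = T := Finset.insert_erase hi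
    have hU := (hpos i).union IH (by
      rw [Finset.disjoint_biUnion_right]
      intro j hj
      exact hdisj i j (Finset.ne_of_mem_erase hj).symm) (by
      intro x hx y hy y' hy' h1 h2
      rw [Finset.mem_biUnion] at hx
      obtain ⟨j, hj, hxj⟩ := hx
      have hji := Finset.ne_of_mem_erase hj
      have hm := hmin j (Finset.mem_of_mem_erase hj)
      have u1 : (S j).max' (hne j) ≤ y' := by
        by_contra hlt
        exact noncross_lt hnc hji.symm hy hy' hxj (Finset.max'_mem _ (hne j)) h1 h2
          (not_le.1 hlt)
      have u2 : y ≤ (S j).min' (hne j) := by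
        by_contra hlt
        exact noncross_lt hnc hji (Finset.min'_mem _ (hne j)) hxj hy hy' (not_le.1 hlt) h1 h2
      have u3 := Finset.le_max' _ _ hy'
      have u4 := Finset.min'_le _ _ hy
      have u5 : y ≠ (S j).min' (hne j) := fun h =>
        Finset.disjoint_left.1 (hdisj i j hji.symm) hy (h ▸ Finset.min'_mem _ (hne j))
      have u6 := Finset.le_max' _ _ hxj
      have u7 := Finset.min'_le _ _ hxj
      have u8 := lt_of_le_of_ne u2 u5
      simp only [Fin.lt_def, Fin.le_def] at *
      omega)
    have hS : S i ∪ (T.erase i).biUnion S = T.biUnion S := by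
      conv_rhs => rw [← hins, Finset.biUnion_insert]
    rw [hS] at hU
    convert hU using 2 with B
    constructor
    · rintro ⟨f, hf, rfl⟩
      refine ⟨f i, (T.erase i).biUnion f, hf i hi,
        ⟨f, fun j hj => hf j (Finset.mem_of_mem_erase hj), rfl⟩, ?_⟩
      conv_lhs => rw [← hins, Finset.biUnion_insert]
    · rintro ⟨B₁, B₂, hB₁, ⟨f, hf, rfl⟩, rfl⟩
      refine ⟨Function.update f i B₁, ?_, ?_⟩
      · intro j hj
        by_cases hji : j = i
        · subst hji; simpa using hB₁
        · simpa [hji] using hf j (Finset.mem_erase.2 ⟨hji, hj⟩)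
      · conv_rhs => rw [← hins, Finset.biUnion_insert]
        rw [Function.update_self]
        congr 1
        apply Finset.biUnion_congr rfl
        intro j hj
        rw [Function.update_of_ne (Finset.ne_of_mem_erase hj)]

end PosAux

/-- Let `{S₁, ..., S_t}` be a non-crossing partition of `[n]`,
each block carrying the total order inherited from `[n]`, and for each `i` let
`Mᵢ` be a connected positroid on `Sᵢ`.  Then the direct sum `M₁ ⊕ ... ⊕ M_t` —
whose bases are the unions of one basis from each `Mᵢ` — is a positroid on
`[n] = {1 < ... < n}`. -/
theorem directSum_over_noncrossing_isPositroid (n t : ℕ)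
    (S : Fin t → Finset (Fin n)) (ℬᵢ : Fin t → Finset (Fin n) → Prop)
    (hne : ∀ i, (S i).Nonempty)
    (hpart : ∀ x : Fin n, ∃! i, x ∈ S i)
    (hnc : NonCrossingFam S)
    (hsupp : ∀ i B, ℬᵢ i B → B ⊆ S i)
    (hmat : ∀ i, IsBasesSet (ℬᵢ i))
    (hpos : ∀ i, IsPositroid (toSubtypePred (S i) (ℬᵢ i)))
    (hconn : ∀ i, MatroidConnected (toSubtypePred (S i) (ℬᵢ i))) :
    IsPositroid (fun B : Finset (Fin n) =>
      ∃ f : Fin t → Finset (Fin n), (∀ i, ℬᵢ i (f i)) ∧ B = Finset.univ.biUnion f) := by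
  have hdisj : ∀ i j, i ≠ j → Disjoint (S i) (S j) := by
    intro i j hij
    rw [Finset.disjoint_left]
    intro x hi hj
    exact hij ((hpart x).unique hi hj)
  have h := PosAux.main_ind S ℬᵢ hne hdisj hnc
    (fun i => PosAux.posOn_of (S i) (ℬᵢ i) (hsupp i) (hmat i).1 (hpos i)) _ Finset.univ rfl
  have h' := h.isPositroid
  simpa using h'
end

section
/- For every n ≥ 2, the number of connected positroids on [n] equals the number of stabilized-interval-free permutations of [n]. -/
open Finset

/-- A permutation `π` of `[n]` is *stabilized-interval-free* (SIF) if
`π(I) ≠ I` for every nonempty interval `I = {a, a+1, ..., b}` that is a proper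
subset of `[n]`. -/
def IsSIF {n : ℕ} (π : Equiv.Perm (Fin n)) : Prop :=
  ∀ a b : Fin n, a ≤ b → Finset.Icc a b ≠ Finset.univ →
    (Finset.Icc a b).image π ≠ Finset.Icc a b

structure RankFn {α : Type*} [DecidableEq α] (r : Finset α → ℕ) : Prop where
  empty : r ∅ = 0
  mono : ∀ S T : Finset α, S ⊆ T → r S ≤ r T
  insert_le : ∀ (x : α) (S : Finset α), r (insert x S) ≤ r S + 1
  submod : ∀ S T : Finset α, r (S ∪ T) + r (S ∩ T) ≤ r S + r T

namespace RankFn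

variable {α : Type*} [DecidableEq α] {r : Finset α → ℕ}

theorem closure (h : RankFn r) (T X : Finset α)
    (hx : ∀ x ∈ X, r (insert x T) = r T) : r (T ∪ X) = r T := by
  induction X using Finset.induction_on with
  | empty => simp
  | insert a X ha ih =>
    have h1 := ih (fun x hxX => hx x (mem_insert_of_mem hxX))
    have h2 := hx a (mem_insert_self a X)
    have h3 := h.submod (T ∪ X) (insert a T)
    have e1 : (T ∪ X) ∪ insert a T = T ∪ insert a X := by
      ext y; simp only [mem_union, mem_insert]; tauto
    have h4 : r T ≤ r ((T ∪ X) ∩ insert a T) :=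
      h.mono _ _ (by intro y hy; simp [hy])
    have h5 : r T ≤ r (T ∪ insert a X) := h.mono _ _ subset_union_left
    rw [e1] at h3
    omega

theorem union_le_card (h : RankFn r) (S T : Finset α) : r (S ∪ T) ≤ r S + T.card := by
  induction T using Finset.induction_on with
  | empty => simp
  | insert a T ha ih =>
    have := h.insert_le a (S ∪ T)
    rw [union_insert, card_insert_of_notMem ha]
    omega

theorem le_card (h : RankFn r) (S : Finset α) : r S ≤ S.card := by
  have := h.union_le_card ∅ S
  rw [empty_union, h.empty] at this
  omega

theorem indep_subset (h : RankFn r) {I J : Finset α} (hIJ : I ⊆ J) (hJ : r J = J.card) :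
    r I = I.card := by
  have h1 := h.union_le_card I (J \ I)
  rw [union_sdiff_of_subset hIJ] at h1
  have h2 := card_sdiff_add_card_eq_card hIJ
  have h3 := h.le_card I
  omega

theorem insert_eq (h : RankFn r) (x : α) (S : Finset α) :
    r (insert x S) = r S ∨ r (insert x S) = r S + 1 := by
  have h1 := h.insert_le x S
  have h2 := h.mono S (insert x S) (subset_insert _ _)
  omega

theorem extend (h : RankFn r) {I X : Finset α} (hIX : I ⊆ X) (hI : r I = I.card) :
    ∃ J, I ⊆ J ∧ J ⊆ X ∧ r J = J.card ∧ r J = r X := by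
  classical
  obtain ⟨J, hJ, hmax⟩ := Finset.exists_max_image
    (X.powerset.filter (fun J => I ⊆ J ∧ r J = J.card)) Finset.card
    ⟨I, by simp [hIX, hI]⟩
  simp only [mem_filter, mem_powerset] at hJ hmax
  refine ⟨J, hJ.2.1, hJ.1, hJ.2.2, ?_⟩
  rw [← h.closure J X, union_eq_right.2 hJ.1]
  intro x hx
  rcases h.insert_eq x J with h1 | h1
  · exact h1
  · exfalso
    have hxJ : x ∉ J := by
      intro hxJ
      rw [insert_eq_of_mem hxJ] at h1
      omega
    have := hmax (insert x J) ⟨insert_subset hx hJ.1, hJ.2.1.trans (subset_insert _ _), by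
      rw [card_insert_of_notMem hxJ, h1, hJ.2.2]⟩
    rw [card_insert_of_notMem hxJ] at this
    omega

/-- relative rank function -/
theorem contract (h : RankFn r) (F : Finset α) : RankFn (fun X => r (F ∪ X) - r F) where
  empty := by simp
  mono S T hST := by
    have := h.mono (F ∪ S) (F ∪ T) (union_subset_union_right hST)
    omega
  insert_le x S := by
    have := h.insert_le x (F ∪ S)
    simp only [union_insert]
    omega
  submod S T := by
    have h1 := h.submod (F ∪ S) (F ∪ T)
    have e1 : (F ∪ S) ∪ (F ∪ T) = F ∪ (S ∪ T) := by
      ext y; simp only [mem_union]; tauto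
    have e2 : (F ∪ S) ∩ (F ∪ T) = F ∪ (S ∩ T) := by
      ext y; simp only [mem_union, mem_inter]; tauto
    rw [e1, e2] at h1
    have a1 := h.mono F (F ∪ S) subset_union_left
    have a2 := h.mono F (F ∪ T) subset_union_left
    have a3 := h.mono F (F ∪ (S ∪ T)) subset_union_left
    have a4 := h.mono F (F ∪ (S ∩ T)) subset_union_left
    omega

theorem exchange (h : RankFn r) {X Y : Finset α} (hXY : r (X ∪ Y) < r X + r Y) :
    ∃ a ∈ X, ∃ c ∈ Y, ∃ T, T ⊆ X ∪ Y ∧ a ∉ T ∧ c ∉ T ∧ r (X ∪ Y) = T.card + 1 ∧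
      r (insert a T) = T.card + 1 ∧ r (insert c T) = T.card + 1 := by
  obtain ⟨I, -, hIX, hI, hIr⟩ := h.extend (empty_subset X) (by simp [h.empty])
  obtain ⟨B, hIB, hBXY, hB, hBr⟩ := h.extend (hIX.trans (subset_union_left (s₂ := Y))) hI
  -- T_y = B \ I
  have hcard := card_sdiff_add_card_eq_card hIB
  have hTy := h.indep_subset (sdiff_subset (s := B) (t := I)) hB
  have hex : ∃ c ∈ Y, r (insert c (B \ I)) ≠ r (B \ I) := by
    by_contra hcon
    push Not at hcon
    have h1 := h.closure _ _ hcon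
    have h2 := h.mono Y (B \ I ∪ Y) subset_union_right
    omega
  obtain ⟨c, hc, hcr⟩ := hex
  have hcB : r (insert c B) = B.card := by
    have h1 := h.mono B (insert c B) (subset_insert _ _)
    have h2 := h.mono (insert c B) (X ∪ Y)
      (insert_subset (mem_union_right _ hc) hBXY)
    omega
  have hexa : ∃ a ∈ I, r (insert c (B.erase a)) ≠ (B.erase a).card := by
    by_contra hcon
    push Not at hcon
    apply hcr
    have key : ∀ A ⊆ I, r (insert c (B \ A)) = (B \ A).card := by
      intro A
      induction A using Finset.induction_on with
      | empty => intro _; simpa using hcB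
      | insert a A ha ih =>
        intro hA
        have haI := hA (mem_insert_self a A)
        have haB := hIB haI
        have h1 := ih ((subset_insert _ _).trans hA)
        have h2 := hcon a haI
        have h3 := h.submod (insert c (B \ A)) (insert c (B.erase a))
        have e1 : insert c (B \ A) ∪ insert c (B.erase a) = insert c B := by
          ext y
          simp only [mem_union, mem_insert, mem_sdiff, mem_erase]
          by_cases hy : y = a
          · subst hy; tauto
          · tauto
        have h4 : r (insert c (B \ insert a A)) ≤
            r (insert c (B \ A) ∩ insert c (B.erase a)) := by
          apply h.mono
          intro y
          simp only [mem_inter, mem_insert, mem_sdiff, mem_erase]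
          tauto
        rw [e1, hcB] at h3
        have e2 : (B \ insert a A).card + 1 = (B \ A).card := by
          have : B \ insert a A = (B \ A).erase a := by
            ext y; simp only [mem_insert, mem_sdiff, mem_erase]; tauto
          rw [this]
          exact card_erase_add_one (by simp [haB, ha])
        have e3 := card_erase_add_one haB
        have h5 := h.indep_subset (sdiff_subset (s := B) (t := insert a A)) hB
        have h6 := h.mono _ _ (subset_insert c (B \ insert a A))
        omega
    rw [key I subset_rfl, hTy]
  obtain ⟨a, haI, har⟩ := hexa
  have haB := hIB haI
  have e3 := card_erase_add_one haB
  have h5 := h.indep_subset (erase_subset a B) hB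
  have h6 := h.insert_eq c (B.erase a)
  refine ⟨a, hIX haI, c, hc, B.erase a, (erase_subset _ _).trans hBXY, notMem_erase _ _, ?_,
    by omega, ?_, by omega⟩
  · intro hcm
    rw [insert_eq_of_mem hcm] at har
    omega
  · rw [insert_erase haB]; omega

end RankFn

/-- non-crossing exchange property of positroids -/
def NCProp {n : ℕ} (r : Finset (Fin n) → ℕ) : Prop :=
  ∀ (T : Finset (Fin n)) (a b c d : Fin n), a < b → b < c → c < d →
    a ∉ T → b ∉ T → c ∉ T → d ∉ T → T.card + 2 = r univ →
    r (insert a (insert b T)) = r univ → r (insert b (insert c T)) = r univ →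
    r (insert c (insert d T)) = r univ → r (insert a (insert d T)) = r univ →
    r (insert a (insert c T)) = r univ ∧ r (insert b (insert d T)) = r univ

def bdry {n : ℕ} (F : Finset (Fin n)) : Finset (Fin n × Fin n) :=
  univ.filter (fun p => p.1.val + 1 = p.2.val ∧ ¬ (p.1 ∈ F ↔ p.2 ∈ F))

theorem bdry_compl {n : ℕ} (F : Finset (Fin n)) : bdry Fᶜ = bdry F := by
  ext p; simp only [bdry, mem_filter, mem_univ, true_and, mem_compl]; tauto

theorem exists_step {n : ℕ} (p : Fin n → Prop) (x y : Fin n) (hxy : x < y) (hx : p x)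
    (hy : ¬ p y) : ∃ k j : Fin n, k.val + 1 = j.val ∧ x ≤ k ∧ j ≤ y ∧ p k ∧ ¬ p j := by
  by_contra hcon
  push Not at hcon
  have key : ∀ m : ℕ, ∀ h : m < n, x.val ≤ m → m ≤ y.val → p ⟨m, h⟩ := by
    intro m
    induction m with
    | zero =>
      intro h h1 _
      have : (⟨0, h⟩ : Fin n) = x := Fin.ext (by simp; omega)
      rw [this]; exact hx
    | succ m ih =>
      intro h h1 h2
      by_cases hm : x.val ≤ m
      · exact hcon ⟨m, by omega⟩ ⟨m + 1, h⟩ rfl hm h2 (ih (by omega) hm (by omega))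
      · have : (⟨m + 1, h⟩ : Fin n) = x := Fin.ext (by simp; omega)
        rw [this]; exact hx
  exact hy (key y y.2 (le_of_lt hxy) le_rfl)

theorem bdry_split {n : ℕ} (F : Finset (Fin n)) (y1 y2 : Fin n) (h1 : y1 ∉ F)
    (h2 : y2 ∉ F) (x z : Fin n) (hx : x ∈ F) (hx1 : y1 < x) (hx2 : x < y2) (hz : z ∈ F)
    (hz1 : z < y1 ∨ y2 < z) :
    (bdry (F.filter (fun k => y1 < k ∧ k < y2))).card < (bdry F).card ∧
    (bdry (F.filter (fun k => ¬ (y1 < k ∧ k < y2)))).card < (bdry F).card := by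
  have hne : ∀ k ∈ F, k ≠ y1 ∧ k ≠ y2 := fun k hk =>
    ⟨fun h => h1 (h ▸ hk), fun h => h2 (h ▸ hk)⟩
  constructor
  · apply card_lt_card
    rw [ssubset_iff_of_subset]
    · rcases hz1 with hz1 | hz1
      · obtain ⟨k, j, hkj, hk1, hk2, hk3, hk4⟩ := exists_step (· ∈ F) z y1 hz1 hz h1
        refine ⟨(k, j), by simp [bdry]; tauto, ?_⟩
        simp only [bdry, mem_filter, mem_univ, true_and, not_and, not_not]
        intro _
        have : ¬ (y1 < k) := by omega
        have : ¬ (y1 < j) := by omega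
        tauto
      · obtain ⟨k, j, hkj, hk1, hk2, hk3, hk4⟩ :=
          exists_step (· ∉ F) y2 z hz1 h2 (by simpa using hz)
        refine ⟨(k, j), by simp [bdry]; tauto, ?_⟩
        simp only [bdry, mem_filter, mem_univ, true_and, not_and, not_not]
        intro _
        have : ¬ (k < y2) := by omega
        have : ¬ (j < y2) := by omega
        tauto
    · rintro ⟨k, j⟩
      simp only [bdry, mem_filter, mem_univ, true_and]
      rintro ⟨hkj, h⟩
      refine ⟨hkj, fun hh => h ?_⟩
      constructor
      · rintro ⟨ha, hb, hc⟩
        have := hne j (hh.1 ha)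
        exact ⟨hh.1 ha, by omega, by omega⟩
      · rintro ⟨ha, hb, hc⟩
        have := hne k (hh.2 ha)
        exact ⟨hh.2 ha, by omega, by omega⟩
  · apply card_lt_card
    rw [ssubset_iff_of_subset]
    · obtain ⟨k, j, hkj, hk1, hk2, hk3, hk4⟩ := exists_step (· ∈ F) x y2 hx2 hx h2
      refine ⟨(k, j), by simp [bdry]; tauto, ?_⟩
      simp only [bdry, mem_filter, mem_univ, true_and, not_and, not_not]
      intro _
      have : y1 < k := by omega
      have : k < y2 := by omega
      tauto
    · rintro ⟨k, j⟩
      simp only [bdry, mem_filter, mem_univ, true_and]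
      rintro ⟨hkj, h⟩
      refine ⟨hkj, fun hh => h ?_⟩
      constructor
      · rintro ⟨ha, hb⟩
        have := hne j (hh.1 ha)
        have := hne k ha
        exact ⟨hh.1 ha, by omega⟩
      · rintro ⟨ha, hb⟩
        have := hne k (hh.2 ha)
        have := hne j ha
        exact ⟨hh.2 ha, by omega⟩

theorem compl_union_filter {n : ℕ} (F : Finset (Fin n)) (p q : Fin n → Prop)
    [DecidablePred p] [DecidablePred q] (h : ∀ k, q k ↔ ¬ p k) :
    (F ∪ Fᶜ.filter p)ᶜ = Fᶜ.filter q := by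
  ext k; simp only [mem_compl, mem_union, mem_filter, h]; tauto

theorem core_aux {n : ℕ} {r : Finset (Fin n) → ℕ} (h : RankFn r) (hnc : NCProp r)
    (F : Finset (Fin n)) (a c : Fin n) (hac : a < c) (ha : a ∈ F) (hc : c ∈ F)
    (T : Finset (Fin n)) (hT : T ⊆ F) (haT : a ∉ T) (hcT : c ∉ T) (hF : r F = T.card + 1)
    (hra : r (insert a T) = T.card + 1) (hrc : r (insert c T) = T.card + 1) :
    r (F ∪ Fᶜ.filter (fun k => a < k ∧ k < c)) + r (F ∪ Fᶜ.filter (fun k => ¬ (a < k ∧ k < c)))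
      ≤ r F + r univ := by
  by_contra hcon
  rw [not_le] at hcon
  set P := Fᶜ.filter (fun k => a < k ∧ k < c) with hP
  set Q := Fᶜ.filter (fun k => ¬ (a < k ∧ k < c)) with hQ
  have hPQ : P ∪ Q = Fᶜ := filter_union_filter_not_eq _ _
  have hun : F ∪ (P ∪ Q) = univ := by rw [hPQ]; exact union_compl F
  have hex := (h.contract F).exchange (X := P) (Y := Q) (by
    simp only [hun]
    have := h.mono F univ (subset_univ _)
    have := h.mono F (F ∪ P) subset_union_left
    have := h.mono F (F ∪ Q) subset_union_left
    omega)
  obtain ⟨b, hb, d, hd, T', hT', hbT', hdT', hD, hrb, hrd⟩ := hex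
  simp only [hun] at hD hrb hrd
  have hFu := h.mono F univ (subset_univ _)
  rw [hPQ] at hT'
  have hbF : b ∉ F := by
    have := (mem_filter.1 hb).1; simpa using this
  have hdF : d ∉ F := by
    have := (mem_filter.1 hd).1; simpa using this
  have hT'F : ∀ x ∈ T', x ∉ F := fun x hx => by simpa using hT' hx
  have hb2 := (mem_filter.1 hb).2
  have hd2 := (mem_filter.1 hd).2
  -- spanning lemma
  have span : ∀ x ∈ F, r (insert x T) = T.card + 1 → ∀ y, r (F ∪ insert y T') = r univ →
      r (insert x (insert y (T ∪ T'))) = r univ := by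
    intro x hx hxr y hy
    have h1 := h.submod (insert x T ∪ insert y T') F
    have e1 : insert x T ∪ insert y T' ∪ F = F ∪ insert y T' := by
      ext z; simp only [mem_union, mem_insert]
      constructor
      · rintro (((rfl | hz) | hz) | hz)
        · exact Or.inl hx
        · exact Or.inl (hT hz)
        · tauto
        · tauto
      · tauto
    have h2 : r (insert x T) ≤ r ((insert x T ∪ insert y T') ∩ F) := by
      apply h.mono
      intro z hz
      rw [mem_inter]
      refine ⟨mem_union_left _ hz, ?_⟩
      rcases mem_insert.1 hz with rfl | hz
      · exact hx
      · exact hT hz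
    have e2 : insert x (insert y (T ∪ T')) = insert x T ∪ insert y T' := by
      ext z; simp only [mem_union, mem_insert]; tauto
    have h3 := h.mono (insert x T ∪ insert y T') univ (subset_univ _)
    rw [e2]
    rw [e1, hy] at h1
    omega
  have hyb : r (F ∪ insert b T') = r univ := by
    have := h.mono F (F ∪ insert b T') subset_union_left
    omega
  have hyd : r (F ∪ insert d T') = r univ := by
    have := h.mono F (F ∪ insert d T') subset_union_left
    omega
  have hab := span a ha hra b hyb
  have had := span a ha hra d hyd
  have hcb := span c hc hrc b hyb
  have hcd := span c hc hrc d hyd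
  have hdisj : Disjoint T T' := by
    rw [disjoint_left]
    intro x hx hx'
    exact hT'F x hx' (hT hx)
  have hcard : (T ∪ T').card + 2 = r univ := by
    rw [card_union_of_disjoint hdisj]
    omega
  have hacr : r (insert a (insert c (T ∪ T'))) < r univ := by
    have e : insert a (insert c (T ∪ T')) ⊆ F ∪ T' := by
      intro z
      simp only [mem_union, mem_insert]
      rintro (rfl | rfl | hz | hz)
      · exact Or.inl ha
      · exact Or.inl hc
      · exact Or.inl (hT hz)
      · exact Or.inr hz
    have h1 := h.mono _ _ e
    have h2 := h.union_le_card F T'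
    omega
  have naT : a ∉ T ∪ T' := by
    simp only [mem_union, not_or]; exact ⟨haT, fun hh => hT'F a hh ha⟩
  have ncT : c ∉ T ∪ T' := by
    simp only [mem_union, not_or]; exact ⟨hcT, fun hh => hT'F c hh hc⟩
  have nbT : b ∉ T ∪ T' := by
    simp only [mem_union, not_or]; exact ⟨fun hh => hbF (hT hh), hbT'⟩
  have ndT : d ∉ T ∪ T' := by
    simp only [mem_union, not_or]; exact ⟨fun hh => hdF (hT hh), hdT'⟩
  have hda : d ≠ a := fun hh => hdF (hh ▸ ha)
  have hdc : d ≠ c := fun hh => hdF (hh ▸ hc)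
  by_cases hcase : c < d
  · have := hnc (T ∪ T') a b c d hb2.1 hb2.2 hcase naT nbT ncT ndT hcard hab
      (by rw [Finset.insert_comm]; exact hcb) hcd had
    omega
  · have hda' : d < a := by
      by_contra hh
      exact hd2 ⟨by omega, by omega⟩
    have := hnc (T ∪ T') d a b c hda' hb2.1 hb2.2 ndT naT nbT ncT hcard
      (by rw [Finset.insert_comm]; exact had) hab
      (by rw [Finset.insert_comm]; exact hcb) (by rw [Finset.insert_comm]; exact hcd)
    omega

theorem core {n : ℕ} {r : Finset (Fin n) → ℕ} (h : RankFn r) (hnc : NCProp r)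
    (F : Finset (Fin n)) (y1 y2 : Fin n) (h1 : y1 ∉ F)
    (h2 : y2 ∉ F) (x z : Fin n) (hx : x ∈ F) (hx1 : y1 < x) (hx2 : x < y2) (hz : z ∈ F)
    (hz1 : z < y1 ∨ y2 < z) :
    (∃ X Y : Finset (Fin n), Disjoint X Y ∧ X ∪ Y = F ∧ X.Nonempty ∧ Y.Nonempty ∧
      (bdry X).card < (bdry F).card ∧ (bdry Y).card < (bdry F).card ∧ r X + r Y ≤ r F) ∨
    (∃ P Q : Finset (Fin n), Disjoint P Q ∧ P ∪ Q = Fᶜ ∧ P.Nonempty ∧ Q.Nonempty ∧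
      (bdry (F ∪ P)).card < (bdry F).card ∧ (bdry (F ∪ Q)).card < (bdry F).card ∧
      r (F ∪ P) + r (F ∪ Q) ≤ r F + r univ) := by
  have hb := bdry_split F y1 y2 h1 h2 x z hx hx1 hx2 hz hz1
  set X := F.filter (fun k => y1 < k ∧ k < y2) with hX
  set Y := F.filter (fun k => ¬ (y1 < k ∧ k < y2)) with hY
  have hXY : X ∪ Y = F := filter_union_filter_not_eq _ _
  by_cases hr : r X + r Y ≤ r F
  · left
    refine ⟨X, Y, disjoint_filter_filter_not _ _ _, hXY, ⟨x, by simp [hX, *]⟩,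
      ⟨z, ?_⟩, hb.1, hb.2, hr⟩
    simp only [hY, mem_filter]
    exact ⟨hz, by omega⟩
  right
  obtain ⟨a, haX, c, hcY, T, hT, haT, hcT, hF, hra, hrc⟩ :=
    h.exchange (X := X) (Y := Y) (by rw [hXY]; omega)
  rw [hXY] at hT hF
  have haX := mem_filter.1 haX
  have hcY := mem_filter.1 hcY
  have hc1 : c ≠ y1 := fun hh => h1 (hh ▸ hcY.1)
  have hc2 : c ≠ y2 := fun hh => h2 (hh ▸ hcY.1)
  have hc3 : c < y1 ∨ y2 < c := by
    rcases lt_or_gt_of_ne hc1 with hh | hh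
    · exact Or.inl hh
    · rcases lt_or_gt_of_ne hc2 with hh' | hh'
      · exact absurd ⟨hh, hh'⟩ hcY.2
      · exact Or.inr hh'
  have main : ∀ u w : Fin n, u < w → u ∈ F → w ∈ F →
      (∃ p, p ∉ F ∧ u < p ∧ p < w) → (∃ q, q ∉ F ∧ (q < u ∨ w < q)) →
      r (F ∪ Fᶜ.filter (fun k => u < k ∧ k < w)) +
        r (F ∪ Fᶜ.filter (fun k => ¬ (u < k ∧ k < w))) ≤ r F + r univ → 
      (∃ P Q : Finset (Fin n), Disjoint P Q ∧ P ∪ Q = Fᶜ ∧ P.Nonempty ∧ Q.Nonempty ∧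
      (bdry (F ∪ P)).card < (bdry F).card ∧ (bdry (F ∪ Q)).card < (bdry F).card ∧
      r (F ∪ P) + r (F ∪ Q) ≤ r F + r univ) := by
    rintro u w huw hu hw ⟨p, hp, hp1, hp2⟩ ⟨q, hq, hq1⟩ hle
    have hb := bdry_split Fᶜ u w (by simpa using hu) (by simpa using hw) p q
      (by simpa using hp) hp1 hp2 (by simpa using hq) hq1
    refine ⟨_, _, disjoint_filter_filter_not _ _ _, filter_union_filter_not_eq _ _,
      ⟨p, by simp [hp, hp1, hp2]⟩, ⟨q, ?_⟩, ?_, ?_, hle⟩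
    · simp only [mem_filter, mem_compl]
      refine ⟨hq, fun hh => ?_⟩
      rcases hq1 with h' | h'
      · exact h'.asymm hh.1
      · exact h'.asymm hh.2
    · rw [← bdry_compl (F ∪ _)]
      have e : (F ∪ Fᶜ.filter (fun k => u < k ∧ k < w))ᶜ =
          Fᶜ.filter (fun k => ¬ (u < k ∧ k < w)) :=
        compl_union_filter _ _ _ (fun k => Iff.rfl)
      rw [e, ← bdry_compl F]; exact hb.2
    · rw [← bdry_compl (F ∪ _)]
      have e : (F ∪ Fᶜ.filter (fun k => ¬ (u < k ∧ k < w)))ᶜ =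
          Fᶜ.filter (fun k => (u < k ∧ k < w)) :=
        compl_union_filter _ _ _ (fun k => not_not.symm)
      rw [e, ← bdry_compl F]; exact hb.1
  rcases lt_trichotomy a c with hac | hac | hac
  · exact main a c hac haX.1 hcY.1
      ⟨y2, h2, haX.2.2, hc3.resolve_left (fun hh => absurd (hac.trans hh) haX.2.1.asymm)⟩
      ⟨y1, h1, Or.inl haX.2.1⟩
      (core_aux h hnc F a c hac haX.1 hcY.1 T hT haT hcT hF hra hrc)
  · exact absurd haX.2 (hac ▸ hcY.2)
  · exact main c a hac hcY.1 haX.1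
      ⟨y1, h1, hc3.resolve_right (fun hh => absurd (hh.trans hac) haX.2.2.asymm), haX.2.1⟩
      ⟨y2, h2, Or.inr haX.2.2⟩
      (core_aux h hnc F c a hac hcY.1 haX.1 T hT hcT haT hF hrc hra)

/-- If `F` is not a cyclic interval, there is a crossing configuration. -/
theorem interval_or_crossing {n : ℕ} [NeZero n] (F : Finset (Fin n)) (hne : F.Nonempty)
    (hne' : Fᶜ.Nonempty) :
    (∃ a b : Fin n, a ≤ b ∧ F = Icc a b) ∨ (∃ a b : Fin n, a ≤ b ∧ Fᶜ = Icc a b) ∨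
    ∃ y1 y2 x z : Fin n, y1 ∉ F ∧ y2 ∉ F ∧ x ∈ F ∧ y1 < x ∧ x < y2 ∧ z ∈ F ∧
      (z < y1 ∨ y2 < z) := by
  by_cases h0 : (0 : Fin n) ∈ F
  · by_cases hI : Fᶜ = Icc (Fᶜ.min' hne') (Fᶜ.max' hne')
    · exact Or.inr (Or.inl ⟨_, _, min'_le_max' _ _, hI⟩)
    · right; right
      have : ¬ (Icc (Fᶜ.min' hne') (Fᶜ.max' hne') ⊆ Fᶜ) := by
        intro hs
        apply hI
        apply subset_antisymm _ hs
        intro x hx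
        exact mem_Icc.2 ⟨min'_le _ _ hx, le_max' _ _ hx⟩
      rw [not_subset] at this
      obtain ⟨x, hx, hxF⟩ := this
      have hm := min'_mem _ hne'
      have hM := max'_mem _ hne'
      rw [mem_Icc] at hx
      have hx1 : x ≠ Fᶜ.min' hne' := fun hh => hxF (hh ▸ hm)
      have hx2 : x ≠ Fᶜ.max' hne' := fun hh => hxF (hh ▸ hM)
      have hm' := mem_compl.1 hm
      have h00 : (0 : Fin n) ≠ Fᶜ.min' hne' := fun hh => hm' (hh ▸ h0)
      exact ⟨_, _, x, 0, hm', mem_compl.1 hM, by simpa using hxF,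
        lt_of_le_of_ne hx.1 (Ne.symm hx1), lt_of_le_of_ne hx.2 hx2, h0,
        Or.inl (lt_of_le_of_ne (Fin.zero_le _) h00)⟩
  · by_cases hI : F = Icc (F.min' hne) (F.max' hne)
    · exact Or.inl ⟨_, _, min'_le_max' _ _, hI⟩
    · right; right
      have : ¬ (Icc (F.min' hne) (F.max' hne) ⊆ F) := by
        intro hs
        apply hI
        apply subset_antisymm _ hs
        intro x hx
        exact mem_Icc.2 ⟨min'_le _ _ hx, le_max' _ _ hx⟩
      rw [not_subset] at this
      obtain ⟨x, hx, hxF⟩ := this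
      have hm := min'_mem _ hne
      have hM := max'_mem _ hne
      rw [mem_Icc] at hx
      have hx1 : x ≠ F.min' hne := fun hh => hxF (hh ▸ hm)
      have hx2 : x ≠ F.max' hne := fun hh => hxF (hh ▸ hM)
      have h00 : (0 : Fin n) ≠ F.min' hne := fun hh => h0 (hh ▸ hm)
      exact ⟨0, x, _, _, h0, hxF, hm, lt_of_le_of_ne (Fin.zero_le _) h00,
        lt_of_le_of_ne hx.1 (Ne.symm hx1), hM, Or.inr (lt_of_le_of_ne hx.2 hx2)⟩

/-- Oh's theorem, inequality form. -/
theorem oh {n : ℕ} [NeZero n] {r : Finset (Fin n) → ℕ} (h : RankFn r) (hnc : NCProp r)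
    (B : Finset (Fin n)) (hB : B.card = r univ)
    (h1 : ∀ a b : Fin n, a ≤ b → (B ∩ Icc a b).card ≤ r (Icc a b))
    (h2 : ∀ a b : Fin n, a ≤ b → (B ∩ (Icc a b)ᶜ).card ≤ r (Icc a b)ᶜ) :
    r B = r univ := by
  have key : ∀ N, ∀ F : Finset (Fin n), (bdry F).card = N → (B ∩ F).card ≤ r F := by
    intro N
    induction N using Nat.strong_induction_on with
    | _ N ih =>
    intro F hN
    by_cases hne : F.Nonempty
    swap
    · rw [not_nonempty_iff_eq_empty] at hne
      subst hne; simp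
    by_cases hne' : Fᶜ.Nonempty
    swap
    · rw [not_nonempty_iff_eq_empty, compl_eq_empty_iff] at hne'
      subst hne'; simp [hB]
    rcases interval_or_crossing F hne hne' with ⟨a, b, hab, rfl⟩ | ⟨a, b, hab, hF⟩ | hcr
    · exact h1 a b hab
    · have := h2 a b hab
      rwa [← hF, compl_compl] at this
    obtain ⟨y1, y2, x, z, c1, c2, c3, c4, c5, c6, c7⟩ := hcr
    rcases core h hnc F y1 y2 c1 c2 x z c3 c4 c5 c6 c7 with
      ⟨X, Y, hd, hu, -, -, hbX, hbY, hr⟩ | ⟨P, Q, hd, hu, -, -, hbP, hbQ, hr⟩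
    · have i1 := ih _ (hN ▸ hbX) X rfl
      have i2 := ih _ (hN ▸ hbY) Y rfl
      have : (B ∩ F).card ≤ (B ∩ X).card + (B ∩ Y).card := by
        rw [← hu, inter_union_distrib_left]; exact card_union_le _ _
      omega
    · have i1 := ih _ (hN ▸ hbP) _ rfl
      have i2 := ih _ (hN ▸ hbQ) _ rfl
      have e := card_union_add_card_inter (B ∩ (F ∪ P)) (B ∩ (F ∪ Q))
      have e1 : (B ∩ (F ∪ P)) ∪ (B ∩ (F ∪ Q)) = B := by
        rw [← inter_union_distrib_left]
        have : F ∪ P ∪ (F ∪ Q) = F ∪ (P ∪ Q) := by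
          ext k; simp only [mem_union]; tauto
        rw [this, hu, union_compl, inter_univ]
      have e2 : (B ∩ (F ∪ P)) ∩ (B ∩ (F ∪ Q)) = B ∩ F := by
        ext k
        have hk : k ∈ P → k ∉ Q := fun hh => disjoint_left.1 hd hh
        simp only [mem_inter, mem_union]; tauto
      rw [e1, e2] at e
      omega
  have := key _ B rfl
  rw [inter_self] at this
  have := h.le_card B
  omega

/-- A nontrivial separator yields an interval separator. -/
theorem sep_interval {n : ℕ} [NeZero n] {r : Finset (Fin n) → ℕ} (h : RankFn r)
    (hnc : NCProp r) (S : Finset (Fin n)) (hS : S.Nonempty) (hS' : Sᶜ.Nonempty)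
    (hsep : r S + r Sᶜ = r univ) :
    ∃ a b : Fin n, a ≤ b ∧ (Icc a b)ᶜ.Nonempty ∧ r (Icc a b) + r (Icc a b)ᶜ = r univ := by
  have key : ∀ N, ∀ S : Finset (Fin n), (bdry S).card = N → S.Nonempty → Sᶜ.Nonempty →
      r S + r Sᶜ = r univ → ∃ a b : Fin n, a ≤ b ∧ (Icc a b)ᶜ.Nonempty ∧
        r (Icc a b) + r (Icc a b)ᶜ = r univ := by
    intro N
    induction N using Nat.strong_induction_on with
    | _ N ih =>
    intro S hN hne hne' hsep
    have hlow : ∀ U : Finset (Fin n), r univ ≤ r U + r Uᶜ := by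
      intro U
      have := h.submod U Uᶜ
      rw [union_compl] at this
      omega
    rcases interval_or_crossing S hne hne' with ⟨a, b, hab, rfl⟩ | ⟨a, b, hab, hF⟩ | hcr
    · exact ⟨a, b, hab, hne', hsep⟩
    · refine ⟨a, b, hab, ?_, ?_⟩
      · rwa [← hF, compl_compl]
      · rw [← hF, compl_compl]; omega
    obtain ⟨y1, y2, x, z, c1, c2, c3, c4, c5, c6, c7⟩ := hcr
    rcases core h hnc S y1 y2 c1 c2 x z c3 c4 c5 c6 c7 with
      ⟨X, Y, hd, hu, hX, hY, hbX, hbY, hr⟩ | ⟨P, Q, hd, hu, hP, hQ, hbP, hbQ, hr⟩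
    · have e : Xᶜ = Y ∪ Sᶜ := by
        ext k
        have hk : k ∈ X → k ∉ Y := fun hh => disjoint_left.1 hd hh
        simp only [mem_union, mem_compl, ← hu]; tauto
      have h2 := h.submod Y Sᶜ
      have h3 := hlow X
      rw [e] at h3
      exact ih _ (hN ▸ hbX) X rfl hX (by rw [e]; exact hY.mono subset_union_left)
        (by rw [e]; omega)
    · have e : (S ∪ P)ᶜ = Q := by
        ext k
        have hk : k ∈ P → k ∉ Q := fun hh => disjoint_left.1 hd hh
        have hk2 : k ∈ P ∪ Q ↔ k ∈ Sᶜ := by rw [hu]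
        simp only [mem_union, mem_compl] at hk2 ⊢; tauto
      have h3 := hlow (S ∪ P)
      have h4 := h.submod (S ∪ Q) Sᶜ
      have e1 : (S ∪ Q) ∪ Sᶜ = univ := by
        ext k; simp only [mem_union, mem_compl, mem_univ, iff_true]; tauto
      have e2 : (S ∪ Q) ∩ Sᶜ = Q := by
        ext k
        have hk2 : k ∈ P ∪ Q ↔ k ∈ Sᶜ := by rw [hu]
        simp only [mem_inter, mem_union, mem_compl] at hk2 ⊢; tauto
      rw [e1, e2] at h4
      rw [e] at h3
      exact ih _ (hN ▸ hbP) (S ∪ P) rfl (hne.mono subset_union_left) (by rw [e]; exact hQ)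
        (by rw [e]; omega)
  exact key _ S rfl hS hS' hsep

section cyc
variable {n : ℕ} [NeZero n]

/-- cyclic window `{a, ..., b-1}` modulo `n` -/
def cyc (n : ℕ) [NeZero n] (a b : ℕ) : Finset (Fin n) := (Ico a b).image (Fin.ofNat n)

theorem mem_cyc {a b : ℕ} {x : Fin n} :
    x ∈ cyc n a b ↔ ∃ m, a ≤ m ∧ m < b ∧ m % n = x.val := by
  simp only [cyc, mem_image, mem_Ico]
  constructor
  · rintro ⟨m, ⟨h1, h2⟩, h3⟩
    exact ⟨m, h1, h2, by rw [← h3]; rfl⟩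
  · rintro ⟨m, h1, h2, h3⟩
    exact ⟨m, ⟨h1, h2⟩, Fin.ext h3⟩

theorem cyc_left {a b : ℕ} (h : a < b) :
    cyc n a b = insert (Fin.ofNat n a) (cyc n (a + 1) b) := by
  rw [cyc, ← Finset.insert_Ico_add_one_left_eq_Ico h, image_insert]
  rfl

theorem cyc_empty {a b : ℕ} (h : b ≤ a) : cyc n a b = ∅ := by
  rw [cyc, Ico_eq_empty_of_le h, image_empty]

theorem cyc_mono {a b a' b' : ℕ} (h1 : a' ≤ a) (h2 : b ≤ b') : cyc n a b ⊆ cyc n a' b' :=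
  image_subset_image (Ico_subset_Ico h1 h2)

theorem cyc_shift (a b : ℕ) : cyc n (a + n) (b + n) = cyc n a b := by
  ext x
  rw [mem_cyc, mem_cyc]
  constructor
  · rintro ⟨m, h1, h2, h3⟩
    refine ⟨m - n, by omega, by omega, ?_⟩
    rw [← h3, ← Nat.mod_eq_sub_mod (by omega)]
  · rintro ⟨m, h1, h2, h3⟩
    exact ⟨m + n, by omega, by omega, by rw [Nat.add_mod_right]; exact h3⟩

theorem cyc_univ {a b : ℕ} (h : a + n ≤ b) : cyc n a b = univ := by
  ext x
  simp only [mem_univ, iff_true]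
  rw [mem_cyc]
  have hx := x.2
  have hn : 0 < n := by omega
  have hm := Nat.mod_lt a hn
  have hd := Nat.div_add_mod a n
  by_cases hc : a % n ≤ x.val
  · refine ⟨n * (a / n) + x.val, by omega, by omega, ?_⟩
    rw [Nat.mul_add_mod, Nat.mod_eq_of_lt hx]
  · refine ⟨n * (a / n) + (x.val + n), by omega, by omega, ?_⟩
    rw [Nat.mul_add_mod, Nat.add_mod_right, Nat.mod_eq_of_lt hx]

theorem mod_cases {m : ℕ} (h : m < 2 * n) : m % n = m ∧ m < n ∨ m % n = m - n ∧ n ≤ m := by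
  by_cases hm : m < n
  · exact Or.inl ⟨Nat.mod_eq_of_lt hm, hm⟩
  · right
    refine ⟨?_, by omega⟩
    rw [Nat.mod_eq_sub_mod (by omega), Nat.mod_eq_of_lt (by omega)]

theorem cyc_Icc {a b : Fin n} : cyc n a (b + 1) = Icc a b := by
  ext x
  rw [mem_cyc, mem_Icc]
  constructor
  · rintro ⟨m, h1, h2, h3⟩
    rw [Nat.mod_eq_of_lt (by omega)] at h3
    constructor <;> omega
  · rintro ⟨h1, h2⟩
    exact ⟨x, h1, by omega, Nat.mod_eq_of_lt x.2⟩

theorem cyc_Icc_compl {a b : Fin n} (hab : a ≤ b) : cyc n (b + 1) (a + n) = (Icc a b)ᶜ := by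
  ext x
  rw [mem_cyc, mem_compl, mem_Icc]
  constructor
  · rintro ⟨m, h1, h2, h3⟩
    rcases mod_cases (n := n) (m := m) (by omega) with h | h <;> omega
  · intro h
    by_cases hx : b < x
    · exact ⟨x, by omega, by omega, Nat.mod_eq_of_lt x.2⟩
    · exact ⟨x + n, by omega, by omega, by rw [Nat.add_mod_right, Nat.mod_eq_of_lt x.2]⟩

theorem ft_exists (r : Finset (Fin n) → ℕ) (i : ℕ) :
    ∃ m, i ≤ m ∧ r (cyc n i (m + 1)) = r (cyc n (i + 1) (m + 1)) :=
  ⟨i + n, by omega, by rw [cyc_univ (by omega), cyc_univ (by omega)]⟩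

/-- The bounded affine permutation of a rank function. -/
def ft (r : Finset (Fin n) → ℕ) (i : ℕ) : ℕ := Nat.find (ft_exists r i)

variable {r : Finset (Fin n) → ℕ}

theorem le_ft (i : ℕ) : i ≤ ft r i := (Nat.find_spec (ft_exists r i)).1

theorem ft_le (i : ℕ) : ft r i ≤ i + n :=
  Nat.find_min' _ ⟨by omega, by rw [cyc_univ (by omega), cyc_univ (by omega)]⟩

theorem ft_lt_iff (h : RankFn r) {i b : ℕ} (hib : i < b) :
    ft r i < b ↔ r (cyc n i b) = r (cyc n (i + 1) b) := by
  constructor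
  · intro hlt
    have hs := (Nat.find_spec (ft_exists r i)).2
    change r (cyc n i (ft r i + 1)) = r (cyc n (i + 1) (ft r i + 1)) at hs
    have hle := le_ft (r := r) i
    have h1 := h.submod (cyc n i (ft r i + 1)) (cyc n (i + 1) b)
    have e : cyc n i (ft r i + 1) ∪ cyc n (i + 1) b = cyc n i b := by
      rw [cyc_left (a := i) (b := ft r i + 1) (by omega), cyc_left hib, insert_union,
        union_eq_right.2 (cyc_mono le_rfl (by omega))]
    have h2 : r (cyc n (i + 1) (ft r i + 1)) ≤
        r (cyc n i (ft r i + 1) ∩ cyc n (i + 1) b) := by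
      apply h.mono
      exact subset_inter (cyc_mono (by omega) le_rfl) (cyc_mono le_rfl (by omega))
    have h3 := h.mono _ _ (cyc_mono (n := n) (a := i + 1) (a' := i) (b := b) (b' := b)
      (by omega) le_rfl)
    rw [e] at h1
    omega
  · intro heq
    have : ft r i ≤ b - 1 := Nat.find_min' _ ⟨by omega, by
      rw [show b - 1 + 1 = b by omega]; exact heq⟩
    omega

theorem rank_cyc (h : RankFn r) (b : ℕ) : ∀ k a : ℕ, b - a = k →
    r (cyc n a b) = ((Ico a b).filter (fun i => b ≤ ft r i)).card := by
  intro k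
  induction k with
  | zero =>
    intro a hk
    rw [cyc_empty (by omega), Ico_eq_empty_of_le (by omega), h.empty]; rfl
  | succ k ih =>
    intro a hk
    have hab : a < b := by omega
    have h1 := ih (a + 1) (by omega)
    have h2 := ft_lt_iff h hab
    have h3 := h.insert_eq (Fin.ofNat n a) (cyc n (a + 1) b)
    rw [← cyc_left hab] at h3
    rw [← Finset.insert_Ico_add_one_left_eq_Ico hab, filter_insert]
    by_cases hc : b ≤ ft r a
    · rw [if_pos hc, card_insert_of_notMem (by simp), ← h1]
      omega
    · rw [if_neg hc, ← h1]
      omega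

theorem rank_cyc' (h : RankFn r) (a b : ℕ) :
    r (cyc n a b) = ((Ico a b).filter (fun i => b ≤ ft r i)).card :=
  rank_cyc h b _ a rfl

theorem ft_inj (h : RankFn r) {i j : ℕ} (hij : i < j) : ft r i ≠ ft r j := by
  intro heq
  set m := ft r i with hm
  have hjm : j ≤ m := by rw [heq]; exact le_ft j
  have h1 := rank_cyc' h i m
  have h2 := rank_cyc' h i (m + 1)
  have h3 := h.mono _ _ (cyc_mono (n := n) (a := i) (a' := i) (b := m) (b' := m + 1)
      le_rfl (by omega))
  rw [h1, h2] at h3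
  rw [← Finset.insert_Ico_right_eq_Ico_add_one (by omega), filter_insert] at h3
  -- the sets
  have hsub : ((Ico i m).filter (fun k => m + 1 ≤ ft r k)) ⊆
      ((Ico i m).filter (fun k => m ≤ ft r k)).erase i := by
    intro k
    simp only [mem_filter, mem_erase, mem_Ico]
    rintro ⟨hk1, hk2⟩
    refine ⟨?_, hk1, by omega⟩
    rintro rfl
    omega
  have hi : i ∈ (Ico i m).filter (fun k => m ≤ ft r k) := by
    simp only [mem_filter, mem_Ico]; omega
  by_cases hc : m + 1 ≤ ft r m
  · rw [if_pos hc, card_insert_of_notMem (by simp)] at h3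
    have hjm' : j ≠ m := by rintro rfl; omega
    have hsub2 : ((Ico i m).filter (fun k => m + 1 ≤ ft r k)) ⊆
      (((Ico i m).filter (fun k => m ≤ ft r k)).erase i).erase j := by
      intro k hk
      refine mem_erase.2 ⟨?_, hsub hk⟩
      rintro rfl
      have := (mem_filter.1 hk).2
      omega
    have hj : j ∈ ((Ico i m).filter (fun k => m ≤ ft r k)).erase i := by
      simp only [mem_erase, mem_filter, mem_Ico]; omega
    have := card_le_card hsub2
    have := card_erase_add_one hi
    have := card_erase_add_one hj
    omega
  · rw [if_neg hc] at h3
    have := card_le_card hsub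
    have := card_erase_add_one hi
    omega

theorem ft_shift (i : ℕ) : ft r (i + n) = ft r i + n := by
  apply le_antisymm
  · apply Nat.find_min'
    have hs := Nat.find_spec (ft_exists r i)
    refine ⟨by have := le_ft (r := r) i; omega, ?_⟩
    rw [show ft r i + n + 1 = ft r i + 1 + n by omega, show i + n + 1 = i + 1 + n by omega,
      cyc_shift, cyc_shift]
    exact hs.2
  · have hs := Nat.find_spec (ft_exists r (i + n))
    change i + n ≤ ft r (i + n) ∧ r (cyc n (i + n) (ft r (i + n) + 1)) =
      r (cyc n (i + n + 1) (ft r (i + n) + 1)) at hs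
    have hle := hs.1
    have : ft r i ≤ ft r (i + n) - n := by
      apply Nat.find_min'
      refine ⟨by omega, ?_⟩
      rw [← cyc_shift i, ← cyc_shift (i + 1),
        show ft r (i + n) - n + 1 + n = ft r (i + n) + 1 by omega,
        show i + 1 + n = i + n + 1 by omega]
      exact hs.2
    omega

theorem ft_mod_inj (h : RankFn r) : Function.Injective
    (fun k : Fin n => Fin.ofNat n (ft r k.val)) := by
  intro i j hij
  have hij : ft r i.val % n = ft r j.val % n := congrArg Fin.val hij
  have hi := ft_le (r := r) i.val
  have hj := ft_le (r := r) j.val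
  have aux : ∀ i j : ℕ, ft r i = ft r j → i = j := by
    intro i j hh
    rcases lt_trichotomy i j with h1 | h1 | h1
    · exact absurd hh (ft_inj h h1)
    · exact h1
    · exact absurd hh.symm (ft_inj h h1)
  have s1 := ft_shift (r := r) i.val
  have s2 := ft_shift (r := r) j.val
  rcases mod_cases (n := n) (m := ft r i.val) (by omega) with h1 | h1 <;>
  rcases mod_cases (n := n) (m := ft r j.val) (by omega) with h2 | h2
  · exact Fin.ext (aux _ _ (by omega))
  · have := aux (i.val + n) j.val (by omega)
    omega
  · have := aux (i.val) (j.val + n) (by omega)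
    omega
  · exact Fin.ext (aux _ _ (by omega))

/-- The permutation of a rank function. -/
noncomputable def ftPerm (h : RankFn r) : Equiv.Perm (Fin n) :=
  Equiv.ofBijective _ (Finite.injective_iff_bijective.1 (ft_mod_inj h))

theorem ftPerm_val (h : RankFn r) (k : Fin n) : (ftPerm h k).val = ft r k.val % n := rfl

/-- no nontrivial separators -/
def NoSep (r : Finset (Fin n) → ℕ) : Prop :=
  ∀ S : Finset (Fin n), S.Nonempty → Sᶜ.Nonempty → r S + r Sᶜ ≠ r univ

theorem sif_of_noSep (h : RankFn r) (hs : NoSep r) : IsSIF (ftPerm h) := by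
  intro a b hab hne himg
  apply hs (Icc a b) ⟨a, by simp [hab]⟩
  · rw [nonempty_iff_ne_empty, Ne, compl_eq_empty_iff]; exact hne
  have hA : r (Icc a b) = ((Ico a.val (b.val + 1)).filter (fun i => b.val + 1 ≤ ft r i)).card := by
    rw [← cyc_Icc, rank_cyc' h]
  have hB : r (Icc a b)ᶜ =
      ((Ico (b.val + 1) (a.val + n)).filter (fun i => a.val + n ≤ ft r i)).card := by
    rw [← cyc_Icc_compl hab, rank_cyc' h]
  have hC : r univ =
      ((Ico a.val (a.val + n)).filter (fun i => a.val + n ≤ ft r i)).card := by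
    rw [← cyc_univ (n := n) (a := a.val) (b := a.val + n) le_rfl, rank_cyc' h]
  rw [hA, hB, hC]
  have hU : Ico a.val (a.val + n) = Ico a.val (b.val + 1) ∪ Ico (b.val + 1) (a.val + n) := by
    rw [Ico_union_Ico_eq_Ico] <;> omega
  rw [hU, filter_union, card_union_of_disjoint]
  · congr 2
    apply filter_congr
    intro i hi
    rw [mem_Ico] at hi
    constructor
    swap
    · intro _; omega
    intro hle
    have hin : i < n := by omega
    have hmem : ftPerm h ⟨i, hin⟩ ∈ Icc a b := by
      rw [← himg]
      apply mem_image_of_mem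
      rw [mem_Icc]
      constructor
      · exact hi.1
      · exact Fin.le_def.2 (by simp; omega)
    rw [mem_Icc, Fin.le_def, Fin.le_def, ftPerm_val] at hmem
    simp only at hmem
    have := ft_le (r := r) i
    rcases mod_cases (n := n) (m := ft r i) (by omega) with h1 | h1 <;> omega
  · apply disjoint_filter_filter
    exact Ico_disjoint_Ico_consecutive _ _ _

theorem ft_ne_self (hn : 2 ≤ n) (h : RankFn r) (hs : NoSep r) (k : Fin n) :
    ft r k ≠ k ∧ ft r k ≠ k + n := by
  have hc : ({k} : Finset (Fin n))ᶜ.Nonempty := by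
    rw [← card_pos, card_compl, card_singleton, Fintype.card_fin]; omega
  have h0 := hs {k} (singleton_nonempty k) hc
  have h1 := h.submod {k} {k}ᶜ
  rw [union_compl] at h1
  have hm := h.mono {k}ᶜ univ (subset_univ _)
  have h2 : r {k} ≤ 1 := by simpa using h.le_card {k}
  have h4 : cyc n k (k + 1) = {k} := by rw [cyc_Icc]; simp
  have h5 : cyc n (k + 1) (k + n) = {k}ᶜ := by
    rw [cyc_Icc_compl le_rfl]; simp
  constructor
  · intro hh
    have := (ft_lt_iff h (i := k) (b := k + 1) (by omega)).1 (by omega)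
    rw [h4, cyc_empty le_rfl, h.empty] at this
    omega
  · intro hh
    have h3 := (not_congr (ft_lt_iff h (i := k) (b := k + n) (by omega))).1 (by omega)
    rw [h5, cyc_univ le_rfl] at h3
    omega

theorem rank_eq_of_perm (hn : 2 ≤ n) {r' : Finset (Fin n) → ℕ} (h : RankFn r)
    (h' : RankFn r') (hs : NoSep r) (hs' : NoSep r') (hp : ftPerm h = ftPerm h') (a b : ℕ) :
    r (cyc n a b) = r' (cyc n a b) := by
  rw [rank_cyc' h, rank_cyc' h']
  have key : ∀ i, ft r i = ft r' i := by
    intro i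
    induction i using Nat.strong_induction_on with
    | _ i ih =>
    by_cases hi : i < n
    · have e := congrArg Fin.val (congrArg (fun p => p ⟨i, hi⟩) hp)
      simp only [ftPerm_val] at e
      have h1 := ft_ne_self hn h hs ⟨i, hi⟩
      have h2 := ft_ne_self hn h' hs' ⟨i, hi⟩
      simp only at h1 h2
      have a1 := ft_le (r := r) i
      have a2 := ft_le (r := r') i
      have b1 := le_ft (r := r) i
      have b2 := le_ft (r := r') i
      rcases mod_cases (n := n) (m := ft r i) (by omega) with c1 | c1 <;>
      rcases mod_cases (n := n) (m := ft r' i) (by omega) with c2 | c2 <;> omega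
    · have := ih (i - n) (by omega)
      have e1 := ft_shift (r := r) (i - n)
      have e2 := ft_shift (r := r') (i - n)
      rw [show i - n + n = i by omega] at e1 e2
      omega
  simp only [key]

theorem sep_rank (h : RankFn r) {S : Finset (Fin n)} (hsep : r S + r Sᶜ = r univ)
    (J : Finset (Fin n)) : r J = r (J ∩ S) + r (J ∩ Sᶜ) := by
  have h1 := h.submod (J ∩ S) (J ∩ Sᶜ)
  rw [← inter_union_distrib_left, union_compl, inter_univ] at h1
  have h2 := h.submod J S
  have h3 := h.submod (J ∪ S) Sᶜ
  have e1 : J ∪ S ∪ Sᶜ = univ := by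
    ext k; simp only [mem_union, mem_compl, mem_univ, iff_true]; tauto
  have e2 : (J ∪ S) ∩ Sᶜ = J ∩ Sᶜ := by
    ext k; simp only [mem_union, mem_inter, mem_compl]; tauto
  rw [e1, e2] at h3
  omega

theorem perm_preserves_sep (h : RankFn r) {S : Finset (Fin n)}
    (hsep : r S + r Sᶜ = r univ) (i : Fin n) (hi : i ∈ S) : ftPerm h i ∈ S := by
  by_contra hcon
  set m := ft r i with hm
  have him : i.val ≤ m := le_ft _
  have hmS : Fin.ofNat n m ∉ S := hcon
  have hiv : Fin.ofNat n i.val = i := Fin.ext (Nat.mod_eq_of_lt i.2)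
  have hne : i.val ≠ m := by
    intro hh
    rw [← hh, hiv] at hmS
    exact hmS hi
  have h1 := (ft_lt_iff h (i := i) (b := m + 1) (by omega)).1 (by omega)
  have h2 := (not_congr (ft_lt_iff h (i := i) (b := m) (by omega))).1 (by omega)
  apply h2
  have e : ∀ a, a ≤ m → cyc n a (m + 1) ∩ S = cyc n a m ∩ S := by
    intro a ha
    rw [cyc, ← Finset.insert_Ico_right_eq_Ico_add_one ha, image_insert,
      insert_inter_of_notMem hmS]
    rfl
  have e' : ∀ b, i.val < b → cyc n i b ∩ Sᶜ = cyc n (i + 1) b ∩ Sᶜ := by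
    intro b hb
    rw [cyc_left hb, hiv, insert_inter_of_notMem (by simpa using hi)]
  rw [sep_rank h hsep (cyc n i (m + 1)), sep_rank h hsep (cyc n (i + 1) (m + 1)),
    e _ (by omega), e _ (by omega), e' _ (by omega)] at h1
  rw [sep_rank h hsep (cyc n i m), sep_rank h hsep (cyc n (i + 1) m), e' _ (by omega)]
  omega

theorem noSep_of_sif (h : RankFn r) (hnc : NCProp r) (hs : IsSIF (ftPerm h)) : NoSep r := by
  intro S hS hS' hsep
  obtain ⟨a, b, hab, hne, hsep⟩ := sep_interval h hnc S hS hS' hsep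
  apply hs a b hab
  · rwa [nonempty_iff_ne_empty, Ne, compl_eq_empty_iff] at hne
  apply eq_of_subset_of_card_le
  · intro x hx
    obtain ⟨y, hy, rfl⟩ := mem_image.1 hx
    exact perm_preserves_sep h hsep y hy
  · rw [card_image_of_injective _ (ftPerm h).injective]

end cyc

theorem noSep_iff {n : ℕ} [NeZero n] {r : Finset (Fin n) → ℕ} (h : RankFn r)
    (ℬ : Finset (Finset (Fin n)))
    (hB : ∀ B, B ∈ ℬ ↔ B.card = r univ ∧ r B = r univ) :
    MatroidConnected (fun B => B ∈ ℬ) ↔ NoSep r := by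
  have bases : ∀ S : Finset (Fin n),
      IsBasesSet (fun B : Finset (Fin n) => B ⊆ S ∧ B.card = r S ∧ r B = r S) := by
    intro S
    refine ⟨?_, ?_⟩
    · obtain ⟨J, -, hJ, h1, h2⟩ := h.extend (empty_subset S) (by simp [h.empty])
      exact ⟨J, hJ, by omega, h2⟩
    · rintro B₁ B₂ ⟨hs1, hc1, hr1⟩ ⟨hs2, hc2, hr2⟩ b₁ hb
      rw [mem_sdiff] at hb
      have hi := h.indep_subset (erase_subset b₁ B₁) (by omega)
      have hce := card_erase_add_one hb.1
      have hex : ∃ x ∈ B₂, r (insert x (B₁.erase b₁)) ≠ r (B₁.erase b₁) := by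
        by_contra hcon
        push Not at hcon
        have h1 := h.closure _ _ hcon
        have h2 := h.mono B₂ (B₁.erase b₁ ∪ B₂) subset_union_right
        omega
      obtain ⟨x, hx, hxr⟩ := hex
      have hx1 : x ∉ B₁.erase b₁ := by
        intro hh; rw [insert_eq_of_mem hh] at hxr; exact hxr rfl
      have hxb : x ≠ b₁ := by rintro rfl; exact hb.2 hx
      have h3 := h.insert_eq x (B₁.erase b₁)
      refine ⟨x, ?_, ?_, ?_, ?_⟩
      · rw [mem_sdiff]
        exact ⟨hx, fun hh => hx1 (mem_erase.2 ⟨hxb, hh⟩)⟩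
      · exact insert_subset (hs2 hx) ((erase_subset _ _).trans hs1)
      · rw [card_insert_of_notMem hx1]; omega
      · omega
  constructor
  · intro hc S hS hS' hsep
    apply hc
    refine ⟨S, Sᶜ, _, _, hS, hS', disjoint_compl_right, union_compl S, bases S, bases Sᶜ,
      fun B hB => hB.1, fun B hB => hB.1, ?_⟩
    intro B
    refine (hB B).trans ?_
    constructor
    · rintro ⟨hc, hr⟩
      have e := inter_union_distrib_left B S Sᶜ
      rw [union_compl, inter_univ] at e
      have hd : Disjoint (B ∩ S) (B ∩ Sᶜ) :=
        disjoint_of_subset_left inter_subset_right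
          (disjoint_of_subset_right inter_subset_right disjoint_compl_right)
      have hcard := card_union_of_disjoint hd
      rw [← e] at hcard
      have i1 := h.indep_subset (inter_subset_left (s₁ := B) (s₂ := S)) (by omega)
      have i2 := h.indep_subset (inter_subset_left (s₁ := B) (s₂ := Sᶜ)) (by omega)
      have m1 := h.mono _ _ (inter_subset_right (s₁ := B) (s₂ := S))
      have m2 := h.mono _ _ (inter_subset_right (s₁ := B) (s₂ := Sᶜ))
      exact ⟨B ∩ S, B ∩ Sᶜ, ⟨inter_subset_right, by omega, by omega⟩,
        ⟨inter_subset_right, by omega, by omega⟩, e⟩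
    · rintro ⟨B₁, B₂, ⟨hs1, hc1, hr1⟩, ⟨hs2, hc2, hr2⟩, rfl⟩
      have hd : Disjoint B₁ B₂ :=
        disjoint_of_subset_left hs1 (disjoint_of_subset_right hs2 disjoint_compl_right)
      refine ⟨by rw [card_union_of_disjoint hd]; omega, ?_⟩
      rw [sep_rank h hsep]
      have e1 : (B₁ ∪ B₂) ∩ S = B₁ := by
        ext x
        have a1 := @hs1 x
        have a2 := @hs2 x
        simp only [mem_inter, mem_union, mem_compl] at *
        tauto
      have e2 : (B₁ ∪ B₂) ∩ Sᶜ = B₂ := by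
        ext x
        have a1 := @hs1 x
        have a2 := @hs2 x
        simp only [mem_inter, mem_union, mem_compl] at *
        tauto
      rw [e1, e2]
      omega
  · rintro hs ⟨E₁, E₂, ℬ₁, ℬ₂, hE1, hE2, hdis, huni, hb1, hb2, hsub1, hsub2, hdec⟩
    have hE : E₁ᶜ = E₂ := by
      rw [compl_eq_univ_sdiff, ← huni, union_sdiff_left]
      exact sdiff_eq_self_of_disjoint hdis.symm
    apply hs E₁ hE1 (by rwa [hE])
    rw [hE]
    obtain ⟨C₁, hC₁⟩ := hb1.1
    obtain ⟨C₂, hC₂⟩ := hb2.1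
    have dj : ∀ B₁ B₂, ℬ₁ B₁ → ℬ₂ B₂ → Disjoint B₁ B₂ := fun B₁ B₂ h1 h2 =>
      disjoint_of_subset_left (hsub1 _ h1) (disjoint_of_subset_right (hsub2 _ h2) hdis)
    have hcd : ∀ B₁ B₂, ℬ₁ B₁ → ℬ₂ B₂ → B₁.card + B₂.card = r univ := by
      intro B₁ B₂ h1 h2
      have := ((hB (B₁ ∪ B₂)).1 ((hdec _).2 ⟨B₁, B₂, h1, h2, rfl⟩)).1
      rwa [card_union_of_disjoint (dj _ _ h1 h2)] at this
    have up : ∀ E : Finset (Fin n), ∃ B ∈ ℬ, r E ≤ (B ∩ E).card := by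
      intro E
      obtain ⟨I, -, hIE, hI, hIr⟩ := h.extend (empty_subset E) (by simp [h.empty])
      obtain ⟨B, hIB, -, hBc, hBr⟩ := h.extend (subset_univ I) hI
      refine ⟨B, (hB B).2 ⟨by omega, hBr⟩, ?_⟩
      rw [← hIr, hI]
      exact card_le_card (subset_inter hIB hIE)
    have sep1 : r univ ≤ r E₁ + r E₂ := by
      have := h.submod E₁ E₂
      rw [huni] at this
      omega
    obtain ⟨B, hBm, hBr⟩ := up E₁
    obtain ⟨B', hBm', hBr'⟩ := up E₂
    obtain ⟨B₁, B₂, h1, h2, rfl⟩ := (hdec B).1 hBm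
    obtain ⟨B₁', B₂', h1', h2', rfl⟩ := (hdec B').1 hBm'
    have e1 : (B₁ ∪ B₂) ∩ E₁ ⊆ B₁ := by
      intro x hx
      rw [mem_inter, mem_union] at hx
      rcases hx.1 with hh | hh
      · exact hh
      · exact absurd hx.2 (disjoint_right.1 hdis (hsub2 _ h2 hh))
    have e2 : (B₁' ∪ B₂') ∩ E₂ ⊆ B₂' := by
      intro x hx
      rw [mem_inter, mem_union] at hx
      rcases hx.1 with hh | hh
      · exact absurd hx.2 (disjoint_left.1 hdis (hsub1 _ h1' hh))
      · exact hh
    have := card_le_card e1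
    have := card_le_card e2
    have := hcd _ _ h1 h2'
    omega

/-- rank function of a basis family -/
def brk {n : ℕ} (ℬ : Finset (Finset (Fin n))) (J : Finset (Fin n)) : ℕ :=
  ℬ.sup (fun B => (B ∩ J).card)

theorem brk_eq {n : ℕ} {r : Finset (Fin n) → ℕ} (h : RankFn r) (ℬ : Finset (Finset (Fin n)))
    (hB : ∀ B, B ∈ ℬ ↔ B.card = r univ ∧ r B = r univ) : brk ℬ = r := by
  funext J
  apply le_antisymm
  · apply Finset.sup_le
    intro B hBm
    have hb := (hB B).1 hBm
    have := h.indep_subset (inter_subset_left (s₁ := B) (s₂ := J)) (by omega)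
    have := h.mono _ _ (inter_subset_right (s₁ := B) (s₂ := J))
    omega
  · obtain ⟨I, -, hIE, hI, hIr⟩ := h.extend (empty_subset J) (by simp [h.empty])
    obtain ⟨B, hIB, -, hBc, hBr⟩ := h.extend (subset_univ I) hI
    have hm : B ∈ ℬ := (hB B).2 ⟨by omega, hBr⟩
    have h1 : (B ∩ J).card ≤ brk ℬ J := Finset.le_sup (f := fun B => (B ∩ J).card) hm
    have h2 := card_le_card (subset_inter hIB hIE)
    omega

/-- linear rank function -/
noncomputable def vrk {n d : ℕ} (v : Fin n → Fin d → ℝ) (J : Finset (Fin n)) : ℕ :=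
  Module.finrank ℝ (Submodule.span ℝ (v '' (J : Set (Fin n))))

theorem vrk_rankFn {n d : ℕ} (v : Fin n → Fin d → ℝ) : RankFn (vrk v) where
  empty := by simp [vrk]
  mono S T hST := by
    apply Submodule.finrank_mono
    apply Submodule.span_mono
    exact Set.image_mono (by exact_mod_cast hST)
  insert_le x S := by
    unfold vrk
    rw [coe_insert, Set.image_insert_eq, Submodule.span_insert]
    have h1 := Submodule.finrank_add_le_finrank_add_finrank
      (Submodule.span ℝ {v x}) (Submodule.span ℝ (v '' (S : Set (Fin n))))
    have h2 := finrank_span_le_card (R := ℝ) ({v x} : Set (Fin d → ℝ))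
    simp at h2
    omega
  submod S T := by
    unfold vrk
    have h1 := Submodule.finrank_sup_add_finrank_inf_eq
      (Submodule.span ℝ (v '' (S : Set (Fin n)))) (Submodule.span ℝ (v '' (T : Set (Fin n))))
    rw [← Submodule.span_union, ← Set.image_union, ← coe_union] at h1
    have h2 : Module.finrank ℝ (Submodule.span ℝ (v '' ((S ∩ T : Finset (Fin n)) : Set (Fin n)))) ≤
      Module.finrank ℝ ↥(Submodule.span ℝ (v '' (S : Set (Fin n))) ⊓
        Submodule.span ℝ (v '' (T : Set (Fin n)))) := by
      apply Submodule.finrank_mono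
      apply le_inf <;> apply Submodule.span_mono <;> apply Set.image_mono <;>
        rw [coe_inter]
      · exact Set.inter_subset_left
      · exact Set.inter_subset_right
    omega

theorem vrk_insert_iff {n d : ℕ} (v : Fin n → Fin d → ℝ) (x : Fin n) (J : Finset (Fin n)) :
    vrk v (insert x J) = vrk v J ↔ v x ∈ Submodule.span ℝ (v '' (J : Set (Fin n))) := by
  unfold vrk
  rw [coe_insert, Set.image_insert_eq]
  constructor
  · intro h
    have hle : Submodule.span ℝ (v '' (J : Set (Fin n))) ≤
        Submodule.span ℝ (insert (v x) (v '' (J : Set (Fin n)))) :=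
      Submodule.span_mono (Set.subset_insert _ _)
    rw [Submodule.eq_of_le_of_finrank_eq hle h.symm]
    exact Submodule.subset_span (Set.mem_insert _ _)
  · intro h
    rw [Submodule.span_insert_eq_span h]

theorem indep_iff_vrk {n d : ℕ} (v : Fin n → Fin d → ℝ) (B : Finset (Fin n)) :
    LinearIndependent ℝ (fun j : B => v j.1) ↔ vrk v B = B.card := by
  rw [linearIndependent_iff_card_eq_finrank_span, Fintype.card_coe, eq_comm]
  have : Set.range (fun j : B => v j.1) = v '' (B : Set (Fin n)) := by
    ext y; simp
  unfold Set.finrank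
  rw [this]
  rfl

theorem vrk_univ {n d : ℕ} (v : Fin n → Fin d → ℝ) :
    vrk v univ = (Matrix.of (fun i j => v j i)).rank := by
  rw [Matrix.rank_eq_finrank_span_cols]
  unfold vrk
  rw [coe_univ, Set.image_univ]
  rfl

/-- positroids in terms of vector configurations -/
theorem bases_iff {n d : ℕ} (v : Fin n → Fin d → ℝ) (hr : vrk v univ = d)
    (ℬ : Finset (Finset (Fin n))) :
    (Matrix.of (fun i j => v j i)).RepresentsBases (fun B => B ∈ ℬ) ↔
      ∀ B, B ∈ ℬ ↔ B.card = vrk v univ ∧ vrk v B = vrk v univ := by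
  unfold Matrix.RepresentsBases
  apply forall_congr'
  intro B
  have := indep_iff_vrk v B
  simp only [Matrix.of_apply] at this ⊢
  rw [show (LinearIndependent ℝ fun j : B => fun i => v j.1 i) ↔ vrk v B = B.card from this, hr]
  constructor
  · intro h; rw [h]; constructor <;> rintro ⟨a, b⟩ <;> exact ⟨a, by omega⟩
  · intro h; rw [h]; constructor <;> rintro ⟨a, b⟩ <;> exact ⟨a, by omega⟩

/-- signed maximal minor -/
noncomputable def sdet {n d : ℕ} (v : Fin n → Fin d → ℝ) (g : Fin d → Fin n) : ℝ :=
  (Matrix.of (fun p => v (g p))).det *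
    (Matrix.vandermonde (fun p => ((g p).val : ℝ))).det

def TNN {n d : ℕ} (v : Fin n → Fin d → ℝ) : Prop := ∀ g : Fin d → Fin n, 0 ≤ sdet v g

theorem sdet_perm {n d : ℕ} (v : Fin n → Fin d → ℝ) (g : Fin d → Fin n) (σ : Equiv.Perm (Fin d)) :
    sdet v (g ∘ σ) = sdet v g := by
  unfold sdet
  have h1 := Matrix.det_permute σ (Matrix.of (fun p => v (g p)))
  have h2 := Matrix.det_permute σ (Matrix.vandermonde (fun p => ((g p).val : ℝ)))
  have e1 : (Matrix.of (fun p => v (g p))).submatrix σ id =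
      Matrix.of (fun p => v ((g ∘ σ) p)) := rfl
  have e2 : (Matrix.vandermonde (fun p => ((g p).val : ℝ))).submatrix σ id =
      Matrix.vandermonde (fun p => (((g ∘ σ) p).val : ℝ)) := by
    ext i j; simp [Matrix.vandermonde]
  rw [← e1, ← e2, h1, h2]
  rcases Int.units_eq_one_or (Equiv.Perm.sign σ) with h | h <;> rw [h] <;> push_cast <;> ring

theorem vand_pos {n d : ℕ} (g : Fin d → Fin n) (hg : StrictMono g) :
    0 < (Matrix.vandermonde (fun p => ((g p).val : ℝ))).det := by
  rw [Matrix.det_vandermonde]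
  apply prod_pos
  intro i _
  apply prod_pos
  intro j hj
  have := hg (mem_Ioi.1 hj)
  rw [sub_pos]
  exact_mod_cast this

theorem tnn_iff {n d : ℕ} (v : Fin n → Fin d → ℝ) :
    TNN v ↔ ∀ g : Fin d → Fin n, StrictMono g → 0 ≤ (Matrix.of (fun p => v (g p))).det := by
  constructor
  · intro h g hg
    have h1 := h g
    unfold sdet at h1
    exact nonneg_of_mul_nonneg_left h1 (vand_pos g hg)
  · intro h g
    by_cases hg : Function.Injective g
    · rw [← sdet_perm v g (Tuple.sort g)]
      have hs : StrictMono (g ∘ Tuple.sort g) :=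
        (Tuple.monotone_sort g).strictMono_of_injective (hg.comp (Equiv.injective _))
      exact mul_nonneg (h _ hs) (vand_pos _ hs).le
    · unfold sdet
      have : (Matrix.vandermonde (fun p => ((g p).val : ℝ))).det = 0 := by
        by_contra hne
        rw [← ne_eq, Matrix.det_vandermonde_ne_zero_iff] at hne
        apply hg
        intro a b hab
        apply hne
        simp [hab]
      rw [this, mul_zero]

theorem totallyNonneg_iff {n d : ℕ} (v : Fin n → Fin d → ℝ) :
    (Matrix.of (fun i j => v j i)).TotallyNonneg ↔ vrk v univ = d ∧ TNN v := by
  unfold Matrix.TotallyNonneg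
  rw [vrk_univ, tnn_iff]
  apply and_congr_right
  intro _
  apply forall_congr'
  intro g
  rw [← Matrix.det_transpose]
  rfl

/-- determinant as a linear function of the first row -/
noncomputable def detL {e : ℕ} (R : Fin e → Fin (e+1) → ℝ) : (Fin (e+1) → ℝ) →ₗ[ℝ] ℝ where
  toFun w := (Matrix.of (Fin.cons w R : Fin (e+1) → Fin (e+1) → ℝ)).det
  map_add' x y := by
    have := Matrix.det_updateRow_add (Matrix.of (Fin.cons 0 R : Fin (e+1) → Fin (e+1) → ℝ)) 0 x y
    have e1 : ∀ w, (Matrix.of (Fin.cons 0 R : Fin (e+1) → Fin (e+1) → ℝ)).updateRow 0 w =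
      Matrix.of (Fin.cons w R : Fin (e+1) → Fin (e+1) → ℝ) := by
      intro w
      exact Fin.update_cons_zero (α := fun _ => Fin (e+1) → ℝ) 0 R w
    simpa only [e1] using this
  map_smul' c x := by
    have := Matrix.det_updateRow_smul (Matrix.of (Fin.cons 0 R : Fin (e+1) → Fin (e+1) → ℝ)) 0 c x
    have e1 : ∀ w, (Matrix.of (Fin.cons 0 R : Fin (e+1) → Fin (e+1) → ℝ)).updateRow 0 w =
      Matrix.of (Fin.cons w R : Fin (e+1) → Fin (e+1) → ℝ) := by
      intro w
      exact Fin.update_cons_zero (α := fun _ => Fin (e+1) → ℝ) 0 R w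
    simpa only [e1, RingHom.id_apply, smul_eq_mul] using this

theorem detL_span {e : ℕ} (R : Fin e → Fin (e+1) → ℝ) (w : Fin (e+1) → ℝ)
    (hw : w ∈ Submodule.span ℝ (Set.range R)) : detL R w = 0 := by
  have : Submodule.span ℝ (Set.range R) ≤ LinearMap.ker (detL R) := by
    rw [Submodule.span_le]
    rintro _ ⟨s, rfl⟩
    change detL R (R s) = 0
    apply Matrix.det_zero_of_row_eq (i := 0) (j := s.succ) (Fin.succ_ne_zero s).symm
    rfl
  exact this hw

theorem detL_ne_zero_iff {d : ℕ} (R : Fin d → Fin d → ℝ) :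
    (Matrix.of R).det ≠ 0 ↔ LinearIndependent ℝ R := by
  rw [← isUnit_iff_ne_zero, ← Matrix.isUnit_iff_isUnit_det,
    ← Matrix.linearIndependent_rows_iff_isUnit]
  rfl

theorem det_ne_zero_iff_vrk {n d : ℕ} (v : Fin n → Fin d → ℝ) (g : Fin d → Fin n) :
    (Matrix.of (fun p => v (g p))).det ≠ 0 ↔ vrk v (univ.image g) = d := by
  rw [detL_ne_zero_iff, linearIndependent_iff_card_eq_finrank_span, Fintype.card_fin, eq_comm]
  unfold Set.finrank vrk
  rw [coe_image, coe_univ, Set.image_univ, ← Set.range_comp]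
  rfl

theorem vand_cons {n e : ℕ} (x : Fin n) (g : Fin e → Fin n) :
    (Matrix.vandermonde (fun p => (((Fin.cons x g : Fin (e+1) → Fin n) p).val : ℝ))).det =
      (∏ s, (((g s).val : ℝ) - x.val)) *
        (Matrix.vandermonde (fun p => ((g p).val : ℝ))).det := by
  simp only [Matrix.det_vandermonde]
  rw [Fin.prod_univ_succ]
  congr 1
  · rw [Fin.prod_Ioi_zero]; simp
  · apply prod_congr rfl
    intro i _
    rw [Fin.prod_Ioi_succ]
    simp

theorem detL_cons {n e : ℕ} (v : Fin n → Fin (e+1) → ℝ) (x : Fin n) (g : Fin e → Fin n) :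
    (Matrix.of (fun p => v ((Fin.cons x g : Fin (e+1) → Fin n) p))).det =
      detL (fun s => v (g s)) (v x) := by
  change _ = (Matrix.of _).det
  congr 2
  funext p
  refine Fin.cases ?_ (fun s => ?_) p <;> simp

theorem sdet_cons {n e : ℕ} (v : Fin n → Fin (e+1) → ℝ) (x : Fin n) (g : Fin e → Fin n) :
    sdet v (Fin.cons x g) = detL (fun s => v (g s)) (v x) *
      ((∏ s, (((g s).val : ℝ) - x.val)) *
        (Matrix.vandermonde (fun p => ((g p).val : ℝ))).det) := by
  unfold sdet
  rw [vand_cons, detL_cons]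

/-- two-row determinants -/
noncomputable def om {n e : ℕ} (v : Fin n → Fin (e+2) → ℝ) (g : Fin e → Fin n) (x y : Fin n) : ℝ :=
  detL (fun s => v ((Fin.cons y g : Fin (e+1) → Fin n) s)) (v x)

theorem om_ne_zero_iff {n e : ℕ} (v : Fin n → Fin (e+2) → ℝ) (g : Fin e → Fin n) (x y : Fin n) :
    om v g x y ≠ 0 ↔ vrk v (insert x (insert y (univ.image g))) = e + 2 := by
  unfold om
  rw [← detL_cons, det_ne_zero_iff_vrk]
  have : univ.image (Fin.cons x (Fin.cons y g : Fin (e+1) → Fin n) : Fin (e+2) → Fin n) =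
      insert x (insert y (univ.image g)) := by
    ext z
    simp [Fin.exists_fin_succ, eq_comm]
  rw [this]

theorem om_plucker {n e : ℕ} (v : Fin n → Fin (e+2) → ℝ) (g : Fin e → Fin n) (p q y z : Fin n)
    (h0 : om v g p q = 0) (h1 : ∃ w, om v g w q ≠ 0) :
    om v g p y * om v g q z = om v g p z * om v g q y := by
  obtain ⟨w, hw⟩ := h1
  have hli : LinearIndependent ℝ (fun s => v ((Fin.cons q g : Fin (e+1) → Fin n) s)) := by
    have h2 := (detL_ne_zero_iff _).1 hw
    exact (linearIndependent_finCons.1 h2).1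
  have hmem : v p ∈ Submodule.span ℝ
      (Set.range (fun s => v ((Fin.cons q g : Fin (e+1) → Fin n) s))) := by
    by_contra hne
    have : om v g p q ≠ 0 :=
      (detL_ne_zero_iff _).2 (linearIndependent_finCons.2 ⟨hli, hne⟩)
    exact this h0
  have hr : Set.range (fun s => v ((Fin.cons q g : Fin (e+1) → Fin n) s)) =
      insert (v q) (Set.range (fun s => v (g s))) := by
    ext z
    simp [Fin.exists_fin_succ, eq_comm]
  rw [hr, Submodule.mem_span_insert] at hmem
  obtain ⟨α, u, hu, hpu⟩ := hmem
  have key : ∀ y, om v g p y = α * om v g q y := by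
    intro y
    unfold om
    rw [hpu, map_add, map_smul, detL_span _ u, add_zero, smul_eq_mul]
    refine Submodule.span_mono ?_ hu
    rintro _ ⟨s, rfl⟩
    exact ⟨s.succ, by simp⟩
  rw [key, key]; ring

theorem om_swap {n e : ℕ} (v : Fin n → Fin (e+2) → ℝ) (g : Fin e → Fin n) (x y : Fin n) :
    om v g x y = - om v g y x := by
  unfold om
  rw [← detL_cons, ← detL_cons]
  have h1 := Matrix.det_permute (Equiv.swap 0 1) (Matrix.of (fun p => v
    ((Fin.cons y (Fin.cons x g : Fin (e+1) → Fin n) : Fin (e+2) → Fin n) p)))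
  rw [Equiv.Perm.sign_swap (by simp)] at h1
  have : (Matrix.of (fun p => v
    ((Fin.cons y (Fin.cons x g : Fin (e+1) → Fin n) : Fin (e+2) → Fin n) p))).submatrix
      (Equiv.swap 0 1) id = (Matrix.of (fun p => v
    ((Fin.cons x (Fin.cons y g : Fin (e+1) → Fin n) : Fin (e+2) → Fin n) p))) := by
    ext i j
    refine Fin.cases ?_ (fun i => Fin.cases ?_ (fun i => ?_) i) i
    · simp
    · change v ((Fin.cons y (Fin.cons x g : Fin (e+1) → Fin n) : Fin (e+2) → Fin n) (Equiv.swap 0 1 1)) j = _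
      rw [Equiv.swap_apply_right]; rfl
    · change v ((Fin.cons y (Fin.cons x g : Fin (e+1) → Fin n) : Fin (e+2) → Fin n) (Equiv.swap 0 1 i.succ.succ)) j = _
      rw [Equiv.swap_apply_of_ne_of_ne]
      · rfl
      · exact Fin.succ_ne_zero _
      · intro h
        rw [← Fin.succ_zero_eq_one] at h
        exact Fin.succ_ne_zero _ (Fin.succ_injective _ h)
  rw [this] at h1
  rw [h1]; simp

theorem om_sign {n e : ℕ} (v : Fin n → Fin (e+2) → ℝ) (hv : TNN v) (g : Fin e → Fin n)
    (x y : Fin n) (hxy : x < y) :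
    0 ≤ om v g x y * ((∏ s, (((g s).val : ℝ) - x.val)) * (∏ s, (((g s).val : ℝ) - y.val)) *
        (Matrix.vandermonde (fun p => ((g p).val : ℝ))).det) := by
  have h := hv (Fin.cons x (Fin.cons y g : Fin (e+1) → Fin n))
  rw [sdet_cons, vand_cons, Fin.prod_univ_succ] at h
  have hp : (0:ℝ) < (y.val : ℝ) - x.val := by rw [sub_pos]; exact_mod_cast hxy
  simp only [Fin.cons_zero, Fin.cons_succ] at h
  change 0 ≤ om v g x y * _ at h
  refine nonneg_of_mul_nonneg_left (b := (y.val : ℝ) - x.val) ?_ hp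
  nlinarith [h]

theorem nc_of_tnn {n d : ℕ} (v : Fin n → Fin d → ℝ) (hr : vrk v univ = d) (hv : TNN v) :
    NCProp (vrk v) := by
  intro T a b c d' hab hbc hcd ha hb hc hd hT h1 h2 h3 h4
  rw [hr] at hT h1 h2 h3 h4 ⊢
  obtain ⟨e, rfl⟩ : ∃ e, d = e + 2 := ⟨T.card, hT.symm⟩
  have hTe : T.card = e := by omega
  let g : Fin e → Fin n := fun s => (T.orderIsoOfFin hTe s).1
  have hg : univ.image g = T := by
    ext x
    simp only [mem_image, mem_univ, true_and]
    constructor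
    · rintro ⟨s, rfl⟩; exact (T.orderIsoOfFin hTe s).2
    · intro hx; exact ⟨(T.orderIsoOfFin hTe).symm ⟨x, hx⟩, by
        change ((T.orderIsoOfFin hTe) ((T.orderIsoOfFin hTe).symm ⟨x, hx⟩)).1 = x
        rw [OrderIso.apply_symm_apply]⟩
  have hgi : StrictMono g := fun s t hst => (T.orderIsoOfFin hTe).strictMono hst
  have hV := vand_pos g hgi
  set V := (Matrix.vandermonde (fun p => ((g p).val : ℝ))).det
  rw [← hg, ← om_ne_zero_iff] at h1 h2 h3 h4 ⊢
  rw [← om_ne_zero_iff]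
  have hpne : ∀ x, x ∉ T → (∏ s, (((g s).val : ℝ) - x.val)) ≠ 0 := by
    intro x hx
    rw [prod_ne_zero_iff]
    intro s _ h0
    rw [sub_eq_zero] at h0
    have : g s = x := Fin.ext (by exact_mod_cast h0)
    exact hx (this ▸ (T.orderIsoOfFin hTe s).2)
  have sab := om_sign v hv g a b hab
  have sbc := om_sign v hv g b c hbc
  have scd := om_sign v hv g c d' hcd
  have sad := om_sign v hv g a d' (hab.trans (hbc.trans hcd))
  have pa := hpne a ha
  have pb := hpne b hb
  have pc := hpne c hc
  have pd := hpne d' hd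
  generalize (∏ s, (((g s).val : ℝ) - a.val)) = A at *
  generalize (∏ s, (((g s).val : ℝ) - b.val)) = B at *
  generalize (∏ s, (((g s).val : ℝ) - c.val)) = C at *
  generalize (∏ s, (((g s).val : ℝ) - d'.val)) = D at *
  have pos : ∀ w K : ℝ, w ≠ 0 → K ≠ 0 → 0 ≤ w * K → 0 < w * K := fun w K hw hK h =>
    lt_of_le_of_ne h (Ne.symm (mul_ne_zero hw hK))
  have q1 := pos _ _ h1 (mul_ne_zero (mul_ne_zero pa pb) hV.ne') sab
  have q2 := pos _ _ h2 (mul_ne_zero (mul_ne_zero pb pc) hV.ne') sbc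
  have q3 := pos _ _ h3 (mul_ne_zero (mul_ne_zero pc pd) hV.ne') scd
  have q4 := pos _ _ h4 (mul_ne_zero (mul_ne_zero pa pd) hV.ne') sad
  have r1 := mul_pos q1 q3
  have r2 := mul_pos q4 q2
  have fin : ∀ x y x' y' : ℝ, 0 < (x * (A * B * V)) * (y * (C * D * V)) →
      0 < (x' * (A * D * V)) * (y' * (B * C * V)) → x * y = - (x' * y') → False := by
    intro x y x' y' u1 u2 hh
    have e1 : (x * (A * B * V)) * (y * (C * D * V)) = (x * y) * (A*B*C*D*V*V) := by ring
    have e2 : (x' * (A * D * V)) * (y' * (B * C * V)) = (x' * y') * (A*B*C*D*V*V) := by ring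
    rw [e1, hh] at u1
    rw [e2] at u2
    linarith
  constructor
  · intro h0
    have := om_plucker v g a c b d' h0 ⟨b, h2⟩
    rw [om_swap v g c b] at this
    exact fin _ _ _ _ r1 r2 (by rw [this]; ring)
  · intro h0
    have := om_plucker v g b d' a c h0 ⟨c, h3⟩
    rw [om_swap v g b a, om_swap v g d' c, om_swap v g d' a] at this
    refine fin _ _ _ _ r1 r2 ?_
    linarith

def Good {n : ℕ} (f : Fin n → ℕ) : Prop :=
  (∀ k : Fin n, k.val ≤ f k ∧ f k ≤ k.val + n) ∧ ∀ i j : Fin n, f i % n = f j % n → i = j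

theorem good_sum {n : ℕ} (f : Fin n → ℕ) (hf : Good f) :
    ∑ k, f k = ∑ k : Fin n, k.val + n * (univ.filter (fun k => n ≤ f k)).card := by
  have h1 : ∀ k : Fin n, f k = f k % n + n * (if n ≤ f k then 1 else 0) := by
    intro k
    have := (hf.1 k).2
    have hk := k.2
    have h2 := Nat.mod_add_div (f k) n
    by_cases h : n ≤ f k
    · rw [if_pos h]
      rw [Nat.mod_eq_sub_mod h, Nat.mod_eq_of_lt (by omega)]; omega
    · rw [if_neg h, Nat.mod_eq_of_lt (by omega)]; omega
  rw [sum_congr rfl (fun k _ => h1 k), sum_add_distrib, ← mul_sum, card_filter]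
  congr 1
  have hb : Function.Bijective (fun k : Fin n => (⟨f k % n, Nat.mod_lt _ (by have := k.2; omega)⟩ : Fin n)) := by
    apply Finite.injective_iff_bijective.1
    intro i j hij
    exact hf.2 i j (congrArg Fin.val hij)
  exact Function.Bijective.sum_comp hb (fun k : Fin n => k.val)

def Pr {n d : ℕ} [NeZero n] (v : Fin n → Fin d → ℝ) (f : Fin n → ℕ) : Prop :=
  ∀ k : Fin n, v k ∈ Submodule.span ℝ (v '' (cyc n (k.val + 1) (f k + 1) : Set (Fin n)))

theorem ft_good {n : ℕ} [NeZero n] {r : Finset (Fin n) → ℕ} (h : RankFn r) :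
    Good (fun k : Fin n => ft r k.val) := by
  refine ⟨fun k => ⟨le_ft _, ft_le _⟩, fun i j hij => ?_⟩
  apply (ftPerm h).injective
  apply Fin.ext
  rw [ftPerm_val, ftPerm_val]
  exact hij

theorem exact_of_pr {n d : ℕ} [NeZero n] (v : Fin n → Fin d → ℝ) (f : Fin n → ℕ) (hf : Good f)
    (hd : (univ.filter (fun k => n ≤ f k)).card = d) (hr : vrk v univ = d) (hp : Pr v f)
    (k : Fin n) : ft (vrk v) k.val = f k := by
  have h := vrk_rankFn v
  have hle : ∀ k : Fin n, ft (vrk v) k.val ≤ f k := by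
    intro k
    rw [← Nat.lt_succ_iff, Nat.succ_eq_add_one, ft_lt_iff h (by have := (hf.1 k).1; omega),
      cyc_left (by have := (hf.1 k).1; omega)]
    have : Fin.ofNat n k.val = k := by apply Fin.ext; simp
    rw [this, vrk_insert_iff]
    exact hp k
  have hc : (univ.filter (fun k : Fin n => n ≤ ft (vrk v) k.val)).card = d := by
    have h1 := rank_cyc' h 0 n
    rw [cyc_univ (by omega), hr] at h1
    refine Eq.trans ?_ h1.symm
    apply card_bij (fun k _ => k.val)
    · intro a ha; simp at ha ⊢; exact ha
    · intro a _ b _ hab; exact Fin.ext hab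
    · intro b hb; simp at hb; exact ⟨⟨b, hb.1⟩, by simp [hb.2], rfl⟩
  have s1 := good_sum _ hf
  have s2 := good_sum _ (ft_good h)
  rw [hd] at s1
  rw [hc] at s2
  exact (sum_eq_sum_iff_of_le (fun k _ => hle k)).1 (by rw [s1, s2]) k (mem_univ _)

theorem vrk_le {n d : ℕ} (v : Fin n → Fin d → ℝ) (J : Finset (Fin n)) : vrk v J ≤ d := by
  have := Submodule.finrank_le (Submodule.span ℝ (v '' (J : Set (Fin n))))
  simpa [vrk] using this

theorem mem_cyc_self {n : ℕ} [NeZero n] (k : Fin n) (a b m : ℕ) (h1 : a ≤ m) (h2 : m < b)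
    (h3 : m % n = k.val) : k ∈ cyc n a b := mem_cyc.2 ⟨m, h1, h2, h3⟩

theorem base_case {n d : ℕ} [NeZero n] (f : Fin n → ℕ)
    (hfix : ∀ k : Fin n, f k = k.val ∨ f k = k.val + n)
    (hd : (univ.filter (fun k => n ≤ f k)).card = d) :
    ∃ v : Fin n → Fin d → ℝ, TNN v ∧ vrk v univ = d ∧ Pr v f := by
  classical
  set C := univ.filter (fun k => n ≤ f k) with hC
  let v : Fin n → Fin d → ℝ := fun k =>
    if h : k ∈ C then Pi.single ((C.orderIsoOfFin hd).symm ⟨k, h⟩) 1 else 0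
  have hv0 : ∀ k, k ∉ C → v k = 0 := fun k hk => by simp [v, hk]
  have hone : (Matrix.of (fun p => v (C.orderEmbOfFin hd p))) = 1 := by
    ext p q
    have hm : C.orderEmbOfFin hd p ∈ C := orderEmbOfFin_mem _ _ _
    have he : (C.orderIsoOfFin hd).symm ⟨C.orderEmbOfFin hd p, hm⟩ = p := by
      rw [OrderIso.symm_apply_eq]
      apply Subtype.ext
      simp
    simp only [Matrix.of_apply, v, dif_pos hm, he, Matrix.one_apply, Pi.single_apply]
    simp [eq_comm]
  refine ⟨v, ?_, ?_, ?_⟩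
  · rw [tnn_iff]
    intro g hg
    by_cases hall : ∀ p, g p ∈ C
    · have := orderEmbOfFin_unique hd hall hg
      subst this
      rw [hone]; simp
    · push Not at hall
      obtain ⟨p, hp⟩ := hall
      rw [Matrix.det_eq_zero_of_row_eq_zero p]
      intro q
      simp [hv0 _ hp]
  · apply le_antisymm (vrk_le _ _)
    have h1 : vrk v (univ.image (C.orderEmbOfFin hd)) = d := by
      rw [← det_ne_zero_iff_vrk, hone]; simp
    exact h1.symm.le.trans ((vrk_rankFn v).mono _ _ (subset_univ _))
  · intro k
    rcases hfix k with h | h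
    · rw [hv0 k]
      · exact Submodule.zero_mem _
      · rw [hC, mem_filter]; have := k.2; intro h; omega
    · rw [cyc_univ (by omega)]
      exact Submodule.subset_span ⟨k, by simp, rfl⟩

/-- loop or coloop of a vector configuration -/
def Triv {n d : ℕ} (v : Fin n → Fin d → ℝ) (x : Fin n) : Prop :=
  v x = 0 ∨ v x ∉ Submodule.span ℝ (v '' (({x}ᶜ : Finset (Fin n)) : Set (Fin n)))

theorem drop_one {n d : ℕ} (v : Fin n → Fin d → ℝ) (x i : Fin n) (hx : Triv v x) (hi : i ≠ x)
    (J : Finset (Fin n)) (h : v i ∈ Submodule.span ℝ (v '' (J : Set (Fin n)))) :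
    v i ∈ Submodule.span ℝ (v '' ((J.erase x : Finset (Fin n)) : Set (Fin n))) := by
  have h2 : v i ∈ Submodule.span ℝ (insert (v x) (v '' ((J.erase x : Finset (Fin n)) : Set (Fin n)))) := by
    refine Submodule.span_mono ?_ h
    rintro _ ⟨y, hy, rfl⟩
    by_cases hyx : y = x
    · left; rw [hyx]
    · right; exact ⟨y, by simpa [hyx] using hy, rfl⟩
  rw [Submodule.mem_span_insert] at h2
  obtain ⟨a, z, hz, he⟩ := h2
  rcases hx with h0 | hne
  · rw [he, h0, smul_zero, zero_add]; exact hz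
  · by_cases ha : a = 0
    · rw [he, ha, zero_smul, zero_add]; exact hz
    · exfalso
      apply hne
      have hz' : z ∈ Submodule.span ℝ (v '' (({x}ᶜ : Finset (Fin n)) : Set (Fin n))) := by
        refine Submodule.span_mono ?_ hz
        apply Set.image_mono
        intro y hy
        have : y ∈ J ∧ y ≠ x := by simpa using hy
        simp [this.2]
      have hi' : v i ∈ Submodule.span ℝ (v '' (({x}ᶜ : Finset (Fin n)) : Set (Fin n))) :=
        Submodule.subset_span ⟨i, by simp [hi], rfl⟩
      have : v x = a⁻¹ • (v i - z) := by
        rw [he, add_sub_cancel_right, smul_smul, inv_mul_cancel₀ ha, one_smul]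
      rw [this]
      exact Submodule.smul_mem _ _ (Submodule.sub_mem _ hi' hz')

theorem drop_many {n d : ℕ} (v : Fin n → Fin d → ℝ) (i : Fin n) (F : Finset (Fin n))
    (hF : ∀ x ∈ F, Triv v x ∧ i ≠ x)
    (J : Finset (Fin n)) (h : v i ∈ Submodule.span ℝ (v '' (J : Set (Fin n)))) :
    v i ∈ Submodule.span ℝ (v '' ((J \ F : Finset (Fin n)) : Set (Fin n))) := by
  induction F using Finset.induction_on with
  | empty => simpa using h
  | insert a F ha ih =>
    have h1 := ih (fun x hx => hF x (mem_insert_of_mem hx))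
    have h2 := drop_one v a i (hF a (mem_insert_self _ _)).1 (hF a (mem_insert_self _ _)).2 _ h1
    have : J \ insert a F = (J \ F).erase a := by
      ext y; simp; tauto
    rw [this]; exact h2

/-- bridge addition -/
def bridge {n d : ℕ} (v : Fin n → Fin d → ℝ) (i j : Fin n) (ε : ℝ) : Fin n → Fin d → ℝ :=
  Function.update v j (v j + ε • v i)

theorem bridge_ne {n d : ℕ} (v : Fin n → Fin d → ℝ) (i j : Fin n) (ε : ℝ) (k : Fin n)
    (h : k ≠ j) : bridge v i j ε k = v k := Function.update_of_ne h _ _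

theorem bridge_self {n d : ℕ} (v : Fin n → Fin d → ℝ) (i j : Fin n) (ε : ℝ) :
    bridge v i j ε j = v j + ε • v i := Function.update_self _ _ _

theorem bridge_span {n d : ℕ} (v : Fin n → Fin d → ℝ) (i j : Fin n) (hij : i ≠ j) (ε : ℝ)
    (J : Finset (Fin n)) (hJ : j ∈ J → i ∈ J) :
    Submodule.span ℝ (v '' (J : Set (Fin n))) ≤
      Submodule.span ℝ (bridge v i j ε '' (J : Set (Fin n))) := by
  rw [Submodule.span_le]
  rintro _ ⟨y, hy, rfl⟩
  have hmem : ∀ z ∈ J, bridge v i j ε z ∈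
      Submodule.span ℝ (bridge v i j ε '' (J : Set (Fin n))) :=
    fun z hz => Submodule.subset_span ⟨z, hz, rfl⟩
  by_cases h : y = j
  · subst h
    have h1 := hmem y hy
    have h2 := hmem i (hJ hy)
    rw [bridge_self] at h1
    rw [bridge_ne _ _ _ _ _ hij] at h2
    have : v y = (v y + ε • v i) - ε • v i := by simp
    rw [this]
    exact Submodule.sub_mem _ h1 (Submodule.smul_mem _ _ h2)
  · have := hmem y hy
    rwa [bridge_ne _ _ _ _ _ h] at this

theorem bridge_vrk {n d : ℕ} (v : Fin n → Fin d → ℝ) (i j : Fin n) (hij : i ≠ j) (ε : ℝ)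
    (h : vrk v univ = d) : vrk (bridge v i j ε) univ = d := by
  apply le_antisymm (vrk_le _ _)
  refine h.symm.le.trans ?_
  exact Submodule.finrank_mono (bridge_span v i j hij ε univ (fun _ => mem_univ _))

theorem coloop_mem {n d : ℕ} (v : Fin n → Fin d → ℝ) (hr : vrk v univ = d) (x : Fin n)
    (hx : v x ∉ Submodule.span ℝ (v '' (({x}ᶜ : Finset (Fin n)) : Set (Fin n))))
    (J : Finset (Fin n)) (hJ : vrk v J = d) : x ∈ J := by
  by_contra hne
  apply hx
  rw [← vrk_insert_iff]
  have h1 := (vrk_rankFn v).mono J {x}ᶜ (by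
    intro y hy; simp; rintro rfl; exact hne hy)
  have h2 := vrk_le v {x}ᶜ
  have h3 := vrk_le v (insert x {x}ᶜ)
  have h4 := (vrk_rankFn v).mono {x}ᶜ (insert x {x}ᶜ) (subset_insert _ _)
  omega

theorem bridge_tnn_aux {n e : ℕ} (v : Fin n → Fin (e+1) → ℝ) (hv : TNN v) (hr : vrk v univ = e+1)
    (i j : Fin n) (hij : i < j) (ht : ∀ x, i < x → x < j → Triv v x)
    (Cb : Finset (Fin n)) (hCb : ∀ x, x ∈ Cb ↔ i < x ∧ x < j ∧ v x ≠ 0) (S : Fin e → Fin n) :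
    0 ≤ sdet (bridge v i j (∏ x ∈ Cb, ((x.val : ℝ) - j.val) * ((x.val : ℝ) - i.val)))
      (Fin.cons j S) := by
  set ε := ∏ x ∈ Cb, ((x.val : ℝ) - j.val) * ((x.val : ℝ) - i.val) with hε
  rw [sdet_cons]
  by_cases hS : ∃ s, S s = j
  · obtain ⟨s, hs⟩ := hS
    have : ∏ s, (((S s).val : ℝ) - j.val) = 0 := prod_eq_zero (mem_univ s) (by rw [hs, sub_self])
    rw [this]; simp
  push Not at hS
  have hR : (fun s => bridge v i j ε (S s)) = fun s => v (S s) := by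
    funext s; exact bridge_ne _ _ _ _ _ (hS s)
  rw [hR, bridge_self, map_add, map_smul, smul_eq_mul, add_mul]
  have h1 := hv (Fin.cons j S)
  have h2 := hv (Fin.cons i S)
  rw [sdet_cons] at h1 h2
  apply add_nonneg h1
  by_cases h0 : detL (fun s => v (S s)) (v i) = 0
  · rw [h0]; simp
  have hfull : vrk v (univ.image (Fin.cons i S : Fin (e+1) → Fin n)) = e + 1 := by
    rw [← det_ne_zero_iff_vrk, detL_cons]; exact h0
  have hinj : Function.Injective (Fin.cons i S : Fin (e+1) → Fin n) := by
    have a1 := (vrk_rankFn v).le_card (univ.image (Fin.cons i S : Fin (e+1) → Fin n))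
    have a2 := card_image_le (s := univ) (f := (Fin.cons i S : Fin (e+1) → Fin n))
    rw [card_univ, Fintype.card_fin] at a2
    rw [← Set.injOn_univ, ← coe_univ, ← card_image_iff, card_univ, Fintype.card_fin]
    omega
  rw [Fin.cons_injective_iff] at hinj
  obtain ⟨hiS, hSinj⟩ := hinj
  have hnz : ∀ s, v (S s) ≠ 0 := by
    intro s hs
    apply h0
    apply Matrix.det_eq_zero_of_row_eq_zero s.succ
    intro q
    change v (S s) q = 0
    rw [hs]; rfl
  have hsub : Cb ⊆ univ.image S := by
    intro x hx
    obtain ⟨x1, x2, x3⟩ := (hCb x).1 hx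
    have hcol := (ht x x1 x2).resolve_left x3
    have := coloop_mem v hr x hcol _ hfull
    simp only [mem_image, mem_univ, true_and, Fin.exists_fin_succ, Fin.cons_zero,
      Fin.cons_succ] at this ⊢
    rcases this with h | h
    · exact absurd h x1.ne
    · exact h
  set q : Fin n → ℝ := fun x => ((x.val : ℝ) - j.val) * ((x.val : ℝ) - i.val) with hq
  have hprod : (∏ s, (((S s).val : ℝ) - j.val)) * (∏ s, (((S s).val : ℝ) - i.val)) =
      (∏ x ∈ univ.image S \ Cb, q x) * ε := by
    rw [← prod_mul_distrib, hε, prod_sdiff hsub, prod_image (fun a _ b _ h => hSinj h)]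
  have hpos : 0 ≤ ∏ x ∈ univ.image S \ Cb, q x := by
    apply prod_nonneg
    intro x hx
    rw [mem_sdiff, hCb] at hx
    obtain ⟨hx1, hx2⟩ := hx
    obtain ⟨s, -, rfl⟩ := mem_image.1 hx1
    have : S s < i ∨ j < S s := by
      by_contra hcon
      push Not at hcon
      have hne : S s ≠ i := fun h => hiS ⟨s, h⟩
      exact hx2 ⟨lt_of_le_of_ne hcon.1 (Ne.symm hne), lt_of_le_of_ne hcon.2 (hS s), hnz s⟩
    have hij' : (i.val : ℝ) < j.val := by exact_mod_cast hij
    rcases this with h | h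
    · have : ((S s).val : ℝ) < i.val := by exact_mod_cast h
      apply mul_nonneg_of_nonpos_of_nonpos <;> linarith
    · have : (j.val : ℝ) < (S s).val := by exact_mod_cast h
      apply mul_nonneg <;> linarith
  have hi0 : ∏ s, (((S s).val : ℝ) - i.val) ≠ 0 := by
    rw [prod_ne_zero_iff]
    intro s _ h
    rw [sub_eq_zero] at h
    exact hiS ⟨s, Fin.ext (by exact_mod_cast h)⟩
  generalize ∏ s, (((S s).val : ℝ) - i.val) = Hi at *
  generalize ∏ s, (((S s).val : ℝ) - j.val) = Hj at *
  generalize (Matrix.vandermonde (fun p => ((S p).val : ℝ))).det = V at *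
  generalize detL (fun s => v (S s)) (v i) = D at *
  generalize ∏ x ∈ univ.image S \ Cb, q x = Q at *
  have hsq : 0 < Hi * Hi := mul_self_pos.2 hi0
  refine nonneg_of_mul_nonneg_left ?_ hsq
  have e1 : ε * D * (Hj * V) * (Hi * Hi) = (D * (Hi * V)) * (Q * (ε * ε)) := by
    have : ε * D * (Hj * V) * (Hi * Hi) = (D * (Hi * V)) * (ε * (Hj * Hi)) := by ring
    rw [this, hprod]; ring
  rw [e1]
  exact mul_nonneg h2 (mul_nonneg hpos (mul_self_nonneg ε))

theorem bridge_tnn {n d : ℕ} (v : Fin n → Fin d → ℝ) (hv : TNN v) (hr : vrk v univ = d)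
    (i j : Fin n) (hij : i < j) (ht : ∀ x, i < x → x < j → Triv v x) :
    ∃ ε : ℝ, ε ≠ 0 ∧ TNN (bridge v i j ε) := by
  classical
  set Cb := univ.filter (fun x => i < x ∧ x < j ∧ v x ≠ 0) with hC
  refine ⟨∏ x ∈ Cb, ((x.val : ℝ) - j.val) * ((x.val : ℝ) - i.val), ?_, ?_⟩
  · rw [prod_ne_zero_iff]
    intro x hx
    rw [hC, mem_filter] at hx
    apply mul_ne_zero <;> rw [sub_ne_zero] <;> intro h
    · exact hx.2.2.1.ne (Fin.ext (by exact_mod_cast h))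
    · exact hx.2.1.ne' (Fin.ext (by exact_mod_cast h))
  · intro g
    by_cases hg : ∃ p, g p = j
    · obtain ⟨p, hp⟩ := hg
      cases d with
      | zero => exact p.elim0
      | succ e =>
        rw [← sdet_perm _ g (Equiv.swap 0 p)]
        have : g ∘ (Equiv.swap 0 p) = Fin.cons j (fun s => g (Equiv.swap 0 p (Fin.succ s))) := by
          funext t
          refine Fin.cases ?_ (fun s => ?_) t
          · simp [hp]
          · simp
        rw [this]
        exact bridge_tnn_aux v hv hr i j hij ht Cb (fun x => by simp [hC]) _
    · push Not at hg
      have : sdet (bridge v i j (∏ x ∈ Cb, ((x.val : ℝ) - j.val) * ((x.val : ℝ) - i.val))) g =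
          sdet v g := by
        unfold sdet
        congr 3
        funext p
        exact bridge_ne _ _ _ _ _ (hg p)
      rw [this]
      exact hv g

def IsFixd {n : ℕ} (f : Fin n → ℕ) (k : Fin n) : Prop := f k = k.val ∨ f k = k.val + n

/-- the residue of a nonfixed value is nonfixed -/
theorem res_nonfix {n : ℕ} (f : Fin n → ℕ) (hf : Good f) (i m : Fin n) (hi : ¬ IsFixd f i)
    (h : f i = m.val ∨ f i = m.val + n) : ¬ IsFixd f m := by
  intro hm
  have e1 : f i % n = m.val := by
    rcases h with h | h <;> rw [h] <;> simp [Nat.mod_eq_of_lt m.2]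
  have e2 : f m % n = m.val := by
    rcases hm with h | h <;> rw [h] <;> simp [Nat.mod_eq_of_lt m.2]
  have := hf.2 i m (by omega)
  subst this
  exact hi h

theorem exists_pair {n : ℕ} (f : Fin n → ℕ) (hf : Good f) (hne : ∃ k, ¬ IsFixd f k) :
    ∃ i j : Fin n, i < j ∧ ¬ IsFixd f i ∧ ¬ IsFixd f j ∧ f i < f j ∧ ∀ k, i < k → k < j → IsFixd f k := by
  classical
  have hpair : ∃ i j : Fin n, i < j ∧ ¬ IsFixd f i ∧ ¬ IsFixd f j ∧ f i < f j := by
    set N := univ.filter (fun k => ¬ IsFixd f k) with hN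
    have hNne : N.Nonempty := by
      obtain ⟨k, hk⟩ := hne
      exact ⟨k, by simp [hN, hk]⟩
    obtain ⟨i, hi, himin⟩ := exists_min_image N id hNne
    obtain ⟨j, hj, hjmax⟩ := exists_max_image N id hNne
    have hi' : ¬ IsFixd f i := by simpa [hN] using hi
    have hj' : ¬ IsFixd f j := by simpa [hN] using hj
    have bi := hf.1 i
    have bj := hf.1 j
    have ii := i.2
    have jj := j.2
    have hi1 : f i < n := by
      by_contra hcon
      have h1 : f i ≠ i.val + n := fun h => hi' (Or.inr h)
      have := res_nonfix f hf i ⟨f i - n, by omega⟩ hi' (Or.inr (by simp; omega))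
      have := himin _ (by simp [hN]; exact this)
      have := Fin.le_def.1 this
      simp at this
      omega
    have hj1 : n ≤ f j := by
      by_contra hcon
      have h1 : f j ≠ j.val := fun h => hj' (Or.inl h)
      have := res_nonfix f hf j ⟨f j, by omega⟩ hj' (Or.inl rfl)
      have := hjmax _ (by simp [hN]; exact this)
      have := Fin.le_def.1 this
      simp at this
      omega
    have hle : i ≤ j := himin j hj
    refine ⟨i, j, lt_of_le_of_ne hle ?_, hi', hj', by omega⟩
    rintro rfl
    omega
  obtain ⟨i0, j0, h0⟩ := hpair
  obtain ⟨⟨i, j⟩, hm, hmin⟩ := exists_min_image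
    ((univ : Finset (Fin n × Fin n)).filter (fun p => p.1 < p.2 ∧ ¬ IsFixd f p.1 ∧ ¬ IsFixd f p.2 ∧
      f p.1 < f p.2)) (fun p => p.2.val - p.1.val) ⟨(i0, j0), by simpa using h0⟩
  have hm' : i < j ∧ ¬ IsFixd f i ∧ ¬ IsFixd f j ∧ f i < f j := by simpa using hm
  obtain ⟨a1, a2, a3, a4⟩ := hm'
  refine ⟨i, j, a1, a2, a3, a4, ?_⟩
  intro k hik hkj
  by_contra hk
  have l1 := Fin.lt_def.1 hik
  have l2 := Fin.lt_def.1 hkj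
  by_cases hc : f i < f k
  · have := hmin (i, k) (by simp; exact ⟨hik, a2, hk, hc⟩)
    simp at this
    omega
  · have := hmin (k, j) (by simp; exact ⟨hkj, hk, a3, by omega⟩)
    simp at this
    omega

theorem step {n d : ℕ} [NeZero n] (f : Fin n → ℕ) (hf : Good f)
    (hd : (univ.filter (fun k => n ≤ f k)).card = d) (i j : Fin n) (hij : i < j)
    (hi : ¬ IsFixd f i) (hj : ¬ IsFixd f j) (hlt : f i < f j)
    (hbet : ∀ k, i < k → k < j → IsFixd f k)
    (ih : Good (f ∘ Equiv.swap i j) → (univ.filter (fun k => n ≤ (f ∘ Equiv.swap i j) k)).card = d →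
      ∃ v : Fin n → Fin d → ℝ, TNN v ∧ vrk v univ = d ∧ Pr v (f ∘ Equiv.swap i j)) :
    ∃ v : Fin n → Fin d → ℝ, TNN v ∧ vrk v univ = d ∧ Pr v f := by
  classical
  have lij := Fin.lt_def.1 hij
  have bi := hf.1 i
  have bj := hf.1 j
  have ii := i.2
  have jj := j.2
  have hi1 : f i ≠ i.val := fun h => hi (Or.inl h)
  have hi2 : f i ≠ i.val + n := fun h => hi (Or.inr h)
  have hj1 : f j ≠ j.val := fun h => hj (Or.inl h)
  have hj2 : f j ≠ j.val + n := fun h => hj (Or.inr h)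
  have hji : j.val ≤ f i := by
    by_contra hcon
    refine res_nonfix f hf i ⟨f i, by omega⟩ hi (Or.inl rfl) (hbet _ ?_ ?_) <;>
      rw [Fin.lt_def] <;> simp <;> omega
  have hjn : f j ≤ i.val + n := by
    by_contra hcon
    refine res_nonfix f hf j ⟨f j - n, by omega⟩ hj (Or.inr (by simp; omega)) (hbet _ ?_ ?_) <;>
      rw [Fin.lt_def] <;> simp <;> omega
  set f' := f ∘ Equiv.swap i j with hf'
  have f'i : f' i = f j := by simp [hf']
  have f'j : f' j = f i := by simp [hf']
  have f'k : ∀ k, k ≠ i → k ≠ j → f' k = f k := fun k h1 h2 => by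
    simp [hf', Equiv.swap_apply_of_ne_of_ne h1 h2]
  have hg' : Good f' := by
    constructor
    · intro k
      by_cases h1 : k = i
      · subst h1; rw [f'i]; omega
      · by_cases h2 : k = j
        · subst h2; rw [f'j]; omega
        · rw [f'k k h1 h2]; exact hf.1 k
    · intro a b hab
      exact (Equiv.swap i j).injective (hf.2 _ _ hab)
  have hd' : (univ.filter (fun k => n ≤ f' k)).card = d := by
    rw [← hd, card_filter, card_filter]
    exact Equiv.sum_comp (Equiv.swap i j) (fun k => if n ≤ f k then 1 else 0)
  obtain ⟨v, hv, hr, hp⟩ := ih hg' hd'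
  have hex := exact_of_pr v f' hg' hd' hr hp
  have htriv : ∀ x, i < x → x < j → Triv v x := by
    intro x h1 h2
    have hx := hbet x h1 h2
    unfold IsFixd at hx
    rw [← f'k x h1.ne' h2.ne] at hx
    rcases hx with hx | hx
    · left
      have := hp x
      rw [hx, cyc_empty le_rfl] at this
      simpa using this
    · right
      rw [← vrk_insert_iff]
      intro heq
      have hc := cyc_Icc_compl (le_refl x)
      rw [Icc_self] at hc
      have hxn := x.2
      have := (ft_lt_iff (vrk_rankFn v) (i := x.val) (b := x.val + n) (by omega)).2 (by
        rw [cyc_left (by omega), hc]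
        have : Fin.ofNat n x.val = x := by apply Fin.ext; simp
        rw [this]; exact heq)
      rw [hex x] at this
      omega
  obtain ⟨ε, hε, htnn⟩ := bridge_tnn v hv hr i j hij htriv
  refine ⟨bridge v i j ε, htnn, bridge_vrk v i j hij.ne ε hr, ?_⟩
  have notin : ∀ b, b ≤ j.val + n → j ∉ cyc n (j.val + 1) b := by
    intro b hb hm
    obtain ⟨m, m1, m2, m3⟩ := mem_cyc.1 hm
    rcases mod_cases (n := n) (m := m) (by omega) with h | h <;> omega
  have hvj0 : v j ∈ Submodule.span ℝ (v '' (cyc n (j.val + 1) (f i + 1) : Set (Fin n))) := by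
    have := hp j
    rwa [f'j] at this
  have hvj : v j ∈ Submodule.span ℝ (bridge v i j ε '' (cyc n (j.val + 1) (f i + 1) : Set (Fin n))) :=
    bridge_span v i j hij.ne ε _ (fun h => absurd h (notin _ (by omega))) hvj0
  intro k
  by_cases hkn : f k = k.val + n
  · rw [cyc_univ (by omega)]
    exact Submodule.subset_span ⟨k, by simp, rfl⟩
  by_cases hki : k = i
  · subst hki
    rw [bridge_ne _ _ _ _ _ hij.ne]
    have h1 : v j ∈ Submodule.span ℝ
        (bridge v k j ε '' (cyc n (k.val + 1) (f k + 1) : Set (Fin n))) := by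
      refine Submodule.span_mono (Set.image_mono ?_) hvj
      exact_mod_cast cyc_mono (by omega) le_rfl
    have h2 : v j + ε • v k ∈ Submodule.span ℝ
        (bridge v k j ε '' (cyc n (k.val + 1) (f k + 1) : Set (Fin n))) := by
      rw [← bridge_self]
      refine Submodule.subset_span ⟨j, ?_, rfl⟩
      exact_mod_cast mem_cyc_self j _ _ j.val (by omega) (by omega) (Nat.mod_eq_of_lt jj)
    have : v k = ε⁻¹ • ((v j + ε • v k) - v j) := by
      rw [add_sub_cancel_left, smul_smul, inv_mul_cancel₀ hε, one_smul]
    rw [this]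
    exact Submodule.smul_mem _ _ (Submodule.sub_mem _ h2 h1)
  by_cases hkj : k = j
  · subst hkj
    rw [bridge_self]
    have hmono : (v '' (cyc n (k.val + 1) (f i + 1) : Set (Fin n))) ⊆
        (v '' (cyc n (k.val + 1) (f k + 1) : Set (Fin n))) :=
      Set.image_mono (by exact_mod_cast cyc_mono le_rfl (by omega))
    have hmono' : (bridge v i k ε '' (cyc n (k.val + 1) (f i + 1) : Set (Fin n))) ⊆
        (bridge v i k ε '' (cyc n (k.val + 1) (f k + 1) : Set (Fin n))) :=
      Set.image_mono (by exact_mod_cast cyc_mono le_rfl (by omega))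
    refine Submodule.add_mem _ (Submodule.span_mono hmono' hvj) (Submodule.smul_mem _ _ ?_)
    by_cases hin : f k = i.val + n
    · rw [← bridge_ne v i k ε i hij.ne]
      refine Submodule.subset_span ⟨i, ?_, rfl⟩
      exact_mod_cast mem_cyc_self i _ _ (i.val + n) (by omega) (by omega)
        (by simp [Nat.mod_eq_of_lt ii])
    · apply bridge_span v i k hij.ne ε _ (fun h => absurd h (notin _ (by omega)))
      have h1 := hp i
      rw [f'i] at h1
      have h2 := drop_many v i (univ.filter (fun x => i < x ∧ x < k))
        (fun x hx => by
          have hx' : i < x ∧ x < k := by simpa using hx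
          exact ⟨htriv x hx'.1 hx'.2, hx'.1.ne⟩) _ h1
      have h3 : v i ∈ Submodule.span ℝ
          (insert (v k) (v '' (cyc n (k.val + 1) (f k + 1) : Set (Fin n)))) := by
        refine Submodule.span_mono ?_ h2
        rintro _ ⟨x, hx, rfl⟩
        have hx' := mem_sdiff.1 (mem_coe.1 hx)
        obtain ⟨m, m1, m2, m3⟩ := mem_cyc.1 hx'.1
        have hx2 : ¬ (i < x ∧ x < k) := by simpa using hx'.2
        rw [Fin.lt_def, Fin.lt_def] at hx2
        by_cases hxk : x = k
        · left; rw [hxk]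
        · right
          refine ⟨x, ?_, rfl⟩
          have hxk' : x.val ≠ k.val := fun h => hxk (Fin.ext h)
          have hxn := x.2
          refine mem_coe.2 (mem_cyc.2 ⟨m, ?_, m2, m3⟩)
          rcases mod_cases (n := n) (m := m) (by omega) with h | h <;> omega
      rwa [Submodule.span_insert_eq_span (Submodule.span_mono hmono hvj0)] at h3
  · rw [bridge_ne _ _ _ _ _ hkj]
    have h1 := hp k
    rw [f'k k hki hkj] at h1
    refine bridge_span v i j hij.ne ε _ ?_ h1
    intro hm
    obtain ⟨m, m1, m2, m3⟩ := mem_cyc.1 hm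
    have bk := hf.1 k
    have kk := k.2
    have hki' : k.val ≠ i.val := fun h => hki (Fin.ext h)
    have hkj' : k.val ≠ j.val := fun h => hkj (Fin.ext h)
    have hnb : ¬ (i.val < k.val ∧ k.val < j.val) := by
      rintro ⟨u1, u2⟩
      rcases hbet k u1 u2 with h | h <;> omega
    rcases mod_cases (n := n) (m := m) (by omega) with h | h
    · exact mem_cyc_self i _ _ i.val (by omega) (by omega) (Nat.mod_eq_of_lt ii)
    · exact mem_cyc_self i _ _ (i.val + n) (by omega) (by omega) (by simp [Nat.mod_eq_of_lt ii])

theorem realize {n : ℕ} [NeZero n] (d : ℕ) : ∀ (N : ℕ) (f : Fin n → ℕ), ∑ k, k.val * f k = N →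
    Good f → (univ.filter (fun k => n ≤ f k)).card = d →
    ∃ v : Fin n → Fin d → ℝ, TNN v ∧ vrk v univ = d ∧ Pr v f := by
  intro N
  induction N using Nat.strong_induction_on with
  | _ N ih =>
    intro f hN hf hd
    by_cases hfix : ∀ k, IsFixd f k
    · exact base_case f hfix hd
    · push Not at hfix
      obtain ⟨i, j, hij, hi, hj, hlt, hbet⟩ := exists_pair f hf hfix
      refine step f hf hd i j hij hi hj hlt hbet (fun hg hd' => ih _ ?_ _ rfl hg hd')
      rw [← hN]
      have hsplit : ∀ F : Fin n → ℕ, ∑ k, F k = F i + F j + ∑ k ∈ (univ.erase i).erase j, F k := by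
        intro F
        rw [← add_sum_erase univ F (mem_univ i),
          ← add_sum_erase (univ.erase i) F (mem_erase.2 ⟨hij.ne', mem_univ j⟩), add_assoc]
      rw [hsplit, hsplit (fun k => k.val * f k)]
      have : ∑ k ∈ (univ.erase i).erase j, k.val * (f ∘ Equiv.swap i j) k =
          ∑ k ∈ (univ.erase i).erase j, k.val * f k := by
        apply sum_congr rfl
        intro k hk
        simp only [mem_erase, mem_univ, and_true] at hk
        simp [Equiv.swap_apply_of_ne_of_ne hk.2 hk.1]
      rw [this]
      simp only [Function.comp, Equiv.swap_apply_left, Equiv.swap_apply_right]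
      have lij := Fin.lt_def.1 hij
      nlinarith [mul_pos (Nat.sub_pos_of_lt lij) (Nat.sub_pos_of_lt hlt), Nat.sub_add_cancel lij.le,
        Nat.sub_add_cancel hlt.le]

theorem positroid_data {n : ℕ} (ℬ : Finset (Finset (Fin n)))
    (h : IsPositroid (fun B => B ∈ ℬ)) :
    RankFn (brk ℬ) ∧ NCProp (brk ℬ) ∧
      ∀ B, B ∈ ℬ ↔ B.card = brk ℬ univ ∧ brk ℬ B = brk ℬ univ := by
  obtain ⟨d, A, hA, hrep⟩ := h
  let v : Fin n → Fin d → ℝ := fun j i => A i j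
  have hAv : A = Matrix.of (fun i j => v j i) := rfl
  rw [hAv] at hA hrep
  obtain ⟨hr, ht⟩ := (totallyNonneg_iff v).1 hA
  have hB := (bases_iff v hr ℬ).1 hrep
  have e := brk_eq (vrk_rankFn v) ℬ hB
  rw [e]
  exact ⟨vrk_rankFn v, nc_of_tnn v hr ht, hB⟩

theorem bases_subset {n : ℕ} [NeZero n] {r r' : Finset (Fin n) → ℕ} (h : RankFn r)
    (h' : RankFn r') (hnc' : NCProp r')
    (heq : ∀ a b, r (cyc n a b) = r' (cyc n a b)) (B : Finset (Fin n))
    (hB : B.card = r univ ∧ r B = r univ) : B.card = r' univ ∧ r' B = r' univ := by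
  have hu : r univ = r' univ := by
    have := heq 0 n
    rwa [cyc_univ (by omega)] at this
  have hle : ∀ J, (B ∩ J).card ≤ r J := by
    intro J
    have h1 := h.indep_subset (inter_subset_left (s₁ := B) (s₂ := J)) (by omega)
    have h2 := h.mono _ _ (inter_subset_right (s₁ := B) (s₂ := J))
    omega
  refine ⟨by omega, oh h' hnc' B (by omega) ?_ ?_⟩
  · intro a b _
    rw [← cyc_Icc, ← heq]
    exact hle _
  · intro a b hab
    rw [← cyc_Icc_compl hab, ← heq]
    exact hle _

theorem surj_aux {n : ℕ} [NeZero n] (π : Equiv.Perm (Fin n)) (hπ : IsSIF π) :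
    ∃ (ℬ : Finset (Finset (Fin n))) (h : RankFn (brk ℬ)), IsPositroid (fun B => B ∈ ℬ) ∧
      MatroidConnected (fun B => B ∈ ℬ) ∧ ftPerm h = π := by
  classical
  let f : Fin n → ℕ := fun k => if k.val < (π k).val then (π k).val else (π k).val + n
  have hmod : ∀ k, f k % n = (π k).val := by
    intro k
    simp only [f]
    split_ifs <;> simp [Nat.mod_eq_of_lt (π k).2]
  have hf : Good f := by
    constructor
    · intro k
      have h1 := k.2
      have h2 := (π k).2
      simp only [f]
      split_ifs <;> omega
    · intro i j hij
      rw [hmod, hmod] at hij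
      exact π.injective (Fin.ext hij)
  obtain ⟨d, hd⟩ : ∃ d, (univ.filter (fun k => n ≤ f k)).card = d := ⟨_, rfl⟩
  obtain ⟨v, hv, hr, hp⟩ := realize d _ f rfl hf hd
  let ℬ : Finset (Finset (Fin n)) :=
    univ.filter (fun B => B.card = vrk v univ ∧ vrk v B = vrk v univ)
  have hB : ∀ B, B ∈ ℬ ↔ B.card = vrk v univ ∧ vrk v B = vrk v univ := by
    intro B; simp [ℬ]
  have e := brk_eq (vrk_rankFn v) ℬ hB
  have hpos : IsPositroid (fun B => B ∈ ℬ) :=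
    ⟨d, Matrix.of (fun i j => v j i), (totallyNonneg_iff v).2 ⟨hr, hv⟩, (bases_iff v hr ℬ).2 hB⟩
  obtain ⟨h, hnc, hB'⟩ := positroid_data ℬ hpos
  have hperm : ftPerm h = π := by
    apply Equiv.ext
    intro k
    apply Fin.ext
    rw [ftPerm_val, e, exact_of_pr v f hf hd hr hp, hmod]
  exact ⟨ℬ, h, hpos, (noSep_iff h ℬ hB').2 (noSep_of_sif h hnc (hperm ▸ hπ)), hperm⟩

/-- For every `n ≥ 2`, the number of connected positroids on
`[n]` (counted as collections of bases) equals the number of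
stabilized-interval-free permutations of `[n]`. -/
theorem card_connected_positroids_eq_card_SIF (n : ℕ) (hn : 2 ≤ n) :
    Nat.card {ℬ : Finset (Finset (Fin n)) //
        IsPositroid (fun B => B ∈ ℬ) ∧ MatroidConnected (fun B => B ∈ ℬ)} =
      Nat.card {π : Equiv.Perm (Fin n) // IsSIF π} := by
  haveI : NeZero n := ⟨by omega⟩
  let Φ : {ℬ : Finset (Finset (Fin n)) //
        IsPositroid (fun B => B ∈ ℬ) ∧ MatroidConnected (fun B => B ∈ ℬ)} →
      {π : Equiv.Perm (Fin n) // IsSIF π} := fun X =>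
    ⟨ftPerm (positroid_data X.1 X.2.1).1, sif_of_noSep _
      ((noSep_iff (positroid_data X.1 X.2.1).1 X.1 (positroid_data X.1 X.2.1).2.2).1 X.2.2)⟩
  apply Nat.card_eq_of_bijective Φ
  constructor
  · intro X Y hXY
    have hp : ftPerm (positroid_data X.1 X.2.1).1 = ftPerm (positroid_data Y.1 Y.2.1).1 :=
      congrArg Subtype.val hXY
    obtain ⟨h1, n1, b1⟩ := positroid_data X.1 X.2.1
    obtain ⟨h2, n2, b2⟩ := positroid_data Y.1 Y.2.1
    have s1 := (noSep_iff h1 X.1 b1).1 X.2.2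
    have s2 := (noSep_iff h2 Y.1 b2).1 Y.2.2
    have heq := rank_eq_of_perm hn h1 h2 s1 s2 hp
    apply Subtype.ext
    ext B
    rw [b1, b2]
    exact ⟨bases_subset h1 h2 n2 heq B, bases_subset h2 h1 n1 (fun a b => (heq a b).symm) B⟩
  · rintro ⟨π, hπ⟩
    obtain ⟨ℬ, h, hpos, hcon, hperm⟩ := surj_aux π hπ
    exact ⟨⟨ℬ, hpos, hcon⟩, Subtype.ext hperm⟩
end
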